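/- Let q ≡ 7 (mod 8) and r ≡ s ≡ 3 (mod 8) be distinct primes with (q/r) = (q/s) = -1 and (s/r) = 1, and write ε_{2qrs} = a + b√(2qrs) for the fundamental unit of Q(√(2qrs)). If 2q(a-1) is not a perfect square, then the unit index q(F₁) := [E_{F₁} : ⟨-1, ε₂, ε_{qrs}, ε_{2qrs}⟩] of the field F₁ = Q(√(qrs), √2) equals 1, and h₂(F₁) = h₂(2qrs). -/

import Mathlib

open NumberField

/-- The subfield of ℝ generated over ℚ by a set of real numbers. -/
noncomputable def Qadj (S : Set ℝ) : IntermediateField ℚ ℝ := IntermediateField.adjoin ℚ S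

/-- The 2-part of the class number of a subfield of ℝ. -/
noncomputable def h2pow (K : IntermediateField ℚ ℝ) : ℕ :=
  2 ^ ((Nat.card (ClassGroup (𝓞 K))).factorization 2)

/-- The subgroup of the units of 𝓞_K generated by the units lying in the subfields in
`Fs`; for `Fs` the set of quadratic subfields Q(√2), Q(√(qrs)), Q(√(2qrs)) of
F₁ = Q(√(qrs), √2) this subgroup is ⟨-1, ε₂, ε_{qrs}, ε_{2qrs}⟩. -/
noncomputable def subfieldUnits (K : IntermediateField ℚ ℝ)
    (Fs : Set (IntermediateField ℚ ℝ)) : Subgroup (𝓞 K)ˣ :=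
  Subgroup.closure {u : (𝓞 K)ˣ | ∃ F ∈ Fs, ((algebraMap (𝓞 K) K (u : 𝓞 K) : K) : ℝ) ∈ F}


open NumberField

/-- quadratic ring extension data -/
structure QR (A B : Type*) [CommRing A] [CommRing B] [IsDedekindDomain A] [IsDedekindDomain B]
    [Algebra A B] [Module.Finite A B] [Module.IsTorsionFree A B]
    (σ : B ≃+* B) (τ : B) : Prop where
  inv : ∀ x, σ (σ x) = x
  fixA : ∀ a : A, σ (algebraMap A B a) = algebraMap A B a
  fix : ∀ x, σ x = x → ∃ a : A, algebraMap A B a = x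
  conj : σ τ = -τ
  ne : τ ≠ 0
  norm : ∀ x, algebraMap A B (Algebra.intNorm A B x) = x * σ x
  rank : Module.finrank A B = 2

theorem ideal_eq_of_le_of_absNorm {B : Type*} [CommRing B] [IsDedekindDomain B] [Module.Free ℤ B]
    [Module.Finite ℤ B] [CharZero B]
    {I J : Ideal B} (h : I ≤ J) (hn : Ideal.absNorm I = Ideal.absNorm J) (hJ : J ≠ ⊥) : I = J := by
  obtain ⟨K, hK⟩ := Ideal.dvd_iff_le.mpr h
  have h0 : Ideal.absNorm J ≠ 0 := by
    simpa [Ideal.absNorm_eq_zero_iff] using hJ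
  rw [hK, map_mul] at hn
  have : Ideal.absNorm K = 1 := by
    have := Nat.eq_of_mul_eq_mul_left (Nat.pos_of_ne_zero h0) (hn.trans (mul_one _).symm)
    exact this
  rw [Ideal.absNorm_eq_one_iff] at this
  rw [hK, this, Ideal.mul_top]

section gen
variable {B : Type*} [CommRing B] 

theorem map_map_inv (σ : B ≃+* B) (inv : ∀ x, σ (σ x) = x) (I : Ideal B) :
    (I.map σ).map σ = I := by
  change ((I.map (σ : B →+* B)).map (σ : B →+* B)) = I
  rw [Ideal.map_map]
  have : ((σ : B →+* B).comp (σ : B →+* B)) = RingHom.id B := by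
    ext x; simp [inv]
  rw [this, Ideal.map_id]

theorem mem_map_equiv' (σ : B ≃+* B) (inv : ∀ x, σ (σ x) = x) (I : Ideal B) (x : B) :
    x ∈ I.map σ ↔ σ x ∈ I := by
  constructor
  · intro h
    have := Ideal.mem_map_of_mem σ h
    rwa [map_map_inv σ inv] at this
  · intro h
    have := Ideal.mem_map_of_mem σ h
    rwa [inv] at this

theorem map_span_singleton' (σ : B ≃+* B) (x : B) :
    (Ideal.span {x}).map σ = Ideal.span {σ x} := by
  rw [Ideal.map_span, Set.image_singleton]

theorem map_ne_bot' (σ : B ≃+* B) (inv : ∀ x, σ (σ x) = x) {I : Ideal B} (h : I ≠ ⊥) :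
    I.map σ ≠ ⊥ := by
  intro h'
  apply h
  rw [← map_map_inv σ inv I, h', Ideal.map_bot]

theorem absNorm_map_equiv [IsDedekindDomain B] [Module.Free ℤ B]
    [Module.Finite ℤ B] (σ : B ≃+* B) (I : Ideal B) :
    Ideal.absNorm (I.map σ) = Ideal.absNorm I := by
  rw [← Ideal.absNorm_relNorm ℤ B I, ← Ideal.absNorm_relNorm ℤ B (I.map σ)]
  have := Ideal.relNorm_map_algEquiv (R := ℤ) σ.toIntAlgEquiv I
  exact congrArg _ this

/-- Hilbert 90 for ideals -/
theorem H90 [IsDomain B] (σ : B ≃+* B) (inv : ∀ x, σ (σ x) = x) (τ : B) (hτ : τ ≠ 0)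
    (hc : σ τ = -τ) (I : Ideal B) (α β : B) (hα : α ≠ 0)
    (h : Ideal.span {α} * I = Ideal.span {β} * I.map σ) (hn : β * σ β = α * σ α) :
    ∃ δ : B, δ ≠ 0 ∧ α * δ = β * σ δ ∧ (Ideal.span {σ δ} * I).map σ = Ideal.span {σ δ} * I := by
  have key : ∀ δ : B, δ ≠ 0 → α * δ = β * σ δ → 
      (Ideal.span {σ δ} * I).map σ = Ideal.span {σ δ} * I := by
    intro δ hδ hd
    have hcan : Ideal.span {α} * ((Ideal.span {σ δ} * I).map σ) =
        Ideal.span {α} * (Ideal.span {σ δ} * I) := by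
      rw [Ideal.map_mul, map_span_singleton', inv]
      rw [mul_left_comm (Ideal.span {α}) (Ideal.span {σ δ}) I, h, ← mul_assoc, ← mul_assoc,
        Ideal.span_singleton_mul_span_singleton, Ideal.span_singleton_mul_span_singleton, hd,
        mul_comm β]
    exact Ideal.span_singleton_mul_right_injective hα hcan
  by_cases hab : α + β = 0
  · have hb : β = -α := by linear_combination hab
    refine ⟨τ, hτ, ?_, key τ hτ ?_⟩ <;> rw [hc, hb] <;> ring
  · have h1 : α * ((α + β) * σ α) = β * σ ((α + β) * σ α) := by
      rw [map_mul, map_add, inv]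
      linear_combination (-α) * hn
    have h2 : (α + β) * σ α ≠ 0 := mul_ne_zero hab (by simpa using hα)
    exact ⟨_, h2, h1, key _ h2 h1⟩
end gen

section qr
variable {A B : Type*} [CommRing A] [CommRing B] [IsDedekindDomain A] [IsDedekindDomain B]
    [Algebra A B] [Module.Finite A B] [Module.IsTorsionFree A B]
    {σ : B ≃+* B} {τ : B} 

theorem QR.map_relNorm [Module.Free ℤ A] [Module.Free ℤ B] [Module.Finite ℤ A] [Module.Finite ℤ B]
    [CharZero A] [CharZero B] (h : QR A B σ τ) (I : Ideal B) (hI : I ≠ ⊥) :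
    (Ideal.relNorm A I).map (algebraMap A B) = I * I.map σ := by
  have : CharZero (FractionRing A) := inferInstance
  apply ideal_eq_of_le_of_absNorm
  · rw [Ideal.relNorm_apply, Ideal.map_span, Ideal.span_le]
    rintro _ ⟨_, ⟨x, hx, rfl⟩, rfl⟩
    rw [h.norm]
    exact Ideal.mul_mem_mul hx (Ideal.mem_map_of_mem σ hx)
  · rw [Ideal.absNorm_algebraMap, Ideal.absNorm_relNorm, h.rank, map_mul, absNorm_map_equiv, sq]
  · simpa [Ideal.mul_eq_bot] using ⟨hI, map_ne_bot' σ h.inv hI⟩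

theorem QR.unram (h : QR A B σ τ) (P : Ideal B) [hP : P.IsPrime] (hP0 : P ≠ ⊥)
    (hram : P * P ∣ (P.under A).map (algebraMap A B)) (hp0 : P.under A ≠ ⊥) : 2 * τ ∈ P := by
  set p := P.under A with hp
  set M := p.map (algebraMap A B) with hM
  obtain ⟨Q', hQ'⟩ := hram
  set Q := P * Q' with hQ
  have hMQ : M = P * Q := by rw [hQ', mul_assoc]
  have hMP : M ≤ P := by rw [hMQ]; exact Ideal.mul_le_left
  have hM0 : M ≠ ⊥ := by
    intro h0
    apply hp0
    rw [Ideal.map_eq_bot_iff_of_injective] at h0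
    · exact h0
    · exact FaithfulSMul.algebraMap_injective A B
  have hQ0 : Q ≠ ⊥ := by
    intro h0; apply hM0; rw [hMQ, h0]; simp
  have hMσ : ∀ x ∈ M, σ x ∈ M := by
    intro x hx
    have h1 : M.map σ = M := by
      change M.map (σ : B →+* B) = M
      rw [hM, Ideal.map_map]
      congr 1
      ext a; exact h.fixA a
    rw [← h1]; exact Ideal.mem_map_of_mem σ hx
  have hQQ : Q * Q ≤ M := by
    rw [hMQ]
    nth_rewrite 1 [hQ]
    rw [mul_assoc]
    exact Ideal.mul_mono_right Ideal.mul_le_right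
  have tr : ∀ x ∈ Q, x + σ x ∈ M := by
    intro x hx
    obtain ⟨a, ha⟩ := h.fix (x + σ x) (by rw [map_add, h.inv, add_comm])
    have hx2 : x * x ∈ M := hQQ (Ideal.mul_mem_mul hx hx)
    have hx3 : σ (x * x) ∈ M := hMσ _ hx2
    have h3 : (x + σ x) ^ 3 ∈ M := by
      have : (x + σ x) ^ 3 = (x + 3 * σ x) * (x * x) + (3 * x + σ x) * σ (x * x) := by
        rw [map_mul]; ring
      rw [this]
      exact M.add_mem (M.mul_mem_left _ hx2) (M.mul_mem_left _ hx3)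
    have h4 : x + σ x ∈ P := hP.mem_of_pow_mem _ (hMP h3)
    rw [← ha] at h4 ⊢
    exact Ideal.mem_map_of_mem _ (by rw [hp]; exact h4)
  have fin : Ideal.span {2 * τ} * Q ≤ P * Q := by
    rw [← hMQ, Ideal.span_singleton_mul_le_iff]
    intro x hx
    have e : 2 * τ * x = τ * (x + σ x) + (τ * x + σ (τ * x)) := by
      rw [map_mul, h.conj]; ring
    rw [e]
    exact M.add_mem (M.mul_mem_left _ (tr x hx)) (tr _ (Q.mul_mem_left _ hx))
  have : Ideal.span {2 * τ} ≤ P := by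
    rw [← Ideal.dvd_iff_le] at fin ⊢
    exact (mul_dvd_mul_iff_right hQ0).mp fin
  exact this (Ideal.mem_span_singleton_self _)

/-- invariant ideals: decomposition when a unique prime `P₂` may ramify. -/
theorem QR.invariant [Module.Free ℤ A] [Module.Free ℤ B] [Module.Finite ℤ A] [Module.Finite ℤ B]
    [CharZero A] [CharZero B] (h : QR A B σ τ) (P₂ : Ideal B) (hP₂ : P₂ ≠ ⊥) (hP₂σ : P₂.map σ = P₂)
    (hr : ∀ P : Ideal B, P.IsPrime → P ≠ ⊥ → 2 * τ ∈ P → P = P₂) :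
    ∀ I : Ideal B, I ≠ ⊥ → I.map σ = I → ∃ (J : Ideal A) (k : ℕ), J ≠ ⊥ ∧
      I = J.map (algebraMap A B) * P₂ ^ k := by
  have hbot : ∀ J : Ideal A, J.map (algebraMap A B) ≠ ⊥ → J ≠ ⊥ := by
    rintro J hJ rfl; exact hJ Ideal.map_bot
  intro I
  induction hN : Ideal.absNorm I using Nat.strong_induction_on generalizing I with
  | _ n ih =>
  intro hI0 hIσ
  by_cases hI1 : I = ⊤
  · exact ⟨⊤, 0, by exact top_ne_bot, by rw [hI1, Ideal.map_top]; simp⟩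
  -- general step: if M ∣ I with M invariant, M ≠ ⊤, get quotient
  have step : ∀ M : Ideal B, M ∣ I → M ≠ ⊤ → M.map σ = M → 
      ∃ (J : Ideal A) (k : ℕ), J ≠ ⊥ ∧ I = M * (J.map (algebraMap A B) * P₂ ^ k) := by
    rintro M ⟨I', hI'⟩ hM1 hMσ
    have hM0 : M ≠ ⊥ := by rintro rfl; apply hI0; rw [hI']; simp
    have hI'0 : I' ≠ ⊥ := by rintro rfl; apply hI0; rw [hI']; simp
    have hI'σ : I'.map σ = I' := by
      have : M * I'.map σ = M * I' := by
        nth_rewrite 1 [← hMσ]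
        rw [← Ideal.map_mul, ← hI', hIσ]
      exact mul_left_cancel₀ hM0 this
    have hlt : Ideal.absNorm I' < n := by
      rw [← hN, hI', map_mul]
      have h1 : Ideal.absNorm M ≠ 1 := by rwa [Ne, Ideal.absNorm_eq_one_iff]
      have h2 : Ideal.absNorm M ≠ 0 := by rwa [Ne, Ideal.absNorm_eq_zero_iff]
      have h3 : Ideal.absNorm I' ≠ 0 := by rwa [Ne, Ideal.absNorm_eq_zero_iff]
      have h4 : 2 ≤ Ideal.absNorm M := by omega
      nlinarith [Nat.pos_of_ne_zero h3]
    obtain ⟨J, k, hJ, hk⟩ := ih _ hlt I' rfl hI'0 hI'σ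
    exact ⟨J, k, hJ, by rw [hI', hk]⟩
  obtain ⟨P, hPm, hPI⟩ := Ideal.exists_le_maximal I hI1
  have hPp := hPm.isPrime
  have hP0 : P ≠ ⊥ := by rintro rfl; exact hI0 (le_bot_iff.mp hPI)
  have hPd : P ∣ I := Ideal.dvd_iff_le.mpr hPI
  by_cases h2 : 2 * τ ∈ P
  · have := hr P hPp hP0 h2
    obtain ⟨J, k, hJ, hk⟩ := step P₂ (this ▸ hPd) (this ▸ hPp.ne_top) hP₂σ
    exact ⟨J, k + 1, hJ, by rw [hk, pow_succ]; ac_rfl⟩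
  have hNP := h.map_relNorm P hP0
  by_cases hPσ : P.map σ = P
  · -- inert
    obtain ⟨J, k, hJ, hk⟩ := step P hPd hPp.ne_top hPσ
    set p := P.under A with hp
    have hpp : p.IsPrime := inferInstance
    have hPp' : P.LiesOver p := ⟨rfl⟩
    obtain ⟨f, hf⟩ := Ideal.exists_relNorm_eq_pow_of_isPrime P p
    have hp0 : p ≠ ⊥ := Ideal.IsIntegral.comap_ne_bot (R := A) hP0
    rw [hf, hPσ, Ideal.map_pow] at hNP
    have hPprime := Ideal.prime_of_isPrime hP0 hPp
    have hf0 : f ≠ 0 := by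
      rintro rfl
      rw [pow_zero] at hNP
      exact hPprime.not_isUnit (IsUnit.of_mul_eq_one _ hNP.symm)
    have hPdp : p.map (algebraMap A B) ∣ P ^ 2 := by
      rw [sq, ← hNP]; exact dvd_pow_self _ hf0
    obtain ⟨g, hg2, hg⟩ := (dvd_prime_pow hPprime 2).mp hPdp
    rw [associated_iff_eq] at hg
    have hPle : P ∣ p.map (algebraMap A B) := Ideal.dvd_iff_le.mpr Ideal.map_comap_le
    have hg1 : g = 1 := by
      interval_cases g
      · exfalso
        rw [hg, pow_zero] at hPle
        exact hPprime.not_isUnit (isUnit_of_dvd_one hPle)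
      · rfl
      · exfalso
        exact h2 (h.unram P hP0 (by rw [← hp, hg, sq]) hp0)
    rw [hg1, pow_one] at hg
    refine ⟨p * J, k, ?_, ?_⟩
    · simpa [Ideal.mul_eq_bot] using ⟨hp0, hJ⟩
    · rw [hk, Ideal.map_mul, hg, mul_assoc]
  · have hd : P * P.map σ ∣ I := by
      have h1 : P.map σ ∣ I := by
        rw [← hIσ, Ideal.dvd_iff_le]; exact Ideal.map_mono hPI
      obtain ⟨I', hI'⟩ := hPd
      have hPprime := Ideal.prime_of_isPrime hP0 hPp
      have hPσp : (P.map σ).IsPrime := Ideal.map_isPrime_of_equiv σ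
      have hPσ' := Ideal.prime_of_isPrime (map_ne_bot' σ h.inv hP0) hPσp
      rw [hI'] at h1 ⊢
      refine mul_dvd_mul_left _ ((hPσ'.dvd_or_dvd h1).resolve_left ?_)
      intro h3
      apply hPσ
      have := (hPσ'.irreducible.dvd_irreducible_iff_associated hPprime.irreducible).mp h3
      rwa [associated_iff_eq] at this
    have e1 : P * P.map σ ≠ ⊤ := by
      intro ht
      exact hPp.ne_top (top_le_iff.mp (ht ▸ Ideal.mul_le_left))
    have e2 : (P * P.map σ).map σ = P * P.map σ := by
      rw [Ideal.map_mul, map_map_inv σ h.inv, mul_comm]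
    obtain ⟨J, k, hJ, hk⟩ := step _ hd e1 e2
    have e3 : Ideal.relNorm A P ≠ ⊥ := by simpa using hP0
    refine ⟨Ideal.relNorm A P * J, k, ?_, ?_⟩
    · simpa [Ideal.mul_eq_bot] using ⟨hP0, hJ⟩
    · rw [hk, Ideal.map_mul, hNP]; ac_rfl
end qr

open NumberField

theorem descent (p : ℕ) (hp : p.Prime) (A B C : ℤ) (hA : ¬ (p:ℤ) ∣ A) (hB : ¬ (p:ℤ) ∣ B)
    (hC : ¬ (p:ℤ) ∣ C) : ∀ (n : ℕ) (x y z : ℤ), z.natAbs = n → z ≠ 0 →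
    A * z ^ 2 + B * y ^ 2 = p * (C * x ^ 2) → IsSquare (((-(A * B) : ℤ)) : ZMod p) := by
  have := Fact.mk hp
  have hpi : Prime (p:ℤ) := Nat.prime_iff_prime_int.mp hp
  intro n
  induction n using Nat.strong_induction_on with
  | _ n ih =>
  intro x y z hn hz h
  by_cases hzp : (p:ℤ) ∣ z
  · have hyp : (p:ℤ) ∣ y := by
      have : (p:ℤ) ∣ B * y ^ 2 := by
        have e : B * y ^ 2 = p * (C * x ^ 2) - A * z ^ 2 := by linarith
        rw [e]
        exact dvd_sub (dvd_mul_right _ _) (Dvd.dvd.mul_left (dvd_pow hzp two_ne_zero) _)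
      exact hpi.dvd_of_dvd_pow ((hpi.dvd_or_dvd this).resolve_left hB)
    obtain ⟨z', rfl⟩ := hzp
    obtain ⟨y', rfl⟩ := hyp
    have hp0 : (p:ℤ) ≠ 0 := hpi.ne_zero
    have e : (p:ℤ) * (A * z' ^ 2 + B * y' ^ 2) = C * x ^ 2 := by
      apply mul_left_cancel₀ hp0; linear_combination h
    have hxp : (p:ℤ) ∣ x := by
      have : (p:ℤ) ∣ C * x ^ 2 := ⟨_, e.symm⟩
      exact hpi.dvd_of_dvd_pow ((hpi.dvd_or_dvd this).resolve_left hC)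
    obtain ⟨x', rfl⟩ := hxp
    have hz' : z' ≠ 0 := by rintro rfl; simp at hz
    refine ih z'.natAbs ?_ x' y' z' rfl hz' ?_
    · rw [← hn, Int.natAbs_mul, Int.natAbs_natCast]
      have := hp.two_le
      have : 0 < z'.natAbs := Int.natAbs_pos.mpr hz'
      nlinarith
    · apply mul_left_cancel₀ hp0; linear_combination e
  · have hyp : ((y : ℤ) : ZMod p) ≠ 0 := by
      intro hy
      rw [ZMod.intCast_zmod_eq_zero_iff_dvd] at hy
      have : (p:ℤ) ∣ A * z ^ 2 := by
        have e : A * z ^ 2 = p * (C * x ^ 2) - B * y ^ 2 := by linarith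
        rw [e]
        exact dvd_sub (dvd_mul_right _ _) (Dvd.dvd.mul_left (dvd_pow hy two_ne_zero) _)
      exact hzp (hpi.dvd_of_dvd_pow ((hpi.dvd_or_dvd this).resolve_left hA))
    refine ⟨A * z / y, ?_⟩
    have h' := congrArg (fun t : ℤ => (t : ZMod p)) h
    push_cast at h' ⊢
    simp only [CharP.cast_eq_zero, zero_mul] at h'
    field_simp
    linear_combination (-A : ZMod p) * h'

/-- `t` is (up to squares) a norm from `ℚ(√d)`. -/
def IsNm (d t : ℤ) : Prop := ∃ x y z : ℤ, z ≠ 0 ∧ t * z ^ 2 = x ^ 2 - d * y ^ 2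

theorem jac_ne_zero {p : ℕ} (hp : p.Prime) {n : ℤ} : jacobiSym n p ≠ 0 ↔ ¬ (p:ℤ) ∣ n := by
  have := Fact.mk hp
  rw [← jacobiSym.legendreSym.to_jacobiSym, Ne, legendreSym.eq_zero_iff,
    ZMod.intCast_zmod_eq_zero_iff_dvd]

theorem jac_ne_neg_one {p : ℕ} (hp : p.Prime) {n : ℤ} (h : IsSquare (n : ZMod p)) :
    jacobiSym n p ≠ -1 := by
  have := Fact.mk hp
  rw [← jacobiSym.legendreSym.to_jacobiSym, Ne, legendreSym.eq_neg_one_iff]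
  exact fun h' => h' h

theorem gen1 {p : ℕ} (hp : p.Prime) {d' t : ℤ} (h : IsNm (p * d') t) (hd : jacobiSym d' p ≠ 0) :
    jacobiSym t p ≠ -1 := by
  by_cases ht : jacobiSym t p = 0
  · rw [ht]; decide
  obtain ⟨x, y, z, hz, h⟩ := h
  have h1 : ¬ (p:ℤ) ∣ -1 := by
    rw [← jac_ne_zero hp]
    have : jacobiSym (-1) p = ZMod.χ₄ p ∨ p = 2 := by
      rcases hp.eq_two_or_odd with h | h
      · right; exact h
      · left; exact jacobiSym.at_neg_one (Nat.odd_iff.mpr h)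
    rw [jac_ne_zero hp]
    rw [Int.dvd_neg]
    intro h
    exact hp.one_lt.ne' (by simpa using Int.eq_one_of_dvd_one (by positivity) h)
  have := descent p hp t (-1) (-d') ((jac_ne_zero hp).mp ht) h1
    (by rw [dvd_neg]; exact (jac_ne_zero hp).mp hd) _ y x z rfl hz (by linear_combination h)
  apply jac_ne_neg_one hp
  simpa using this

theorem gen2 {p : ℕ} (hp : p.Prime) (hm : jacobiSym (-1) p = -1) {d' t' : ℤ}
    (h : IsNm (p * d') (p * t')) (hd : jacobiSym d' p ≠ 0) (ht : jacobiSym t' p ≠ 0) :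
    jacobiSym t' p * jacobiSym d' p ≠ 1 := by
  obtain ⟨x, y, z, hz, h⟩ := h
  have hpi : Prime (p:ℤ) := Nat.prime_iff_prime_int.mp hp
  have hx : (p:ℤ) ∣ x := by
    apply hpi.dvd_of_dvd_pow (n := 2)
    exact ⟨t' * z ^ 2 + d' * y ^ 2, by linear_combination -h⟩
  obtain ⟨x', rfl⟩ := hx
  have := descent p hp t' d' 1 ((jac_ne_zero hp).mp ht) ((jac_ne_zero hp).mp hd)
    (by intro h; exact hp.one_lt.ne' (by simpa using Int.eq_one_of_dvd_one (by positivity) h))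
    _ x' y z rfl hz (by apply mul_left_cancel₀ hpi.ne_zero; linear_combination h)
  have h2 := jac_ne_neg_one hp this
  rw [neg_eq_neg_one_mul, jacobiSym.mul_left, jacobiSym.mul_left, hm] at h2
  intro h3; apply h2; rw [h3]; rfl

structure Hyp (q r s : ℕ) : Prop where
  hq : q.Prime
  hr : r.Prime
  hs : s.Prime
  hq8 : q % 8 = 7
  hr8 : r % 8 = 3
  hs8 : s % 8 = 3
  q2 : jacobiSym 2 q = 1
  qm : jacobiSym (-1) q = -1
  qr : jacobiSym r q = 1
  qs : jacobiSym s q = 1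
  r2 : jacobiSym 2 r = -1
  rm : jacobiSym (-1) r = -1
  rq : jacobiSym q r = -1
  rs : jacobiSym s r = 1
  s2 : jacobiSym 2 s = -1
  sm : jacobiSym (-1) s = -1
  sq : jacobiSym q s = -1
  sr : jacobiSym r s = -1

theorem Hyp.mk' (q r s : ℕ) (hq : q.Prime) (hr : r.Prime) (hs : s.Prime)
    (hq8 : q % 8 = 7) (hr8 : r % 8 = 3) (hs8 : s % 8 = 3)
    (h1 : @legendreSym r ⟨hr⟩ (q : ℤ) = -1) (h2 : @legendreSym s ⟨hs⟩ (q : ℤ) = -1)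
    (h3 : @legendreSym r ⟨hr⟩ (s : ℤ) = 1) : Hyp q r s := by
  rw [@jacobiSym.legendreSym.to_jacobiSym] at h1 h2 h3
  have oq : Odd q := Nat.odd_iff.mpr (by omega)
  have or : Odd r := Nat.odd_iff.mpr (by omega)
  have os : Odd s := Nat.odd_iff.mpr (by omega)
  refine ⟨hq, hr, hs, hq8, hr8, hs8, ?_, ?_, ?_, ?_, ?_, ?_, h1, h3, ?_, ?_, h2, ?_⟩
  · rw [jacobiSym.at_two oq, ZMod.χ₈_nat_mod_eight, hq8]; rfl
  · rw [jacobiSym.at_neg_one oq, ZMod.χ₄_nat_three_mod_four (by omega)]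
  · rw [jacobiSym.quadratic_reciprocity_three_mod_four (by omega) (by omega), h1]; rfl
  · rw [jacobiSym.quadratic_reciprocity_three_mod_four (by omega) (by omega), h2]; rfl
  · rw [jacobiSym.at_two or, ZMod.χ₈_nat_mod_eight, hr8]; rfl
  · rw [jacobiSym.at_neg_one or, ZMod.χ₄_nat_three_mod_four (by omega)]
  · rw [jacobiSym.at_two os, ZMod.χ₈_nat_mod_eight, hs8]; rfl
  · rw [jacobiSym.at_neg_one os, ZMod.χ₄_nat_three_mod_four (by omega)]
  · rw [jacobiSym.quadratic_reciprocity_three_mod_four (by omega) (by omega), h3]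

theorem dvd_cases {q r s n : ℕ} (h : Hyp q r s) (hn : n ∣ 2 * (q * r * s)) :
    ∃ a b c e : Bool, n = 2 ^ a.toNat * q ^ b.toNat * r ^ c.toNat * s ^ e.toNat := by
  obtain ⟨x, y0, hx, hy0, rfl⟩ := (Nat.dvd_mul).mp hn
  obtain ⟨y1, w, hy1, hw, rfl⟩ := (Nat.dvd_mul).mp hy0
  obtain ⟨y, z, hy, hz, rfl⟩ := (Nat.dvd_mul).mp hy1
  have key : ∀ p x : ℕ, p.Prime → x ∣ p → ∃ a : Bool, x = p ^ a.toNat := by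
    intro p x hp hx
    rcases (Nat.dvd_prime hp).mp hx with h | h
    · exact ⟨false, by simp [h]⟩
    · exact ⟨true, by simp [h]⟩
  obtain ⟨a, rfl⟩ := key _ _ Nat.prime_two hx
  obtain ⟨b, rfl⟩ := key _ _ h.hq hy
  obtain ⟨c, rfl⟩ := key _ _ h.hr hz
  obtain ⟨e, rfl⟩ := key _ _ h.hs hw
  exact ⟨a, b, c, e, by ring⟩

theorem jac_pow_bool (x : ℤ) (p : ℕ) (b : Bool) : jacobiSym (x ^ b.toNat) p =
    if b then jacobiSym x p else 1 := by
  cases b <;> simp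

/-- sign, with `true` being negative -/
def sg (b : Bool) : ℤ := if b then -1 else 1

theorem jac_sg (p : ℕ) (b : Bool) : jacobiSym (sg b) p = if b then jacobiSym (-1) p else 1 := by
  cases b <;> simp [sg]

def tv (q r s : ℕ) (g a b c e : Bool) : ℤ :=
  sg g * (2:ℤ) ^ a.toNat * (q:ℤ) ^ b.toNat * (r:ℤ) ^ c.toNat * (s:ℤ) ^ e.toNat

theorem gen3 {p : ℕ} (hp : p.Prime) (hm : jacobiSym (-1) p = -1) {d' t' : ℤ} (b g f : Bool)
    (h : IsNm (p * d') (p ^ b.toNat * t')) (hd : jacobiSym d' p = sg f) 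
    (ht : jacobiSym t' p = sg g) : g = (b && !f) := by
  cases b
  · rw [Bool.toNat_false, pow_zero, one_mul] at h
    have := gen1 hp h (by rw [hd]; cases f <;> decide)
    rw [ht] at this
    cases g
    · rfl
    · exact absurd rfl this
  · rw [Bool.toNat_true, pow_one] at h
    have := gen2 hp hm h (by rw [hd]; cases f <;> decide) (by rw [ht]; cases g <;> decide)
    rw [ht, hd] at this
    revert this
    cases f <;> cases g <;> decide

theorem IsNm.even_case {q r s : ℕ} (h : Hyp q r s) {g a b c e : Bool} (u : ℤ) (x y z : Bool)
    (hq : jacobiSym u q = sg x) (hr : jacobiSym u r = sg y) (hs : jacobiSym u s = sg z)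
    (hD : IsNm (2 * (q * r * s)) (u * tv q r s g a b c e)) :
    x = (g ^^ b) ∧ y = (g ^^ a ^^ b ^^ c) ∧ z = (g ^^ a ^^ b ^^ c) := by
  refine ⟨?_, ?_, ?_⟩
  · have eq : (2 * (q * r * s) : ℤ) = q * (2 * r * s) := by ring
    have et : u * tv q r s g a b c e =
      q ^ b.toNat * (u * sg g * 2 ^ a.toNat * r ^ c.toNat * s ^ e.toNat) := by rw [tv]; ring
    rw [eq, et] at hD
    have := gen3 h.hq h.qm b (x ^^ g) false hD
      (by simp only [jacobiSym.mul_left, h.q2, h.qr, h.qs]; rfl)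
      (by simp only [jacobiSym.mul_left, h.q2, h.qr, h.qs, h.qm, hq, jac_sg, jac_pow_bool]
          cases x <;> cases g <;> simp [sg])
    revert this; cases x <;> cases g <;> cases b <;> simp
  · have eq : (2 * (q * r * s) : ℤ) = r * (2 * q * s) := by ring
    have et : u * tv q r s g a b c e =
      r ^ c.toNat * (u * sg g * 2 ^ a.toNat * q ^ b.toNat * s ^ e.toNat) := by rw [tv]; ring
    rw [eq, et] at hD
    have := gen3 h.hr h.rm c (y ^^ g ^^ a ^^ b) false hD
      (by simp only [jacobiSym.mul_left, h.r2, h.rq, h.rs]; rfl)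
      (by simp only [jacobiSym.mul_left, h.r2, h.rq, h.rs, h.rm, hr, jac_sg, jac_pow_bool]
          cases y <;> cases g <;> cases a <;> cases b <;> simp [sg])
    revert this; cases y <;> cases g <;> cases a <;> cases b <;> cases c <;> simp
  · have eq : (2 * (q * r * s) : ℤ) = s * (2 * q * r) := by ring
    have et : u * tv q r s g a b c e =
      s ^ e.toNat * (u * sg g * 2 ^ a.toNat * q ^ b.toNat * r ^ c.toNat) := by rw [tv]; ring
    rw [eq, et] at hD
    have := gen3 h.hs h.sm e (z ^^ g ^^ a ^^ b ^^ c) true hD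
      (by simp only [jacobiSym.mul_left, h.s2, h.sq, h.sr]; rfl)
      (by simp only [jacobiSym.mul_left, h.s2, h.sq, h.sr, h.sm, hs, jac_sg, jac_pow_bool]
          cases z <;> cases g <;> cases a <;> cases b <;> cases c <;> simp [sg])
    revert this; cases z <;> cases g <;> cases a <;> cases b <;> cases c <;> simp

theorem IsNm.odd_case {q r s : ℕ} (h : Hyp q r s) {g a b c e : Bool}
    (hD : IsNm (q * r * s) (tv q r s g a b c e)) :
    g = b ∧ a = false ∧ c = e := by
  have h1 : g = b := by
    have eq : (q * r * s : ℤ) = q * (r * s) := by ring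
    have et : tv q r s g a b c e =
      q ^ b.toNat * (sg g * 2 ^ a.toNat * r ^ c.toNat * s ^ e.toNat) := by rw [tv]; ring
    rw [eq, et] at hD
    have := gen3 h.hq h.qm b g false hD
      (by simp only [jacobiSym.mul_left, h.qr, h.qs]; rfl)
      (by simp only [jacobiSym.mul_left, h.q2, h.qr, h.qs, h.qm, jac_sg, jac_pow_bool]
          cases g <;> simp [sg])
    simpa using this
  have h2 : (g ^^ a ^^ b) = false := by
    have eq : (q * r * s : ℤ) = r * (q * s) := by ring
    have et : tv q r s g a b c e =
      r ^ c.toNat * (sg g * 2 ^ a.toNat * q ^ b.toNat * s ^ e.toNat) := by rw [tv]; ring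
    rw [eq, et] at hD
    have := gen3 h.hr h.rm c (g ^^ a ^^ b) true hD
      (by simp only [jacobiSym.mul_left, h.rq, h.rs]; rfl)
      (by simp only [jacobiSym.mul_left, h.r2, h.rq, h.rs, h.rm, jac_sg, jac_pow_bool]
          cases g <;> cases a <;> cases b <;> simp [sg])
    simpa using this
  have h3 : (g ^^ a ^^ b ^^ c) = e := by
    have eq : (q * r * s : ℤ) = s * (q * r) := by ring
    have et : tv q r s g a b c e =
      s ^ e.toNat * (sg g * 2 ^ a.toNat * q ^ b.toNat * r ^ c.toNat) := by rw [tv]; ring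
    rw [eq, et] at hD
    have := gen3 h.hs h.sm e (g ^^ a ^^ b ^^ c) false hD
      (by simp only [jacobiSym.mul_left, h.sq, h.sr]; rfl)
      (by simp only [jacobiSym.mul_left, h.s2, h.sq, h.sr, h.sm, jac_sg, jac_pow_bool]
          cases g <;> cases a <;> cases b <;> cases c <;> simp [sg])
    simpa using this
  revert h1 h2 h3
  cases g <;> cases a <;> cases b <;> cases c <;> cases e <;> simp

theorem IsNm.even_case1 {q r s : ℕ} (h : Hyp q r s) {g a b c e : Bool}
    (hD : IsNm (2 * (q * r * s)) (tv q r s g a b c e)) : g = b ∧ a = c := by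
  have := IsNm.even_case h 1 false false false (by simp [sg]) (by simp [sg]) (by simp [sg])
    (by rw [one_mul]; exact hD) (g := g) (a := a) (b := b) (c := c) (e := e)
  revert this
  cases g <;> cases a <;> cases b <;> cases c <;> simp

open NumberField

theorem sq_dvd_sqf {d k b : ℤ} (hd : Squarefree d) (hk : k ≠ 0) (h : k ^ 2 ∣ d * b ^ 2) : k ∣ b := by
  have hg : 0 < Int.gcd k b := Int.gcd_pos_of_ne_zero_left _ hk
  obtain ⟨k', b', hc, hk', hb'⟩ := Int.exists_gcd_one hg
  rw [← Int.isCoprime_iff_gcd_eq_one] at hc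
  set g : ℤ := (Int.gcd k b : ℤ)
  have hg0 : g ≠ 0 := by positivity
  have h1 : k' ^ 2 ∣ d * b' ^ 2 := by
    obtain ⟨w, hw⟩ := h
    refine ⟨w, ?_⟩
    apply mul_left_cancel₀ (pow_ne_zero 2 hg0)
    rw [hk', hb'] at hw
    linear_combination hw
  have h2 : k' ^ 2 ∣ d := (hc.pow).dvd_of_dvd_mul_right h1
  have h3 : IsUnit k' := hd k' (by rwa [← sq])
  rw [hk', hb']
  exact mul_dvd_mul (h3.dvd) dvd_rfl

theorem sqf_part (n : ℤ) (hn : 0 < n) : ∃ m k : ℤ, 0 < m ∧ k ≠ 0 ∧ Squarefree m ∧ n = m * k ^ 2 := by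
  obtain ⟨n, rfl⟩ := Int.eq_ofNat_of_zero_le hn.le
  obtain ⟨m, k, h, h2⟩ := Nat.sq_mul_squarefree n
  have hn' : n ≠ 0 := by rintro rfl; simp at hn
  refine ⟨m, k, ?_, ?_, Int.squarefree_natCast.mpr h2, ?_⟩
  · rcases Nat.eq_zero_or_pos m with h0 | h0
    · simp [h0] at h; omega
    · exact_mod_cast h0
  · rintro h0
    have : k = 0 := by exact_mod_cast h0
    simp [this] at h; omega
  · rw [← h]; push_cast; ring

theorem sqf_dvd {n d : ℕ} (hn : Squarefree n) (h : ∀ p : ℕ, p.Prime → p ∣ n → p ∣ d) : n ∣ d := by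
  rw [← Nat.prod_primeFactors_of_squarefree hn]
  apply Finset.prod_primes_dvd
  · intro p hp; exact (Nat.prime_of_mem_primeFactors hp).prime
  · intro p hp; exact h p (Nat.prime_of_mem_primeFactors hp) (Nat.dvd_of_mem_primeFactors hp)

theorem fund_n {d : ℤ} (hd : Squarefree d) (E : Pell.Solution₁ d) (hE : Pell.IsFundamental E) :
    ∃ n : ℕ, ∃ k : ℤ, 0 < n ∧ k ≠ 0 ∧ n ≠ 1 ∧ 2 * (E.x + 1) = n * k ^ 2 ∧
      (∀ p : ℕ, p.Prime → p ∣ n → (p:ℤ) ∣ 2 * d) ∧ Squarefree n := by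
  have hx := hE.1
  have hy := hE.2.1
  have hd0 := hE.d_pos
  obtain ⟨n, k, hn, hk, hsq, h⟩ := sqf_part (2 * (E.x + 1)) (by linarith)
  obtain ⟨n, rfl⟩ := Int.eq_ofNat_of_zero_le hn.le
  refine ⟨n, k, by simpa using hn, hk, ?_, h, ?_, Int.squarefree_natCast.mp hsq⟩
  · rintro rfl
    have hk2 : (2:ℤ) ∣ k := by
      apply Int.prime_two.dvd_of_dvd_pow (n := 2)
      exact ⟨E.x + 1, by simpa using h.symm⟩
    obtain ⟨k', rfl⟩ := hk2
    have hk0 : k' ≠ 0 := by rintro rfl; simp at hk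
    have ex : E.x = 2 * k' ^ 2 - 1 := by push_cast at h; linarith
    have e := E.prop_y
    rw [ex] at e
    have : 2 * k' ∣ E.y := sq_dvd_sqf hd hk ⟨k' ^ 2 - 1, by rw [e]; ring⟩
    obtain ⟨b', hb'⟩ := this
    have e2 : k' ^ 2 - d * b' ^ 2 = 1 := by
      rw [hb'] at e
      apply mul_left_cancel₀ (pow_ne_zero 2 hk)
      linear_combination -e
    have e3 : |k'| ^ 2 - d * b' ^ 2 = 1 := by rw [sq_abs]; exact e2
    have hb0 : b' ≠ 0 := by rintro rfl; simp at hb'; omega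
    have hb2 : 0 < b' ^ 2 := by positivity
    have hk1 : 1 < |k'| := by
      have h5 : 1 < |k'| ^ 2 := by nlinarith
      have h6 := abs_nonneg k'
      nlinarith
    have := hE.x_le_x (a := Pell.Solution₁.mk |k'| b' e3) (by simpa using hk1)
    rw [Pell.Solution₁.x_mk, ex, ← sq_abs] at this
    nlinarith
  · intro p hp hpn
    by_contra hpd
    have hpi : Prime (p:ℤ) := Nat.prime_iff_prime_int.mp hp
    have e := E.prop_y
    have e1 : (n : ℤ) * k ^ 2 * (2 * (E.x - 1)) = d * (2 * E.y) ^ 2 := by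
      rw [← h]; linear_combination -4 * e
    have h1 : k ∣ 2 * E.y := sq_dvd_sqf hd hk ⟨n * (2 * (E.x - 1)), by rw [← e1]; ring⟩
    obtain ⟨y', hy'⟩ := h1
    rw [hy'] at e1
    have e2 : (n : ℤ) * (2 * (E.x - 1)) = d * y' ^ 2 := by
      apply mul_left_cancel₀ (pow_ne_zero 2 hk)
      linear_combination e1
    have hpn' : (p:ℤ) ∣ n := by exact_mod_cast hpn
    have h2 : (p:ℤ) ∣ y' := by
      have : (p:ℤ) ∣ d * y' ^ 2 := by rw [← e2]; exact Dvd.dvd.mul_right hpn' _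
      refine hpi.dvd_of_dvd_pow ((hpi.dvd_or_dvd this).resolve_left ?_)
      intro h; exact hpd (Dvd.dvd.mul_left h _)
    obtain ⟨n', hn'⟩ := hpn'
    have h3 : (p:ℤ) ∣ n' * (2 * (E.x - 1)) := by
      obtain ⟨y'', rfl⟩ := h2
      refine ⟨d * y'' ^ 2, ?_⟩
      apply mul_left_cancel₀ hpi.ne_zero
      rw [hn'] at e2; linear_combination e2
    rcases hpi.dvd_or_dvd h3 with h4 | h4
    · obtain ⟨w, rfl⟩ := h4
      exact hpi.not_isUnit (hsq _ ⟨w, by rw [hn']; ring⟩)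
    · have h5 : (p:ℤ) ∣ 2 * (E.x + 1) := by rw [h, hn']; exact ⟨n' * k^2, by ring⟩
      have h6 : (p:ℤ) ∣ 2 * 2 := by
        have := dvd_sub h5 h4
        ring_nf at this ⊢
        exact this
      apply hpd
      rcases hpi.dvd_or_dvd h6 with h | h <;> exact Dvd.dvd.mul_right h _

theorem Hyp.ne {q r s : ℕ} (h : Hyp q r s) : q ≠ r ∧ q ≠ s ∧ r ≠ s ∧ q ≠ 2 ∧ r ≠ 2 ∧ s ≠ 2 := by
  have h1 := h.hq8
  have h2 := h.hr8
  have h3 := h.hs8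
  have : r ≠ s := by
    rintro rfl
    have := h.rs
    have h5 := h.sr
    omega
  omega

theorem Hyp.sqf {q r s : ℕ} (h : Hyp q r s) : Squarefree (2 * (q * r * s)) := by
  obtain ⟨h1, h2, h3, h4, h5, h6⟩ := h.ne
  have c1 := (Nat.coprime_primes h.hq h.hr).mpr h1
  have c2 := (Nat.coprime_primes h.hq h.hs).mpr h2
  have c3 := (Nat.coprime_primes h.hr h.hs).mpr h3
  have c4 := (Nat.coprime_primes Nat.prime_two h.hq).mpr h4.symm
  have c5 := (Nat.coprime_primes Nat.prime_two h.hr).mpr h5.symm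
  have c6 := (Nat.coprime_primes Nat.prime_two h.hs).mpr h6.symm
  rw [Nat.squarefree_mul (Nat.Coprime.mul_right (Nat.Coprime.mul_right c4 c5) c6), 
    Nat.squarefree_mul (Nat.Coprime.mul_left c2 c3), Nat.squarefree_mul c1]
  exact ⟨Nat.prime_two.squarefree, ⟨h.hq.squarefree, h.hr.squarefree⟩, h.hs.squarefree⟩

theorem Hyp.fund2 {q r s : ℕ} (h : Hyp q r s) (E : Pell.Solution₁ (q * r * s : ℤ))
    (hE : Pell.IsFundamental E) : ∃ k : ℤ, k ≠ 0 ∧ 2 * (E.x + 1) = (r * s) * k ^ 2 := by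
  have hsq : Squarefree (q * r * s : ℤ) := by
    have := h.sqf.of_mul_right
    rw [← Int.squarefree_natCast] at this
    exact_mod_cast this
  obtain ⟨n, k, hn, hk, hn1, e, hp, hsn⟩ := fund_n hsq E hE
  have hdvd : n ∣ 2 * (q * r * s) := sqf_dvd hsn (fun p h1 h2 => by exact_mod_cast hp p h1 h2)
  obtain ⟨a, b, c, e', rfl⟩ := dvd_cases h hdvd
  have hD : IsNm (q * r * s) (tv q r s false a b c e') := by
    refine ⟨1 + E.x, E.y, k, hk, ?_⟩
    have := E.prop
    push_cast at e
    simp only [tv, sg]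
    simp only [Bool.false_eq_true, if_false]
    linear_combination -this - e
  obtain ⟨rfl, rfl, rfl⟩ := hD.odd_case h
  cases c
  · simp at hn1
  · exact ⟨k, hk, by simpa using e⟩

theorem Hyp.fund3 {q r s : ℕ} (h : Hyp q r s) (E : Pell.Solution₁ (2 * (q * r * s) : ℤ))
    (hE : Pell.IsFundamental E) (hns : ¬ IsSquare (2 * q * (E.x - 1))) :
    ∃ k : ℤ, k ≠ 0 ∧ (2 * (E.x + 1) = s * k ^ 2 ∨ 2 * (E.x + 1) = (2 * r) * k ^ 2) := by
  have hsq : Squarefree (2 * (q * r * s) : ℤ) := by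
    have := h.sqf
    rw [← Int.squarefree_natCast] at this
    exact_mod_cast this
  obtain ⟨n, k, hn, hk, hn1, e, hp, hsn⟩ := fund_n hsq E hE
  have hdvd : n ∣ 2 * (q * r * s) := sqf_dvd hsn (fun p h1 h2 => by
    have := hp p h1 h2
    have h3 : p ∣ 2 * (2 * (q * r * s)) := by exact_mod_cast this
    rcases (h1.dvd_mul).mp h3 with h | h
    · exact Dvd.dvd.mul_right h _
    · exact h)
  obtain ⟨a, b, c, e', rfl⟩ := dvd_cases h hdvd
  have hD : IsNm (2 * (q * r * s)) (tv q r s false a b c e') := by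
    refine ⟨1 + E.x, E.y, k, hk, ?_⟩
    have := E.prop
    push_cast at e
    simp only [tv, sg]
    simp only [Bool.false_eq_true, if_false]
    linear_combination -this - e
  obtain ⟨rfl, rfl⟩ := hD.even_case1 h
  cases a <;> cases e'
  · simp at hn1
  · exact ⟨k, hk, Or.inl (by simpa using e)⟩
  · exact ⟨k, hk, Or.inr (by simpa using e)⟩
  · exfalso
    apply hns
    simp at e
    have hr0 : (r:ℤ) ≠ 0 := by exact_mod_cast h.hr.ne_zero
    have hs0 : (s:ℤ) ≠ 0 := by exact_mod_cast h.hs.ne_zero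
    have e1 : (E.x - 1) * k ^ 2 = 2 * q * E.y ^ 2 := by
      have := E.prop
      have h2 : (2 * r * s : ℤ) ≠ 0 := by positivity
      apply mul_left_cancel₀ h2
      linear_combination -(E.x - 1) * e + 2 * this
    have : k ∣ 2 * q * E.y := by
      rw [← Int.pow_dvd_pow_iff two_ne_zero]
      exact ⟨2 * q * (E.x - 1), by linear_combination (-2 * q) * e1⟩
    obtain ⟨w, hw⟩ := this
    refine ⟨w, ?_⟩
    apply mul_left_cancel₀ (pow_ne_zero 2 hk)
    linear_combination (2 * q) * e1 + (2 * q * E.y + k * w) * hw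

theorem Hyp.aux_prime {q r s : ℕ} (h : Hyp q r s) : ∃ p : ℕ, p.Prime ∧ p % 8 = 1 ∧
    jacobiSym p q = sg true ∧ jacobiSym p r = sg true ∧ jacobiSym p s = sg false ∧
    IsSquare (2 : ZMod p) ∧ IsSquare ((q * r * s : ℕ) : ZMod p) := by
  obtain ⟨h1, h2, h3, h4, h5, h6⟩ := h.ne
  have c1 := (Nat.coprime_primes h.hq h.hr).mpr h1
  have c2 := (Nat.coprime_primes h.hq h.hs).mpr h2
  have c3 := (Nat.coprime_primes h.hr h.hs).mpr h3
  have c4 := (Nat.coprime_primes Nat.prime_two h.hq).mpr h4.symm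
  have c5 := (Nat.coprime_primes Nat.prime_two h.hr).mpr h5.symm
  have hc : Nat.Coprime (2 ^ 3 * s) (q * r) := by
    simp only [Nat.coprime_mul_iff_left, Nat.coprime_mul_iff_right]
    exact ⟨⟨c4.pow_left _, c2.symm⟩, c5.pow_left _, c3.symm⟩
  obtain ⟨k, hk1, hk2⟩ := Nat.chineseRemainder hc 1 (q * r - 1)
  have hqr : 0 < q * r := Nat.mul_pos h.hq.pos h.hr.pos
  have hk2' : (k : ℤ) ≡ -1 [ZMOD (q * r : ℕ)] := by
    have := Int.natCast_modEq_iff.mpr hk2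
    refine this.trans ?_
    rw [Nat.cast_sub hqr]
    refine (Int.modEq_iff_dvd.mpr ?_)
    exact ⟨-1, by push_cast; ring⟩
  have hk1' : (k : ℤ) ≡ 1 [ZMOD (2 ^ 3 * s : ℕ)] := by
    have := Int.natCast_modEq_iff.mpr hk1
    exact_mod_cast this
  have hu1 : IsCoprime (k:ℤ) (2 ^ 3 * s : ℕ) := by
    obtain ⟨w, hw⟩ := hk1'.dvd
    exact ⟨1, w, by linarith⟩
  have hu2 : IsCoprime (k:ℤ) (q * r : ℕ) := by
    obtain ⟨w, hw⟩ := hk2'.dvd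
    exact ⟨-1, -w, by linarith⟩
  have hu : Nat.Coprime k (2 ^ 3 * s * (q * r)) := by
    rw [← Nat.isCoprime_iff_coprime]
    push_cast at hu1 hu2 ⊢
    exact hu1.mul_right hu2
  have hne : NeZero (2 ^ 3 * s * (q * r)) := ⟨by
    have := h.hs.pos; positivity⟩
  obtain ⟨p, -, hp, hpk⟩ := Nat.forall_exists_prime_gt_and_eq_mod
    (q := 2 ^ 3 * s * (q * r)) (a := (k : ZMod _)) ((ZMod.isUnit_iff_coprime _ _).mpr hu) 0
  have hpk' : (p : ℤ) ≡ k [ZMOD (2 ^ 3 * s * (q * r) : ℕ)] := by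
    rw [ZMod.natCast_eq_natCast_iff] at hpk
    exact Int.natCast_modEq_iff.mpr hpk
  have p1 : (p : ℤ) ≡ 1 [ZMOD (2 ^ 3 * s : ℕ)] :=
    (hpk'.of_dvd (by exact_mod_cast dvd_mul_right _ _)).trans hk1'
  have p2 : (p : ℤ) ≡ -1 [ZMOD (q * r : ℕ)] :=
    (hpk'.of_dvd (by exact_mod_cast dvd_mul_left _ _)).trans hk2'
  have p8 : (p : ℤ) ≡ 1 [ZMOD 8] := p1.of_dvd (by push_cast; exact ⟨s, by ring⟩)
  have ps : (p : ℤ) ≡ 1 [ZMOD s] := p1.of_dvd (by push_cast; exact ⟨8, by ring⟩)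
  have pq : (p : ℤ) ≡ -1 [ZMOD q] := p2.of_dvd (by push_cast; exact ⟨r, by ring⟩)
  have pr : (p : ℤ) ≡ -1 [ZMOD r] := p2.of_dvd (by push_cast; exact ⟨q, by ring⟩)
  have hp8 : p % 8 = 1 := by
    have := p8.eq
    omega
  have jq : jacobiSym p q = -1 := by rw [jacobiSym.mod_left' pq, h.qm]
  have jr : jacobiSym p r = -1 := by rw [jacobiSym.mod_left' pr, h.rm]
  have js : jacobiSym p s = 1 := by rw [jacobiSym.mod_left' ps, jacobiSym.one_left]
  have hpf := Fact.mk hp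
  have hpo : Odd p := Nat.odd_iff.mpr (by omega)
  refine ⟨p, hp, hp8, jq, jr, js, ?_, ?_⟩
  · rw [ZMod.exists_sq_eq_two_iff (by omega)]; left; exact hp8
  · have oq : Odd q := Nat.odd_iff.mpr (by have := h.hq8; omega)
    have or : Odd r := Nat.odd_iff.mpr (by have := h.hr8; omega)
    have os : Odd s := Nat.odd_iff.mpr (by have := h.hs8; omega)
    have J : jacobiSym ((q * r * s : ℕ) : ℤ) p = 1 := by
      push_cast
      rw [jacobiSym.mul_left, jacobiSym.mul_left,
       jacobiSym.quadratic_reciprocity_one_mod_four' oq (by omega), 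
       jacobiSym.quadratic_reciprocity_one_mod_four' or (by omega),
       jacobiSym.quadratic_reciprocity_one_mod_four' os (by omega), jq, jr, js]; rfl
    have hnd : (((q * r * s : ℕ) : ℤ) : ZMod p) ≠ 0 := by
      rw [Ne, ZMod.intCast_zmod_eq_zero_iff_dvd]
      exact (jac_ne_zero hp).mp (by rw [J]; decide)
    rw [← jacobiSym.legendreSym.to_jacobiSym, legendreSym.eq_one_iff p hnd] at J
    exact_mod_cast J

open NumberField

structure Quad (K L : Type*) [Field K] [Field L] [Algebra K L] (σ : L ≃+* L) (τ : L) (t : K) :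
    Prop where
  sq : τ ^ 2 = algebraMap K L t
  fixK : ∀ a : K, σ (algebraMap K L a) = algebraMap K L a
  conj : σ τ = -τ
  ne : τ ≠ 0
  span : ∀ x : L, ∃ a b : K, x = algebraMap K L a + algebraMap K L b * τ

section quad
variable {K L : Type*} [Field K] [Field L] [Algebra K L] {σ : L ≃+* L} {τ : L} {t : K}

theorem finrank_two_of_span (hτ : ∀ a : K, τ ≠ algebraMap K L a)
    (span : ∀ x : L, ∃ a b : K, x = algebraMap K L a + algebraMap K L b * τ) :
    Module.finrank K L = 2 := by
  have li : LinearIndependent K ![(1 : L), τ] := by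
    rw [LinearIndependent.pair_iff]
    intro a b h
    rw [Algebra.smul_def, Algebra.smul_def, mul_one] at h
    have hb : b = 0 := by
      by_contra hb
      apply hτ (-a / b)
      have hb' : algebraMap K L b ≠ 0 := by simpa using hb
      rw [map_div₀, eq_div_iff hb', map_neg]
      linear_combination h
    subst hb
    simpa using h
  have sp : ⊤ ≤ Submodule.span K (Set.range ![(1 : L), τ]) := by
    intro x _
    obtain ⟨a, b, rfl⟩ := span x
    rw [Matrix.range_cons, Matrix.range_cons, Matrix.range_empty, Set.union_empty]
    rw [show ({1} ∪ {τ} : Set L) = {1, τ} from rfl, Submodule.mem_span_pair]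
    exact ⟨a, b, by rw [Algebra.smul_def, Algebra.smul_def, mul_one]⟩
  rw [Module.finrank_eq_card_basis (Module.Basis.mk li sp)]
  simp

theorem Quad.exists_of [CharZero K] (hsq : τ ^ 2 = algebraMap K L t)
    (hτ : ∀ a : K, τ ≠ algebraMap K L a)
    (span : ∀ x : L, ∃ a b : K, x = algebraMap K L a + algebraMap K L b * τ) :
    ∃ σ, Quad K L σ τ t := by
  have hr := finrank_two_of_span hτ span
  have : FiniteDimensional K L := Module.finite_of_finrank_eq_succ hr
  have : Algebra.IsQuadraticExtension K L := ⟨hr⟩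
  have hc := IsGalois.card_aut_eq_finrank K L
  rw [hr] at hc
  have : Finite Gal(L/K) := Nat.finite_of_card_ne_zero (by omega)
  have hnt : Nontrivial Gal(L/K) := Finite.one_lt_card_iff_nontrivial.mp (by omega)
  obtain ⟨σ, hσ⟩ := exists_ne (1 : Gal(L/K))
  refine ⟨σ.toRingEquiv, hsq, σ.commutes, ?_, ?_, span⟩
  · have h1 : (σ τ) ^ 2 = τ ^ 2 := by rw [← map_pow, hsq, σ.commutes]
    rcases sq_eq_sq_iff_eq_or_eq_neg.mp h1 with h | h
    · exfalso
      apply hσ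
      ext x
      obtain ⟨a, b, rfl⟩ := span x
      simp [h]
    · exact h
  · rintro rfl
    exact hτ 0 (by simp)

theorem Quad.notK [CharZero K] (h : Quad K L σ τ t) (a : K) : τ ≠ algebraMap K L a := by
  have : CharZero L := charZero_of_injective_algebraMap (algebraMap K L).injective
  intro h'
  have := h.conj
  rw [h', h.fixK, ← h'] at this
  exact h.ne (self_eq_neg.mp this)

theorem Quad.inv (h : Quad K L σ τ t) (x : L) : σ (σ x) = x := by
  obtain ⟨a, b, rfl⟩ := h.span x
  simp [h.fixK, h.conj]

theorem Quad.fix [CharZero K] (h : Quad K L σ τ t) (x : L) (hx : σ x = x) :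
    ∃ a : K, algebraMap K L a = x := by
  have : CharZero L := charZero_of_injective_algebraMap (algebraMap K L).injective
  obtain ⟨a, b, rfl⟩ := h.span x
  simp only [map_add, map_mul, h.fixK, h.conj] at hx
  have h1 : algebraMap K L b * τ = 0 := by
    have : 2 * (algebraMap K L b * τ) = 0 := by linear_combination -hx
    simpa using this
  exact ⟨a, by rw [h1, add_zero]⟩

theorem Quad.finrank [CharZero K] (h : Quad K L σ τ t) : Module.finrank K L = 2 :=
  finrank_two_of_span h.notK h.span

theorem Quad.norm [CharZero K] (h : Quad K L σ τ t) (x : L) :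
    algebraMap K L (Algebra.norm K x) = x * σ x := by
  have hr := h.finrank
  have : FiniteDimensional K L := Module.finite_of_finrank_eq_succ hr
  have : Algebra.IsQuadraticExtension K L := ⟨hr⟩
  have hc := IsGalois.card_aut_eq_finrank K L
  rw [hr, Nat.card_eq_fintype_card] at hc
  let σ' : Gal(L/K) := AlgEquiv.ofRingEquiv (f := σ) h.fixK
  have hσ' : 1 ≠ σ' := by
    intro h1
    have h2 := congrArg (fun f : Gal(L/K) => f τ) h1
    have h3 : τ = σ τ := h2
    rw [h.conj] at h3
    have : CharZero L := charZero_of_injective_algebraMap (algebraMap K L).injective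
    exact h.ne (self_eq_neg.mp h3)
  classical
  have hu : (Finset.univ : Finset Gal(L/K)) = {1, σ'} := by
    symm
    apply Finset.eq_univ_of_card
    rw [Finset.card_pair hσ', hc]
  rw [Algebra.norm_eq_prod_automorphisms, hu, Finset.prod_pair hσ']
  rfl

theorem Quad.toQR {A B : Type*} [CommRing A] [CommRing B] [IsDedekindDomain A] [IsDedekindDomain B]
    [Algebra A B] [Module.Finite A B] [Module.IsTorsionFree A B]
    [Algebra A K] [IsFractionRing A K] [Algebra A L] [IsScalarTower A K L] [Algebra B L] 
    [IsFractionRing B L] 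
    [IsScalarTower A B L] [IsIntegralClosure B A L] [CharZero K] (h : Quad K L σ τ t)
    (σ' : B ≃+* B) (hσ' : ∀ x, algebraMap B L (σ' x) = σ (algebraMap B L x))
    (τ' : B) (hτ' : algebraMap B L τ' = τ) : QR A B σ' τ' := by
  have hr := h.finrank
  have : FiniteDimensional K L := Module.finite_of_finrank_eq_succ hr
  have hinj : Function.Injective (algebraMap B L) := FaithfulSMul.algebraMap_injective B L
  have tow : ∀ a : A, algebraMap B L (algebraMap A B a) = algebraMap K L (algebraMap A K a) := by
    intro a; rw [← IsScalarTower.algebraMap_apply, ← IsScalarTower.algebraMap_apply]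
  refine ⟨?_, ?_, ?_, ?_, ?_, ?_, ?_⟩
  · intro x; apply hinj; rw [hσ', hσ', h.inv]
  · intro a; apply hinj; rw [hσ', tow, h.fixK]
  · intro x hx
    obtain ⟨k, hk⟩ := h.fix (algebraMap B L x) (by rw [← hσ', hx])
    have h1 : IsIntegral A (algebraMap K L k) := by
      rw [hk]; exact (IsIntegralClosure.isIntegral A L x).algebraMap
    have h2 : IsIntegral A k := (isIntegral_algebraMap_iff (algebraMap K L).injective).mp h1
    obtain ⟨a, ha⟩ := (IsIntegrallyClosed.isIntegral_iff (R := A)).mp h2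
    refine ⟨a, hinj ?_⟩
    rw [tow, ha, hk]
  · apply hinj; rw [hσ', hτ', map_neg, hτ', h.conj]
  · rintro rfl; exact h.ne (by rw [← hτ', map_zero])
  · intro x
    apply hinj
    rw [tow, Algebra.algebraMap_intNorm (K := K) (L := L), h.norm, map_mul, hσ']
  · rw [← hr]
    symm
    exact IsFractionRing.finrank_eq A K B L
end quad

/-- conjugation on the ring of integers -/
noncomputable abbrev oc {L : Type*} [Field L] (σ : L ≃+* L) : 𝓞 L ≃+* 𝓞 L :=
  RingOfIntegers.mapRingEquiv σ

theorem Quad.qr {K L : Type*} [Field K] [Field L] [NumberField K] [NumberField L] [Algebra K L]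
    {σ : L ≃+* L} {τ : 𝓞 L} {t : K} (h : Quad K L σ (τ : L) t) : QR (𝓞 K) (𝓞 L) (oc σ) τ :=
  h.toQR (A := 𝓞 K) (B := 𝓞 L) _ (fun x => RingOfIntegers.mapRingEquiv_apply σ x) τ rfl

theorem Quad.qrZ {L : Type*} [Field L] [NumberField L] 
    {σ : L ≃+* L} {τ : 𝓞 L} {t : ℚ} (h : Quad ℚ L σ (τ : L) t) : QR ℤ (𝓞 L) (oc σ) τ :=
  h.toQR (A := ℤ) (B := 𝓞 L) _ (fun x => RingOfIntegers.mapRingEquiv_apply σ x) τ rfl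

set_option linter.unusedVariables false
set_option linter.unusedSectionVars false
open NumberField

section cl
variable {R S : Type*} [CommRing R] [IsDedekindDomain R] [CommRing S] [IsDedekindDomain S]

open Classical in
/-- ideal class of an ideal (junk value 1 at zero) -/
noncomputable def cl (I : Ideal R) : ClassGroup R :=
  if h : I = ⊥ then 1 else ClassGroup.mk0 ⟨I, mem_nonZeroDivisors_iff_ne_zero.mpr h⟩

theorem cl_of_ne {I : Ideal R} (h : I ≠ ⊥) :
    cl I = ClassGroup.mk0 ⟨I, mem_nonZeroDivisors_iff_ne_zero.mpr h⟩ := dif_neg h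

theorem ideal_mul_ne {I J : Ideal R} (hI : I ≠ ⊥) (hJ : J ≠ ⊥) : I * J ≠ ⊥ := mul_ne_zero hI hJ

theorem cl_mul {I J : Ideal R} (hI : I ≠ ⊥) (hJ : J ≠ ⊥) : cl (I * J) = cl I * cl J := by
  rw [cl_of_ne hI, cl_of_ne hJ, cl_of_ne (ideal_mul_ne hI hJ), ← map_mul]
  rfl

theorem cl_surj (c : ClassGroup R) : ∃ I : Ideal R, I ≠ ⊥ ∧ cl I = c := by
  obtain ⟨⟨I, hI⟩, h⟩ := ClassGroup.mk0_surjective c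
  have hI' : I ≠ ⊥ := mem_nonZeroDivisors_iff_ne_zero.mp hI
  exact ⟨I, hI', by rw [cl_of_ne hI', h]⟩

theorem cl_eq {I J : Ideal R} (hI : I ≠ ⊥) (hJ : J ≠ ⊥) : cl I = cl J ↔
    ∃ x y : R, x ≠ 0 ∧ y ≠ 0 ∧ Ideal.span {x} * I = Ideal.span {y} * J := by
  rw [cl_of_ne hI, cl_of_ne hJ, ClassGroup.mk0_eq_mk0_iff]
  simp only [exists_prop]

theorem cl_span (x : R) : cl (Ideal.span {x}) = 1 := by
  by_cases h : x = 0
  · rw [cl, dif_pos (by simpa using h)]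
  · have h' : Ideal.span {x} ≠ ⊥ := by simpa using h
    rw [cl_of_ne h', ClassGroup.mk0_eq_one_iff]
    exact ⟨⟨x, rfl⟩⟩

theorem cl_top : cl (⊤ : Ideal R) = 1 := by
  rw [← Ideal.span_singleton_one]; exact cl_span 1

theorem cl_eq_one {I : Ideal R} (hI : I ≠ ⊥) : cl I = 1 ↔ ∃ x, x ≠ 0 ∧ I = Ideal.span {x} := by
  constructor
  · intro h
    rw [cl_of_ne hI, ClassGroup.mk0_eq_one_iff] at h
    obtain ⟨x, hx⟩ := h
    refine ⟨x, ?_, hx⟩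
    rintro rfl
    apply hI
    rw [hx]
    exact Ideal.span_singleton_eq_bot.mpr rfl
  · rintro ⟨x, -, rfl⟩; exact cl_span x

theorem cl_pow {I : Ideal R} (hI : I ≠ ⊥) (n : ℕ) : cl (I ^ n) = cl I ^ n := by
  induction n with
  | zero => rw [pow_zero, pow_zero, Ideal.one_eq_top, cl_top]
  | succ n ih => rw [pow_succ, cl_mul (pow_ne_zero n hI) hI, ih, pow_succ]

theorem cl_span_mul {I : Ideal R} {x : R} (hx : x ≠ 0) (hI : I ≠ ⊥) :
    cl (Ideal.span {x} * I) = cl I := by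
  rw [cl_mul (by simpa using hx) hI, cl_span, one_mul]

/-- functoriality -/
structure IdMap (φ : Ideal R → Ideal S) : Prop where
  mul : ∀ I J, φ (I * J) = φ I * φ J
  ne : ∀ I, I ≠ ⊥ → φ I ≠ ⊥
  princ : ∀ x, ∃ y, φ (Ideal.span {x}) = Ideal.span {y}

theorem IdMap.cl_congr {φ : Ideal R → Ideal S} (h : IdMap φ) {I J : Ideal R} (hI : I ≠ ⊥)
    (hJ : J ≠ ⊥) (e : cl I = cl J) : cl (φ I) = cl (φ J) := by
  obtain ⟨x, y, hx, hy, e⟩ := (cl_eq hI hJ).mp e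
  have h1 := congrArg φ e
  rw [h.mul, h.mul] at h1
  obtain ⟨x', hx'⟩ := h.princ x
  obtain ⟨y', hy'⟩ := h.princ y
  have hx0 := h.ne (Ideal.span {x}) (by simpa using hx)
  have hy0 := h.ne (Ideal.span {y}) (by simpa using hy)
  rw [hx'] at hx0 h1
  rw [hy'] at hy0 h1
  have := congrArg cl h1
  rwa [cl_mul hx0 (h.ne _ hI), cl_mul hy0 (h.ne _ hJ), cl_span, cl_span, one_mul, one_mul] at this

noncomputable def IdMap.hom {φ : Ideal R → Ideal S} (h : IdMap φ) :
    ClassGroup R →* ClassGroup S :=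
  MonoidHom.mk' (fun c => cl (φ (cl_surj c).choose)) (by
    intro a b
    have ha := (cl_surj a).choose_spec
    have hb := (cl_surj b).choose_spec
    have hab := (cl_surj (a * b)).choose_spec
    rw [← cl_mul (h.ne _ ha.1) (h.ne _ hb.1), ← h.mul]
    apply h.cl_congr hab.1 (ideal_mul_ne ha.1 hb.1)
    rw [cl_mul ha.1 hb.1, ha.2, hb.2, hab.2])

theorem IdMap.hom_cl {φ : Ideal R → Ideal S} (h : IdMap φ) {I : Ideal R} (hI : I ≠ ⊥) :
    h.hom (cl I) = cl (φ I) := by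
  have ha := (cl_surj (cl I)).choose_spec
  exact h.cl_congr ha.1 hI ha.2

theorem idMap_map [Algebra R S] [FaithfulSMul R S] :
    IdMap (fun I : Ideal R => I.map (algebraMap R S)) where
  mul I J := Ideal.map_mul _ _ _
  ne I hI := by
    intro h
    rw [Ideal.map_eq_bot_iff_of_injective (FaithfulSMul.algebraMap_injective R S)] at h
    exact hI h
  princ x := ⟨algebraMap R S x, by rw [Ideal.map_span, Set.image_singleton]⟩

theorem idMap_conj (σ : R ≃+* R) (inv : ∀ x, σ (σ x) = x) :
    IdMap (fun I : Ideal R => I.map σ) where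
  mul I J := Ideal.map_mul _ _ _
  ne I hI := map_ne_bot' σ inv hI
  princ x := ⟨σ x, map_span_singleton' σ x⟩

theorem idMap_relNorm [Algebra R S] [Module.Finite R S] [Module.IsTorsionFree R S] :
    IdMap (fun I : Ideal S => Ideal.relNorm R I) where
  mul I J := map_mul _ _ _
  ne I hI := by
    intro h; apply hI; simpa using h
  princ x := ⟨Algebra.intNorm R S x, Ideal.relNorm_singleton R x⟩

theorem pow_two_inj {I J : Ideal R} (h : I ^ 2 = J ^ 2) : I = J :=
  pow_left_injective two_ne_zero h

theorem sq_dvd_sq_ideal {I J : Ideal R} (h : I ^ 2 ∣ J ^ 2) : I ∣ J := by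
  exact (UniqueFactorizationMonoid.pow_dvd_pow_iff_dvd two_ne_zero).mp h
end cl

set_option linter.unusedVariables false
set_option linter.unusedSectionVars false
open NumberField

structure QF (K : Type*) [Field K] [NumberField K] (σ : K ≃+* K) (w : 𝓞 K) (d : ℤ) : Prop where
  quad : Quad ℚ K σ (w : K) (d : ℚ)
  sqf : Squarefree d
  mod4 : d % 4 = 2 ∨ d % 4 = 3

namespace QF
variable {K : Type*} [Field K] [NumberField K] {σ : K ≃+* K} {w : 𝓞 K} {d : ℤ}

theorem qr (h : QF K σ w d) : QR ℤ (𝓞 K) (oc σ) w := h.quad.qrZ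

theorem wsq (h : QF K σ w d) : w ^ 2 = (d : 𝓞 K) := by
  apply RingOfIntegers.ext
  have := h.quad.sq
  push_cast
  rw [this]; simp

theorem rat_int {q : ℚ} {d n : ℤ} (hd : Squarefree d) (h : d * q ^ 2 = n) : ∃ k : ℤ, q = k := by
  have hden : (q.den : ℚ) ≠ 0 := by exact_mod_cast q.den_ne_zero
  have e : d * q.num ^ 2 = n * (q.den : ℤ) ^ 2 := by
    have hq := q.num_div_den
    have : (d * q.num ^ 2 : ℚ) = n * (q.den : ℚ) ^ 2 := by
      rw [← h]; nth_rewrite 2 [← hq]; field_simp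
    exact_mod_cast this
  have h1 : (q.den : ℤ) ∣ q.num := sq_dvd_sqf hd (by exact_mod_cast q.den_ne_zero) ⟨n, by rw [e]; ring⟩
  obtain ⟨k, hk⟩ := h1
  refine ⟨k, ?_⟩
  rw [← q.num_div_den, hk]
  push_cast
  field_simp

theorem form (h : QF K σ w d) (x : 𝓞 K) : ∃ a b : ℤ, x = a + b * w := by
  obtain ⟨α, β, hx⟩ := h.quad.span (x : K)
  have wq := h.quad.sq
  have cj := h.quad.conj
  have hσ : ((oc σ x : 𝓞 K) : K) = σ (x : K) := RingOfIntegers.mapRingEquiv_apply σ x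
  obtain ⟨A, hA⟩ := h.qr.fix (x + oc σ x) (by rw [map_add, h.qr.inv, add_comm])
  have hN := h.qr.norm x
  set N := Algebra.intNorm ℤ (𝓞 K) x
  have hA' : (2 * α : ℚ) = A := by
    have this : ((A : ℤ) : K) = (x : K) + σ (x : K) := by
      rw [← hσ]; have := congrArg (algebraMap (𝓞 K) K) hA; simpa using this
    apply (algebraMap ℚ K).injective
    rw [hx] at this
    simp only [map_add, map_mul, h.quad.fixK, cj] at this
    simp only [map_mul, map_ofNat, map_intCast]
    rw [this]; ring
  have hN' : α ^ 2 - d * β ^ 2 = N := by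
    have this : ((N : ℤ) : K) = (x : K) * σ (x : K) := by
      rw [← hσ]; have := congrArg (algebraMap (𝓞 K) K) hN; simpa using this
    apply (algebraMap ℚ K).injective
    rw [hx] at this
    simp only [map_add, map_mul, h.quad.fixK, cj] at this
    simp only [map_mul, map_sub, map_pow, map_intCast] at wq ⊢
    rw [this]
    linear_combination ((algebraMap ℚ K β) ^ 2) * wq
  have h4 : (d:ℚ) * (2 * β) ^ 2 = ((A ^ 2 - 4 * N : ℤ) : ℚ) := by
    push_cast; rw [← hA', ← hN']; ring
  obtain ⟨B, hB⟩ := rat_int h.sqf h4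
  rw [hB] at h4
  have h5 : d * B ^ 2 = A ^ 2 - 4 * N := by exact_mod_cast h4
  have h6 : A % 2 = 0 ∧ B % 2 = 0 := by
    rcases Int.even_or_odd' A with ⟨a, rfl | rfl⟩ <;> rcases Int.even_or_odd' B with ⟨b, rfl | rfl⟩
    · omega
    · exfalso
      have : d = 4 * (a ^ 2 - N - d * b ^ 2 - d * b) := by linarith
      rcases h.mod4 with h | h <;> omega
    · exfalso
      have : 1 = 4 * (-a ^ 2 - a + N + d * b ^ 2) := by linarith
      omega
    · exfalso
      have : d = 4 * (a ^ 2 + a - N - d * b ^ 2 - d * b) + 1 := by linarith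
      rcases h.mod4 with h | h <;> omega
  obtain ⟨a, ha⟩ : ∃ a, A = 2 * a := ⟨A / 2, by omega⟩
  obtain ⟨b, hb⟩ : ∃ b, B = 2 * b := ⟨B / 2, by omega⟩
  refine ⟨a, b, ?_⟩
  apply RingOfIntegers.ext
  have e1 : α = a := by rw [ha] at hA'; push_cast at hA'; linarith
  have e2 : β = b := by rw [hb] at hB; push_cast at hB; linarith
  rw [hx, e1, e2]
  simp

theorem conj_form (h : QF K σ w d) (a b : ℤ) : oc σ ((a : 𝓞 K) + b * w) = a - b * w := by
  rw [map_add, map_mul, h.qr.conj, map_intCast, map_intCast]; ring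

theorem norm_form (h : QF K σ w d) (a b : ℤ) : 
    Algebra.intNorm ℤ (𝓞 K) ((a : 𝓞 K) + b * w) = a ^ 2 - d * b ^ 2 := by
  have := h.qr.norm ((a : 𝓞 K) + b * w)
  rw [h.conj_form, eq_intCast] at this
  have h2 : ((a:𝓞 K) + b * w) * (a - b * w) = ((a ^ 2 - d * b ^ 2 : ℤ) : 𝓞 K) := by
    push_cast; linear_combination (-(b:𝓞 K) ^ 2) * h.wsq
  rw [h2] at this
  exact_mod_cast this

theorem form_inj (h : QF K σ w d) {a b a' b' : ℤ} (e : (a : 𝓞 K) + b * w = a' + b' * w) :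
    a = a' ∧ b = b' := by
  have e2 := congrArg (oc σ) e
  rw [h.conj_form, h.conj_form] at e2
  have h1 : ((2 * a : ℤ) : 𝓞 K) = ((2 * a' : ℤ) : 𝓞 K) := by
    push_cast; linear_combination e + e2
  have h1' : 2 * a = 2 * a' := by exact_mod_cast h1
  have h2 : a = a' := by omega
  subst h2
  refine ⟨rfl, ?_⟩
  have h3 : (b : 𝓞 K) * w = b' * w := by linear_combination e
  have := mul_right_cancel₀ h.qr.ne h3
  exact_mod_cast this

theorem absNorm_span (h : QF K σ w d) (x : 𝓞 K) : 
    Ideal.absNorm (Ideal.span {x}) = (Algebra.intNorm ℤ (𝓞 K) x).natAbs := by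
  rw [Ideal.absNorm_span_singleton, Algebra.intNorm_eq_norm]

theorem norm_isNm (h : QF K σ w d) (x : 𝓞 K) (hx : x ≠ 0) (t z : ℤ) (hz : z ≠ 0)
    (e : Algebra.intNorm ℤ (𝓞 K) x = t * z ^ 2) : IsNm d t := by
  obtain ⟨a, b, rfl⟩ := h.form x
  rw [h.norm_form] at e
  exact ⟨a, b, z, hz, e.symm⟩

theorem nrm_ne (h : QF K σ w d) {x : 𝓞 K} (hx : x ≠ 0) : Algebra.intNorm ℤ (𝓞 K) x ≠ 0 := by
  rwa [Ne, Algebra.intNorm_eq_zero]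

theorem genus (h : QF K σ w d) {I J : Ideal (𝓞 K)} (hI : I ≠ ⊥) (hJ : J ≠ ⊥)
    (e : cl I = cl J) : 
    ∃ g : Bool, IsNm d (sg g * (Ideal.absNorm I * Ideal.absNorm J : ℕ)) := by
  obtain ⟨x, y, hx, hy, e⟩ := (cl_eq hI hJ).mp e
  have := congrArg Ideal.absNorm e
  rw [map_mul, map_mul, h.absNorm_span, h.absNorm_span] at this
  set X := Algebra.intNorm ℤ (𝓞 K) x with hX
  set Y := Algebra.intNorm ℤ (𝓞 K) y with hY
  have hX0 : X ≠ 0 := h.nrm_ne hx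
  have hJ0 : (Ideal.absNorm J : ℤ) ≠ 0 := by
    have : Ideal.absNorm J ≠ 0 := by rwa [Ne, Ideal.absNorm_eq_zero_iff]
    exact_mod_cast this
  have h1 : |X| * (Ideal.absNorm I : ℤ) = |Y| * (Ideal.absNorm J : ℤ) := by
    rw [Int.abs_eq_natAbs, Int.abs_eq_natAbs]; exact_mod_cast this
  have key : ∃ g : Bool, X * (Ideal.absNorm I : ℤ) = sg g * (Y * (Ideal.absNorm J : ℤ)) := by
    rcases abs_cases X with ⟨hx', -⟩ | ⟨hx', -⟩ <;> rcases abs_cases Y with ⟨hy', -⟩ | ⟨hy', -⟩ <;>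
      rw [hx', hy'] at h1
    · exact ⟨false, by simp [sg]; linarith⟩
    · exact ⟨true, by simp [sg]; linarith⟩
    · exact ⟨true, by simp [sg]; linarith⟩
    · exact ⟨false, by simp [sg]; linarith⟩
  obtain ⟨g, hg⟩ := key
  have hsg : sg g * sg g = 1 := by cases g <;> simp [sg]
  refine ⟨g, h.norm_isNm (x * y * (Ideal.absNorm J : 𝓞 K)) ?_ _ X hX0 ?_⟩
  · refine mul_ne_zero (mul_ne_zero hx hy) ?_
    exact_mod_cast hJ0
  · have hc : Algebra.intNorm ℤ (𝓞 K) (Ideal.absNorm J : 𝓞 K) = (Ideal.absNorm J : ℤ) ^ 2 := by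
      have := h.norm_form (Ideal.absNorm J : ℤ) 0
      simpa using this
    rw [map_mul, map_mul, hc, ← hX, ← hY]
    push_cast
    linear_combination (- sg g * Ideal.absNorm J * X) * hg - X * Y * (Ideal.absNorm J : ℤ) ^ 2 * hsg

end QF

set_option linter.unusedVariables false
set_option linter.unusedSectionVars false
open NumberField

namespace QF
variable {K : Type*} [Field K] [NumberField K] {σ : K ≃+* K} {w : 𝓞 K} {d : ℤ}

theorem unit_form (h : QF K σ w d) (u : (𝓞 K)ˣ) : 
    ∃ a b : ℤ, (u : 𝓞 K) = a + b * w ∧ (a ^ 2 - d * b ^ 2 = 1 ∨ a ^ 2 - d * b ^ 2 = -1) := by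
  obtain ⟨a, b, e⟩ := h.form u
  refine ⟨a, b, e, ?_⟩
  have h1 : IsUnit (Algebra.intNorm ℤ (𝓞 K) (u : 𝓞 K)) := u.isUnit.map _
  rw [e, h.norm_form] at h1
  exact Int.isUnit_iff.mp h1

/-- unit attached to a Pell solution -/
noncomputable def pu (h : QF K σ w d) : Pell.Solution₁ d →* (𝓞 K)ˣ :=
  MonoidHom.toHomUnits 
  { toFun := fun a => (a.x : 𝓞 K) + a.y * w
    map_one' := by simp
    map_mul' := by
      intro a b
      rw [Pell.Solution₁.x_mul, Pell.Solution₁.y_mul]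
      push_cast
      linear_combination (-(a.y : 𝓞 K) * b.y) * h.wsq }

theorem pu_val (h : QF K σ w d) (a : Pell.Solution₁ d) : ((h.pu a : (𝓞 K)ˣ) : 𝓞 K) = a.x + a.y * w := rfl

theorem pu_neg (h : QF K σ w d) (a : Pell.Solution₁ d) : h.pu (-a) = - h.pu a := by
  ext1
  rw [Units.val_neg, pu_val, pu_val]
  simp; ring

theorem units_pos (h : QF K σ w d) (E : Pell.Solution₁ d) (hE : Pell.IsFundamental E) (u : (𝓞 K)ˣ)
    (a b : ℤ) (e : (u : 𝓞 K) = a + b * w) (hn : a ^ 2 - d * b ^ 2 = 1) :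
    ∃ k : ℤ, u = h.pu E ^ k ∨ u = - h.pu E ^ k := by
  have hu : u = h.pu (Pell.Solution₁.mk a b hn) := by
    ext1; rw [pu_val, e]; rfl
  obtain ⟨k, hk | hk⟩ := hE.eq_zpow_or_neg_zpow (Pell.Solution₁.mk a b hn)
  · exact ⟨k, Or.inl (by rw [hu, hk, map_zpow])⟩
  · exact ⟨k, Or.inr (by rw [hu, hk, pu_neg, map_zpow])⟩

theorem units (h : QF K σ w d) (E : Pell.Solution₁ d) (hE : Pell.IsFundamental E)
    (hm : ¬ IsNm d (-1)) (u : (𝓞 K)ˣ) :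
    ∃ k : ℤ, u = h.pu E ^ k ∨ u = - h.pu E ^ k := by
  obtain ⟨a, b, e, hn | hn⟩ := h.unit_form u
  · exact h.units_pos E hE u a b e hn
  · exact absurd ⟨a, b, 1, one_ne_zero, by linarith⟩ hm

/-- (1 + ε)² = 2(x+1) ε -/
theorem pu_sq (h : QF K σ w d) (E : Pell.Solution₁ d) : 
    (1 + (h.pu E : 𝓞 K)) ^ 2 = ((2 * (E.x + 1) : ℤ) : 𝓞 K) * h.pu E := by
  have h1 : ((E.x ^ 2 - d * E.y ^ 2 : ℤ) : 𝓞 K) = 1 := by rw [E.prop]; simp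
  rw [pu_val]
  push_cast at h1 ⊢
  linear_combination (E.y : 𝓞 K) ^ 2 * h.wsq - h1

theorem mul_conj (h : QF K σ w d) {J : Ideal (𝓞 K)} (hJ : J ≠ ⊥) :
    J * J.map (oc σ) = Ideal.span {(Ideal.absNorm J : 𝓞 K)} := by
  rw [← h.qr.map_relNorm J hJ, Ideal.relNorm_int, Ideal.map_span, Set.image_singleton]
  simp

theorem cl_conj (h : QF K σ w d) {J : Ideal (𝓞 K)} (hJ : J ≠ ⊥) :
    cl J * cl (J.map (oc σ)) = 1 := by
  rw [← cl_mul hJ (map_ne_bot' _ h.qr.inv hJ), h.mul_conj hJ, cl_span]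

theorem map_ne (h : QF K σ w d) {J : Ideal (𝓞 K)} (hJ : J ≠ ⊥) : J.map (oc σ) ≠ ⊥ :=
  map_ne_bot' _ h.qr.inv hJ

/-- the class `x` is represented by `J` with `J² = (n)` -/
def Rr (x : ClassGroup (𝓞 K)) (n : ℕ) : Prop :=
  ∃ J : Ideal (𝓞 K), J ≠ ⊥ ∧ cl J = x ∧ J ^ 2 = Ideal.span {(n : 𝓞 K)}

theorem Rr.mul {x y : ClassGroup (𝓞 K)} {m n : ℕ} (h1 : Rr x m) (h2 : Rr y n) :
    Rr (x * y) (m * n) := by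
  obtain ⟨I, hI, rfl, e⟩ := h1
  obtain ⟨J, hJ, rfl, f⟩ := h2
  refine ⟨I * J, ideal_mul_ne hI hJ, cl_mul hI hJ, ?_⟩
  rw [mul_pow, e, f, Ideal.span_singleton_mul_span_singleton]; push_cast; rfl

theorem Rr.red {x : ClassGroup (𝓞 K)} {n k : ℕ} (hk : k ≠ 0) (h1 : Rr x (n * k ^ 2)) : Rr x n := by
  obtain ⟨I, hI, rfl, e⟩ := h1
  have hk0 : (k : 𝓞 K) ≠ 0 := by exact_mod_cast hk
  have hks : Ideal.span {(k : 𝓞 K)} ≠ ⊥ := by simpa using hk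
  have e' : I ^ 2 = Ideal.span {(k : 𝓞 K)} ^ 2 * Ideal.span {(n : 𝓞 K)} := by
    rw [e, Ideal.span_singleton_pow, Ideal.span_singleton_mul_span_singleton]; push_cast
    rw [mul_comm]
  have hd : Ideal.span {(k : 𝓞 K)} ∣ I := sq_dvd_sq_ideal ⟨_, e'⟩
  obtain ⟨J, rfl⟩ := hd
  have hJ : J ≠ ⊥ := by rintro rfl; simp at hI
  refine ⟨J, hJ, by rw [cl_span_mul hk0 hJ], ?_⟩
  rw [mul_pow] at e'
  exact mul_left_cancel₀ (pow_ne_zero 2 hks) e'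

theorem Rr.uniq {x y : ClassGroup (𝓞 K)} {n : ℕ} (h1 : Rr x n) (h2 : Rr y n) : x = y := by
  obtain ⟨I, hI, rfl, e⟩ := h1
  obtain ⟨J, hJ, rfl, f⟩ := h2
  rw [pow_two_inj (e.trans f.symm)]

theorem Rr.one_of (n : ℕ) (hn : n ≠ 0) (β : 𝓞 K) (u : (𝓞 K)ˣ) (e : β ^ 2 = n * u) : 
    Rr (1 : ClassGroup (𝓞 K)) n := by
  refine ⟨Ideal.span {β}, ?_, cl_span _, ?_⟩
  · rw [Ne, Ideal.span_singleton_eq_bot]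
    rintro rfl
    have : (n : 𝓞 K) * u = 0 := by rw [← e]; simp
    simp [hn] at this
  · rw [Ideal.span_singleton_pow, e, Ideal.span_singleton_mul_right_unit u.isUnit]

theorem Rr.toggle {x : ClassGroup (𝓞 K)} {n y z : ℕ} (hy : y ≠ 0) (h1 : Rr x (n * y)) 
    (h2 : Rr (1 : ClassGroup (𝓞 K)) (y * z)) : Rr x (n * z) := by
  have := h1.mul h2
  rw [mul_one, show n * y * (y * z) = n * z * y ^ 2 by ring] at this
  exact this.red hy

/-- ramification -/
theorem ram (h : QF K σ w d) {J : Ideal (𝓞 K)} {n : ℕ} (hn : Squarefree n)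
    (e : J ^ 2 = Ideal.span {(n : 𝓞 K)}) (p : ℕ) (hp : p.Prime) (hpn : p ∣ n) : (p : ℤ) ∣ 2 * d := by
  have hpi : Prime (p:ℤ) := Nat.prime_iff_prime_int.mp hp
  obtain ⟨n', rfl⟩ := hpn
  have hcop : Nat.Coprime p n' := Nat.coprime_of_squarefree_mul hn
  have hnt : Ideal.span {(p : 𝓞 K)} ≠ ⊤ := by
    rw [Ne, ← Ideal.absNorm_eq_one_iff, h.absNorm_span]
    have := h.norm_form p 0
    simp at this
    rw [this]
    simpa using hp.one_lt.ne'
  obtain ⟨P, hPm, hPp⟩ := Ideal.exists_le_maximal _ hnt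
  have hPprime := hPm.isPrime
  have hpP : (p : 𝓞 K) ∈ P := hPp (Ideal.mem_span_singleton_self _)
  have hP0 : P ≠ ⊥ := by
    rintro rfl
    have : (p : 𝓞 K) = 0 := hpP
    exact hp.ne_zero (by exact_mod_cast this)
  have hPr := Ideal.prime_of_isPrime hP0 hPprime
  have hn' : (n' : 𝓞 K) ∉ P := by
    intro hn'
    obtain ⟨a, b, hab⟩ := Nat.isCoprime_iff_coprime.mpr hcop
    apply hPprime.ne_top
    rw [Ideal.eq_top_iff_one]
    have : (1 : 𝓞 K) = a * p + b * n' := by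
      have := congrArg (fun z : ℤ => (z : 𝓞 K)) hab
      push_cast at this; exact this.symm
    rw [this]
    exact P.add_mem (P.mul_mem_left _ hpP) (P.mul_mem_left _ hn')
  have hPJ : P ∣ J := by
    apply hPr.dvd_of_dvd_pow (n := 2)
    rw [e, Ideal.dvd_span_singleton]
    push_cast
    exact P.mul_mem_right _ hpP
  have hP2 : P ^ 2 ∣ Ideal.span {(p : 𝓞 K)} * Ideal.span {(n' : 𝓞 K)} := by
    rw [Ideal.span_singleton_mul_span_singleton]
    have := pow_dvd_pow_of_dvd hPJ 2
    rw [e] at this; push_cast at this; exact this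
  have hP3 : P ^ 2 ∣ Ideal.span {(p : 𝓞 K)} := 
    hPr.pow_dvd_of_dvd_mul_right 2 (by rwa [Ideal.dvd_span_singleton]) hP2
  have hun : P.under ℤ = Ideal.span {(p:ℤ)} := by
    symm
    have hmax : (Ideal.span {(p:ℤ)}).IsMaximal := 
      PrincipalIdealRing.isMaximal_of_irreducible hpi.irreducible
    refine hmax.eq_of_le ?_ ?_
    · exact (inferInstance : (P.under ℤ).IsPrime).ne_top
    · rw [Ideal.span_singleton_le_iff_mem, Ideal.mem_comap]
      simpa using hpP
  have h2w : 2 * w ∈ P := h.qr.unram P hP0 (by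
    rw [hun, Ideal.map_span, Set.image_singleton, ← sq]; simpa using hP3) (by
      rw [hun]; simpa using hp.ne_zero)
  have h4d : ((4 * d : ℤ) : 𝓞 K) ∈ P := by
    have : ((4 * d : ℤ) : 𝓞 K) = (2 * w) * (2 * w) := by
      push_cast; linear_combination (-4) * h.wsq
    rw [this]; exact P.mul_mem_left _ h2w
  have : (4 * d : ℤ) ∈ P.under ℤ := by
    rw [Ideal.mem_comap]; simpa using h4d
  rw [hun, Ideal.mem_span_singleton] at this
  have h3 : (p:ℤ) ∣ 2 * (2 * d) := by
    have e : (2*(2*d)) = 4*d := by ring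
    rw [e]; exact this
  rcases hpi.dvd_or_dvd h3 with h | h
  · exact Dvd.dvd.mul_right h _
  · exact h

/-- ambiguous class lemma -/
theorem amb (h : QF K σ w d) (hm : ¬ IsNm d (-1) ∨ ∃ η : (𝓞 K)ˣ, (η : 𝓞 K) * oc σ η = -1)
    {x : ClassGroup (𝓞 K)} (hx : x ^ 2 = 1) : ∃ n : ℕ, Squarefree n ∧ Rr x n ∧
      ∀ p : ℕ, p.Prime → p ∣ n → (p : ℤ) ∣ 2 * d := by
  obtain ⟨I, hI, rfl⟩ := cl_surj x
  have h1 : cl I = cl (I.map (oc σ)) := by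
    have := h.cl_conj hI
    rw [sq] at hx
    exact mul_left_cancel (hx.trans this.symm)
  obtain ⟨α, β, hα, hβ, e⟩ := (cl_eq hI (h.map_ne hI)).mp h1
  have hα' := h.qr.norm α
  have hβ' := h.qr.norm β
  have hab : (Algebra.intNorm ℤ (𝓞 K) α).natAbs = (Algebra.intNorm ℤ (𝓞 K) β).natAbs := by
    have := congrArg Ideal.absNorm e
    rw [map_mul, map_mul, h.absNorm_span, h.absNorm_span, absNorm_map_equiv] at this
    have h0 : Ideal.absNorm I ≠ 0 := by rwa [Ne, Ideal.absNorm_eq_zero_iff]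
    exact Nat.eq_of_mul_eq_mul_right (Nat.pos_of_ne_zero h0) this
  have key : ∃ β : 𝓞 K, Ideal.span {α} * I = Ideal.span {β} * I.map (oc σ) ∧ 
      β * oc σ β = α * oc σ α := by
    rcases Int.natAbs_eq_natAbs_iff.mp hab with hab | hab
    · exact ⟨β, e, by rw [← hα', ← hβ', hab]⟩
    · rcases hm with hm | ⟨η, hη⟩
      · exfalso
        apply hm
        refine h.norm_isNm (α * β) (mul_ne_zero hα hβ) (-1) _ (h.nrm_ne hα) ?_
        rw [map_mul, hab]; ring
      · refine ⟨β * η, ?_, ?_⟩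
        · rw [Ideal.span_singleton_mul_right_unit η.isUnit, e]
        · rw [hab] at hα'
          rw [map_mul]
          rw [← hα', map_neg, hβ']
          linear_combination (β * oc σ β) * hη
  obtain ⟨β, e, hn⟩ := key
  obtain ⟨δ, hδ, -, hinv⟩ := H90 (oc σ) h.qr.inv w h.qr.ne h.qr.conj I α β hα e hn
  have hδ' : oc σ δ ≠ 0 := by simpa using hδ
  set I' := Ideal.span {oc σ δ} * I with hI'
  have hI'0 : I' ≠ ⊥ := ideal_mul_ne (by simpa using hδ) hI
  have hcl : cl I' = cl I := cl_span_mul hδ' hI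
  have hsq := h.mul_conj hI'0
  rw [hinv, ← sq] at hsq
  have h0 : Ideal.absNorm I' ≠ 0 := by rwa [Ne, Ideal.absNorm_eq_zero_iff]
  obtain ⟨n, k, hnk, hn⟩ := Nat.sq_mul_squarefree (Ideal.absNorm I')
  have hR : Rr (cl I) n := by
    apply Rr.red (k := k)
    · rintro rfl; simp at hnk; omega
    · exact ⟨I', hI'0, hcl, by rw [hsq, ← hnk, mul_comm]⟩
  refine ⟨n, hn, hR, ?_⟩
  obtain ⟨J, -, -, e⟩ := hR
  intro p hp hpn
  exact h.ram hn e p hp hpn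
end QF

set_option linter.unusedVariables false
set_option linter.unusedSectionVars false
open NumberField

theorem IsNm.red {d t k : ℤ} (hk : k ≠ 0) (h : IsNm d (t * k ^ 2)) : IsNm d t := by
  obtain ⟨x, y, z, hz, e⟩ := h
  exact ⟨x, y, k * z, mul_ne_zero hk hz, by rw [← e]; ring⟩

theorem sg_tv (q r s : ℕ) (g a b c e : Bool) : sg g * ((2 ^ a.toNat * q ^ b.toNat * r ^ c.toNat * s ^ e.toNat : ℕ) : ℤ)
   = tv q r s g a b c e := by
  rw [tv]; push_cast; ring

theorem Hyp.neg_odd {q r s : ℕ} (h : Hyp q r s) : ¬ IsNm (q * r * s) (-1) := by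
  intro h'
  have := IsNm.odd_case h (g := true) (a := false) (b := false) (c := false) (e := false) 
    (by simpa [tv, sg] using h')
  simp at this

theorem Hyp.neg_even {q r s : ℕ} (h : Hyp q r s) : ¬ IsNm (2 * (q * r * s)) (-1) := by
  intro h'
  have := IsNm.even_case1 h (g := true) (a := false) (b := false) (c := false) (e := false) 
    (by simpa [tv, sg] using h')
  simp at this

namespace QF
variable {K : Type*} [Field K] [NumberField K] {σ : K ≃+* K} {w : 𝓞 K} {d : ℤ}

theorem absNorm_of_sq (h : QF K σ w d) {J : Ideal (𝓞 K)} {n : ℕ} (e : J ^ 2 = Ideal.span {(n : 𝓞 K)}) :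
    Ideal.absNorm J = n := by
  have := congrArg Ideal.absNorm e
  rw [map_pow, h.absNorm_span] at this
  have h1 := h.norm_form n 0
  simp at h1
  rw [h1, Int.natAbs_pow] at this
  exact pow_left_injective two_ne_zero (by simpa using this)

theorem genus_sq (h : QF K σ w d) {J : Ideal (𝓞 K)} (hJ : J ≠ ⊥) {y : ClassGroup (𝓞 K)} 
    (e : cl J = y ^ 2) : ∃ g : Bool, IsNm d (sg g * (Ideal.absNorm J : ℤ)) := by
  obtain ⟨I, hI, rfl⟩ := cl_surj y
  rw [← cl_pow hI] at e
  obtain ⟨g, hg⟩ := h.genus hJ (pow_ne_zero 2 hI) e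
  refine ⟨g, IsNm.red (k := Ideal.absNorm I) ?_ (by
    rw [map_pow] at hg; push_cast at hg; rw [← mul_assoc] at hg; exact hg)⟩
  have : Ideal.absNorm I ≠ 0 := by rwa [Ne, Ideal.absNorm_eq_zero_iff]
  exact_mod_cast this

theorem Rr.ofw (h : QF K σ w d) (n : ℕ) (hn : n ≠ 0) (hd : d = n) : Rr (1 : ClassGroup (𝓞 K)) n :=
  Rr.one_of n hn w 1 (by rw [h.wsq, hd]; simp)

theorem Rr.one_one : Rr (1 : ClassGroup (𝓞 K)) 1 :=
  Rr.one_of 1 one_ne_zero 1 1 (by simp)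

theorem Rr.eps (h : QF K σ w d) (E : Pell.Solution₁ d) (n : ℕ) (hn : n ≠ 0) (k : ℤ) (hk : k ≠ 0) 
    (e : 2 * (E.x + 1) = n * k ^ 2) : Rr (1 : ClassGroup (𝓞 K)) n := by
  have := h.pu_sq E
  rw [e] at this
  refine Rr.red (k := k.natAbs) (by simpa using hk) 
    (Rr.one_of (n * k.natAbs ^ 2) (mul_ne_zero hn (by simpa using hk)) _ (h.pu E) (this.trans ?_))
  have e1 : ((n * k.natAbs ^ 2 : ℕ) : 𝓞 K) = ((n * k ^ 2 : ℤ) : 𝓞 K) := by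
    have : ((n * k.natAbs ^ 2 : ℕ) : ℤ) = n * k ^ 2 := by
      push_cast; rw [sq_abs]
    rw [← this, Int.cast_natCast]
  rw [e1]

theorem cl1 (h : QF K σ w 2) {x : ClassGroup (𝓞 K)} (hx : x ^ 2 = 1) : x = 1 := by
  have hη : ((1 : 𝓞 K) + w) * oc σ (1 + w) = -1 := by
    have := h.conj_form 1 1
    simp at this
    rw [map_add, map_one, this]
    linear_combination - h.wsq
  have hu : ∃ η : (𝓞 K)ˣ, (η : 𝓞 K) = 1 + w := 
    ⟨⟨1 + w, - oc σ (1 + w), by linear_combination -hη, by linear_combination -hη⟩, rfl⟩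
  obtain ⟨η, hη'⟩ := hu
  obtain ⟨n, hn, hR, hp⟩ := h.amb (Or.inr ⟨η, by rw [hη', hη]⟩) hx
  have h2 : n ∣ 2 := by
    apply sqf_dvd hn
    intro p hpp hpn
    have h4 := hp p hpp hpn
    have h5 : p ∣ 2 ^ 2 := by exact_mod_cast h4
    exact hpp.dvd_of_dvd_pow h5
  rcases (Nat.dvd_prime Nat.prime_two).mp h2 with rfl | rfl
  · exact hR.uniq Rr.one_one
  · exact hR.uniq (Rr.ofw h 2 (by norm_num) rfl)

variable {q r s : ℕ}

theorem nz (hyp : Hyp q r s) : q ≠ 0 ∧ r ≠ 0 ∧ s ≠ 0 := 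
  ⟨hyp.hq.ne_zero, hyp.hr.ne_zero, hyp.hs.ne_zero⟩

theorem amb_gen (hyp : Hyp q r s) {n : ℕ} (hn : Squarefree n) (hp : ∀ p : ℕ, p.Prime → p ∣ n → (p : ℤ) ∣ 2 * d)
    (hd : d = (2 * (q * r * s) : ℕ) ∨ d = (q * r * s : ℕ)) : n ∣ 2 * (q * r * s) := by
  apply sqf_dvd hn
  intro p hpp hpn
  have h4 := hp p hpp hpn
  rcases hd with rfl | rfl
  · have h5 : p ∣ 2 * (2 * (q * r * s)) := by exact_mod_cast h4
    rcases hpp.dvd_mul.mp h5 with h6 | h6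
    · exact Dvd.dvd.mul_right h6 _
    · exact h6
  · exact_mod_cast h4

theorem amb2 (hyp : Hyp q r s) (h : QF K σ w (q * r * s)) {x : ClassGroup (𝓞 K)} (hx : x ^ 2 = 1) :
    ∃ n : ℕ, n ∣ 2 * (q * r * s) ∧ Rr x n := by
  obtain ⟨n, hn, hR, hp⟩ := h.amb (Or.inl hyp.neg_odd) hx
  exact ⟨n, amb_gen hyp hn hp (Or.inr (by push_cast; ring)), hR⟩

theorem amb3 (hyp : Hyp q r s) (h : QF K σ w (2 * (q * r * s))) {x : ClassGroup (𝓞 K)} (hx : x ^ 2 = 1) :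
    ∃ n : ℕ, n ∣ 2 * (q * r * s) ∧ Rr x n := by
  obtain ⟨n, hn, hR, hp⟩ := h.amb (Or.inl hyp.neg_even) hx
  exact ⟨n, amb_gen hyp hn hp (Or.inl (by push_cast; ring)), hR⟩

theorem cl2 (hyp : Hyp q r s) (h : QF K σ w (q * r * s)) (E : Pell.Solution₁ (q * r * s : ℤ)) 
    (hE : Pell.IsFundamental E) {x : ClassGroup (𝓞 K)} (hx : (x ^ 2) ^ 2 = 1) : x ^ 2 = 1 := by
  obtain ⟨z1, z2, z3⟩ := nz hyp
  obtain ⟨n, hn, hR⟩ := amb2 hyp h hx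
  have hR' := hR
  obtain ⟨J, hJ, hJx, hJ2⟩ := hR
  obtain ⟨g, hg⟩ := h.genus_sq hJ hJx
  rw [h.absNorm_of_sq hJ2] at hg
  obtain ⟨a, b, c, e, rfl⟩ := dvd_cases hyp hn
  rw [sg_tv] at hg
  obtain ⟨-, rfl, rfl⟩ := IsNm.odd_case hyp hg
  obtain ⟨k, hk, hk2⟩ := hyp.fund2 E hE
  have Rrs : Rr (1 : ClassGroup (𝓞 K)) (r * s) := Rr.eps h E (r * s) (mul_ne_zero z2 z3) k hk 
    (by rw [hk2]; push_cast; ring)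
  have Rm : Rr (1 : ClassGroup (𝓞 K)) (q * (r * s)) := Rr.ofw h _ (mul_ne_zero z1 (mul_ne_zero z2 z3)) (by push_cast; ring)
  have Rq : Rr (1 : ClassGroup (𝓞 K)) (q * 1) := Rr.toggle (mul_ne_zero z2 z3) Rm (by simpa using Rrs)
  apply hR'.uniq
  cases b <;> cases c <;> simp
  · exact Rr.one_one
  · exact Rrs
  · simpa using Rq
  · simpa [mul_assoc] using Rm

theorem R3 (hyp : Hyp q r s) (h : QF K σ w (2 * (q * r * s))) (E : Pell.Solution₁ (2 * (q * r * s) : ℤ)) 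
    (hE : Pell.IsFundamental E) (hns : ¬ IsSquare (2 * q * (E.x - 1))) : 
    (Rr (1 : ClassGroup (𝓞 K)) s ∧ Rr (1 : ClassGroup (𝓞 K)) (r * (2 * q))) ∨
    (Rr (1 : ClassGroup (𝓞 K)) (r * 2) ∧ Rr (1 : ClassGroup (𝓞 K)) (s * q)) := by
  obtain ⟨z1, z2, z3⟩ := nz hyp
  have Rm : Rr (1 : ClassGroup (𝓞 K)) (2 * (q * r * s)) := Rr.ofw h _ (by simp [z1, z2, z3]) (by push_cast; ring)
  obtain ⟨k, hk, hk2⟩ := hyp.fund3 E hE hns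
  rcases hk2 with hk2 | hk2
  · left
    have Rs : Rr (1 : ClassGroup (𝓞 K)) s := Rr.eps h E _ z3 k hk hk2
    refine ⟨Rs, ?_⟩
    have := Rr.toggle (n := r * (2 * q)) (y := s) (z := 1) z3 (by convert Rm using 1; ring) (by simpa using Rs)
    simpa using this
  · right
    have Rs : Rr (1 : ClassGroup (𝓞 K)) (r * 2) := Rr.eps h E _ (by simp [z2]) k hk 
      (by rw [hk2]; push_cast; ring)
    refine ⟨Rs, ?_⟩
    have := Rr.toggle (n := s * q) (y := r * 2) (z := 1) (by simp [z2]) (by convert Rm using 1; ring) (by simpa using Rs)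
    simpa using this

theorem cl3 (hyp : Hyp q r s) (h : QF K σ w (2 * (q * r * s))) (E : Pell.Solution₁ (2 * (q * r * s) : ℤ)) 
    (hE : Pell.IsFundamental E) (hns : ¬ IsSquare (2 * q * (E.x - 1))) 
    {x : ClassGroup (𝓞 K)} (hx : x ^ 2 = 1) : ∃ a b : Bool, Rr x (2 ^ a.toNat * q ^ b.toNat) := by
  obtain ⟨z1, z2, z3⟩ := nz hyp
  obtain ⟨n, hn, hR⟩ := amb3 hyp h hx
  obtain ⟨a, b, c, e, rfl⟩ := dvd_cases hyp hn
  have fin : ∀ i j : ℕ, Rr x (2 ^ i * q ^ j) → ∃ a b : Bool, Rr x (2 ^ a.toNat * q ^ b.toNat) := by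
    intro i j hij
    refine ⟨decide (i % 2 = 1), decide (j % 2 = 1), Rr.red (k := 2 ^ (i / 2) * q ^ (j / 2)) (by simp [z1]) ?_⟩
    have e1 : ∀ i : ℕ, (decide (i % 2 = 1)).toNat + (i / 2) * 2 = i := by
      intro i
      have : (decide (i % 2 = 1)).toNat = i % 2 := by
        rcases Nat.mod_two_eq_zero_or_one i with h | h <;> simp [h]
      omega
    have e2 : 2 ^ (decide (i % 2 = 1)).toNat * q ^ (decide (j % 2 = 1)).toNat * (2 ^ (i / 2) * q ^ (j / 2)) ^ 2
       = 2 ^ ((decide (i % 2 = 1)).toNat + (i / 2) * 2) * q ^ ((decide (j % 2 = 1)).toNat + (j / 2) * 2) := by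
      ring
    rw [e2, e1, e1]; exact hij
  have tog : ∀ (n y z : ℕ) (c : Bool), y ≠ 0 → Rr x (n * y ^ c.toNat) → 
      Rr (1 : ClassGroup (𝓞 K)) (y * z) → Rr x (n * z ^ c.toNat) := by
    intro n y z c hy h1 h2
    cases c
    · simpa using h1
    · simp at h1 ⊢
      exact Rr.toggle hy h1 h2
  rcases R3 hyp h E hE hns with ⟨hA, hB⟩ | ⟨hA, hB⟩
  · have h1 := tog _ s 1 e z3 hR (by simpa using hA)
    rw [one_pow, mul_one] at h1
    have h2 := tog _ r _ c z2 h1 hB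
    exact fin (a.toNat + c.toNat) (b.toNat + c.toNat) (by convert h2 using 1; ring)
  · have h1 := tog _ s q e z3 hR hB
    have h2 := tog (2 ^ a.toNat * q ^ b.toNat * q ^ e.toNat) r 2 c z2 (by convert h1 using 1; ring) hA
    exact fin (a.toNat + c.toNat) (b.toNat + e.toNat) (by convert h2 using 1; ring)
end QF

set_option linter.unusedVariables false
set_option linter.unusedSectionVars false
open NumberField

/-- biquadratic setting -/
structure BQ (q r s : ℕ) (F K1 K2 K3 : Type*) [Field F] [Field K1] [Field K2] [Field K3]
    [NumberField F] [NumberField K1] [NumberField K2] [NumberField K3]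
    [Algebra K1 F] [Algebra K2 F] [Algebra K3 F]
    (s1 : K1 ≃+* K1) (s2 : K2 ≃+* K2) (s3 : K3 ≃+* K3) (w1 : 𝓞 K1) (w2 : 𝓞 K2) (w3 : 𝓞 K3)
    (σ1 σ2 σ3 : F ≃+* F) (τ t : 𝓞 F) 
    (E2 : Pell.Solution₁ (q * r * s : ℤ)) (E3 : Pell.Solution₁ (2 * (q * r * s) : ℤ)) : Prop where
  hyp : Hyp q r s
  k1 : QF K1 s1 w1 2
  k2 : QF K2 s2 w2 (q * r * s)
  k3 : QF K3 s3 w3 (2 * (q * r * s))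
  e1 : Quad K1 F σ1 (t : F) ((q * r * s : ℕ) : K1)
  e2 : Quad K2 F σ2 (τ : F) (2 : K2)
  e3 : Quad K3 F σ3 (τ : F) (2 : K3)
  m1 : algebraMap (𝓞 K1) (𝓞 F) w1 = τ
  m2 : algebraMap (𝓞 K2) (𝓞 F) w2 = t
  m3 : algebraMap (𝓞 K3) (𝓞 F) w3 = τ * t
  h2 : Pell.IsFundamental E2
  h3 : Pell.IsFundamental E3
  hns : ¬ IsSquare (2 * q * (E3.x - 1))

namespace BQ
variable {q r s : ℕ} {F K1 K2 K3 : Type*} [Field F] [Field K1] [Field K2] [Field K3]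
    [NumberField F] [NumberField K1] [NumberField K2] [NumberField K3]
    [Algebra K1 F] [Algebra K2 F] [Algebra K3 F]
    {s1 : K1 ≃+* K1} {s2 : K2 ≃+* K2} {s3 : K3 ≃+* K3} {w1 : 𝓞 K1} {w2 : 𝓞 K2} {w3 : 𝓞 K3}
    {σ1 σ2 σ3 : F ≃+* F} {τ t : 𝓞 F} 
    {E2 : Pell.Solution₁ (q * r * s : ℤ)} {E3 : Pell.Solution₁ (2 * (q * r * s) : ℤ)} 

section basic
variable (H : BQ q r s F K1 K2 K3 s1 s2 s3 w1 w2 w3 σ1 σ2 σ3 τ t E2 E3)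
include H

theorem mK1 : algebraMap K1 F (w1 : K1) = (τ : F) := by
  have : _ = (τ : F) := congrArg (algebraMap (𝓞 F) F) H.m1
  rw [← this, ← IsScalarTower.algebraMap_apply, ← IsScalarTower.algebraMap_apply]
theorem mK2 : algebraMap K2 F (w2 : K2) = (t : F) := by
  have : _ = (t : F) := congrArg (algebraMap (𝓞 F) F) H.m2
  rw [← this, ← IsScalarTower.algebraMap_apply, ← IsScalarTower.algebraMap_apply]
theorem mK3 : algebraMap K3 F (w3 : K3) = (τ : F) * t := by
  have := congrArg (algebraMap (𝓞 F) F) H.m3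
  rw [map_mul] at this
  rw [← this, ← IsScalarTower.algebraMap_apply, ← IsScalarTower.algebraMap_apply]

theorem σ1τ : σ1 τ = τ := by rw [← H.mK1, H.e1.fixK]
theorem σ1t : σ1 t = -t := H.e1.conj
theorem σ2τ : σ2 τ = -τ := H.e2.conj
theorem σ2t : σ2 t = t := by rw [← H.mK2, H.e2.fixK]
theorem σ3τ : σ3 τ = -τ := H.e3.conj
theorem σ3t : σ3 t = -t := by
  have h1 : σ3 (τ * t : F) = τ * t := by rw [← H.mK3, H.e3.fixK]
  rw [map_mul, H.σ3τ] at h1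
  have := H.e3.ne
  apply mul_left_cancel₀ this
  linear_combination -h1

theorem basis (x : F) : ∃ a b c e : ℚ, x = a + b * τ + c * t + e * (τ * t) := by
  obtain ⟨α, β, rfl⟩ := H.e1.span x
  obtain ⟨a, b, rfl⟩ := H.k1.quad.span α
  obtain ⟨c, e, rfl⟩ := H.k1.quad.span β
  refine ⟨a, b, c, e, ?_⟩
  simp only [map_add, map_mul, H.mK1, eq_ratCast, map_ratCast]
  ring

theorem σ12 (x : F) : σ1 (σ2 x) = σ3 x := by
  obtain ⟨a, b, c, e, rfl⟩ := H.basis x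
  simp only [map_add, map_mul, map_ratCast, H.σ1τ, H.σ1t, H.σ2τ, H.σ2t, H.σ3τ, H.σ3t, map_neg]
theorem σ13 (x : F) : σ1 (σ3 x) = σ2 x := by
  rw [← H.σ12, H.e1.inv]

omit H in
theorem oc_apply (σ : F ≃+* F) (x : 𝓞 F) : ((oc σ x : 𝓞 F) : F) = σ (x : F) := 
  RingOfIntegers.mapRingEquiv_apply σ x

theorem o12 (x : 𝓞 F) : oc σ1 (oc σ2 x) = oc σ3 x := by
  apply RingOfIntegers.ext
  exact (oc_apply _ _).trans ((congrArg _ (oc_apply _ _)).trans ((H.σ12 _).trans (oc_apply _ _).symm))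
theorem o13 (x : 𝓞 F) : oc σ1 (oc σ3 x) = oc σ2 x := by
  apply RingOfIntegers.ext
  exact (oc_apply _ _).trans ((congrArg _ (oc_apply _ _)).trans ((H.σ13 _).trans (oc_apply _ _).symm))

theorem q1 : QR (𝓞 K1) (𝓞 F) (oc σ1) t := H.e1.qr
theorem q2 : QR (𝓞 K2) (𝓞 F) (oc σ2) τ := H.e2.qr
theorem q3 : QR (𝓞 K3) (𝓞 F) (oc σ3) τ := H.e3.qr

theorem τsq : τ ^ 2 = 2 := by
  rw [← H.m1, ← map_pow, H.k1.wsq, map_intCast, Int.cast_ofNat]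
theorem tsq : t ^ 2 = ((q * r * s : ℕ) : 𝓞 F) := by
  rw [← H.m2, ← map_pow, H.k2.wsq]; simp

theorem rat (x : F) (h1 : σ1 x = x) (h2 : σ2 x = x) : ∃ a : ℚ, x = a := by
  obtain ⟨α, hα⟩ := H.e1.fix x h1
  obtain ⟨a, b, rfl⟩ := H.k1.quad.span α
  refine ⟨a, ?_⟩
  simp only [map_add, map_mul, H.mK1, eq_ratCast, map_ratCast] at hα
  rw [← hα] at h2
  simp only [map_add, map_mul, map_ratCast, H.σ2τ] at h2
  have : (b : F) * τ = 0 := by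
    have h3 : 2 * ((b : F) * τ) = 0 := by linear_combination -h2
    simpa using h3
  rw [← hα, this, add_zero]

/-- multiples in the order ℤ[√2,√m] -/
theorem order (x : 𝓞 F) : ∃ a b c e : ℤ, ((2 * (q * r * s) : ℕ) : 𝓞 F) * x = 
    a + b * τ + c * t + e * (τ * t) := by
  obtain ⟨α, hα⟩ := H.q1.fix (x + oc σ1 x) (by rw [map_add, H.q1.inv, add_comm])
  obtain ⟨β, hβ⟩ := H.q1.fix ((x - oc σ1 x) * t) (by rw [map_mul, map_sub, H.q1.inv, H.q1.conj]; ring)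
  obtain ⟨a, b, rfl⟩ := H.k1.form α
  obtain ⟨c, e, rfl⟩ := H.k1.form β
  simp only [map_add, map_mul, H.m1, map_intCast] at hα hβ
  refine ⟨(q * r * s : ℕ) * a, (q * r * s : ℕ) * b, c, e, ?_⟩
  have h1 := H.tsq
  push_cast at h1 ⊢
  linear_combination -hα * (q * r * s : 𝓞 F) - t * hβ  - (x - oc σ1 x) * h1

/-- SQ -/
theorem sqLemma (n : ℕ) (y : F) (hy : y ^ 2 = n) : IsSquare n ∨ IsSquare (2 * n) ∨ 
    IsSquare (q * r * s * n) ∨ IsSquare (2 * (q * r * s) * n) := by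
  have key : ∀ (k : ℕ) (z : F), z ^ 2 = k → σ1 z = z → σ2 z = z → IsSquare k := by
    intro k z hz h1 h2
    obtain ⟨a, rfl⟩ := H.rat z h1 h2
    have : a ^ 2 = k := by exact_mod_cast hz
    rw [← Rat.isSquare_natCast_iff, ← this]
    exact IsSquare.sq a
  have sgn : ∀ σ : F ≃+* F, σ y = y ∨ σ y = -y := by
    intro σ
    apply sq_eq_sq_iff_eq_or_eq_neg.mp
    rw [← map_pow, hy, map_natCast]
  have eτ : (τ : F) ^ 2 = 2 := by
    have := congrArg (algebraMap (𝓞 F) F) H.τsq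
    rw [map_pow, map_ofNat] at this
    exact this
  have et : (t : F) ^ 2 = (q * r * s : ℕ) := by
    have := congrArg (algebraMap (𝓞 F) F) H.tsq
    simpa using this
  rcases sgn σ1 with a | a <;> rcases sgn σ2 with b | b
  · left; exact key n y hy a b
  · right; left
    refine key _ (τ * y) (by rw [mul_pow, hy, eτ]; push_cast; ring) ?_ ?_
    · rw [map_mul, H.σ1τ, a]
    · rw [map_mul, H.σ2τ, b]; ring
  · right; right; left
    refine key _ (t * y) (by rw [mul_pow, hy, et]; push_cast; ring) ?_ ?_
    · rw [map_mul, H.σ1t, a]; ring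
    · rw [map_mul, H.σ2t, b]
  · right; right; right
    refine key _ (τ * t * y) (by rw [mul_pow, mul_pow, hy, eτ, et]; push_cast; ring) ?_ ?_
    · rw [map_mul, map_mul, H.σ1τ, H.σ1t, a]; ring
    · rw [map_mul, map_mul, H.σ2τ, H.σ2t, b]; ring
end basic
end BQ

set_option linter.unusedVariables false
set_option linter.unusedSectionVars false
open NumberField

theorem Hyp.sq_even {q r s : ℕ} (h : Hyp q r s) {a b c e : ℕ} 
    (hs : IsSquare (2 ^ a * q ^ b * r ^ c * s ^ e)) : Even b ∧ Even c ∧ Even e := by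
  obtain ⟨h1, h2, h3, h4, h5, h6⟩ := h.ne
  have key : ∀ p : ℕ, Even ((2 ^ a * q ^ b * r ^ c * s ^ e).factorization p) := by
    intro p
    obtain ⟨k, hk⟩ := hs
    rw [hk]
    by_cases k0 : k = 0
    · simp [k0]
    rw [Nat.factorization_mul k0 k0]
    exact ⟨_, rfl⟩
  have z1 := h.hq.ne_zero
  have z2 := h.hr.ne_zero
  have z3 := h.hs.ne_zero
  have ev : ∀ p : ℕ, (2 ^ a * q ^ b * r ^ c * s ^ e).factorization p = 
      a * (Nat.factorization 2 p) + b * (Nat.factorization q p) + c * (Nat.factorization r p) + e * (Nat.factorization s p) := by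
    intro p
    rw [Nat.factorization_mul (by simp [z1, z2]) (by simp [z3]), Nat.factorization_mul (by simp [z1]) (by simp [z2]),
      Nat.factorization_mul (by simp) (by simp [z1]), Nat.factorization_pow, Nat.factorization_pow, Nat.factorization_pow,
      Nat.factorization_pow]
    simp
  have kq := key q
  have kr := key r
  have ks := key s
  rw [ev, Nat.prime_two.factorization, h.hq.factorization, h.hr.factorization, h.hs.factorization] at kq kr ks
  simp [Finsupp.single_apply, h1, h2, h3, h4, h5, h6, h1.symm, h2.symm, h3.symm, h4.symm, h5.symm, h6.symm] at kq kr ks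
  exact ⟨kq, kr, ks⟩

theorem QR.normUnit {A B : Type*} [CommRing A] [CommRing B] [IsDedekindDomain A] [IsDedekindDomain B]
    [Algebra A B] [Module.Finite A B] [Module.IsTorsionFree A B] [FaithfulSMul A B]
    {σ : B ≃+* B} {τ : B} (h : QR A B σ τ) (u : Bˣ) : ∃ v : Aˣ, algebraMap A B v = u * σ u := by
  obtain ⟨a, ha⟩ := h.fix (u * σ u) (by rw [map_mul, h.inv, mul_comm])
  obtain ⟨b, hb⟩ := h.fix ((u⁻¹ : Bˣ) * σ (u⁻¹ : Bˣ)) (by rw [map_mul, h.inv, mul_comm])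
  have hab : a * b = 1 := by
    apply FaithfulSMul.algebraMap_injective A B
    rw [map_mul, ha, hb, map_one]
    have : (u : B) * σ u * ((u⁻¹ : Bˣ) * σ (u⁻¹ : Bˣ)) = (u * (u⁻¹ : Bˣ)) * σ (u * (u⁻¹ : Bˣ)) := by
      rw [map_mul]; ring
    rw [this]; simp
  exact ⟨⟨a, b, hab, by rw [mul_comm, hab]⟩, ha⟩

theorem fund_two : ∃ E : Pell.Solution₁ 2, Pell.IsFundamental E ∧ E.x = 3 ∧ E.y = 2 := by
  refine ⟨Pell.Solution₁.mk 3 2 (by norm_num), ⟨by simp, by simp, ?_⟩, by simp, by simp⟩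
  intro b hb
  simp only [Pell.Solution₁.x_mk]
  by_contra hlt
  have : b.x = 2 := by omega
  have h2 := b.prop
  rw [this] at h2
  omega

namespace QF
variable {K : Type*} [Field K] [NumberField K] {σ : K ≃+* K} {w : 𝓞 K} {d : ℤ}

theorem eps2 (h : QF K σ w 2) : ∃ η : (𝓞 K)ˣ, (η : 𝓞 K) = 1 + w := 
  ⟨⟨1 + w, w - 1, by linear_combination h.wsq, by linear_combination h.wsq⟩, rfl⟩

theorem units1 (h : QF K σ w 2) (η : (𝓞 K)ˣ) (hη : (η : 𝓞 K) = 1 + w) (u : (𝓞 K)ˣ) :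
    ∃ v : (𝓞 K)ˣ, u = v ^ 2 ∨ u = - v ^ 2 ∨ u = v ^ 2 * η ∨ u = - v ^ 2 * η := by
  obtain ⟨E, hE, hx, hy⟩ := fund_two
  have hpu : h.pu E = η ^ 2 := by
    ext1
    rw [pu_val, hx, hy, Units.val_pow_eq_pow_val, hη]; push_cast
    linear_combination -h.wsq
  obtain ⟨a, b, e, hn | hn⟩ := h.unit_form u
  · obtain ⟨k, hk⟩ := h.units_pos E hE u a b e hn
    rw [hpu, ← zpow_natCast, zpow_comm, zpow_natCast] at hk
    refine ⟨η ^ k, ?_⟩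
    tauto
  · have hn' : (a + 2 * b) ^ 2 - 2 * (a + b) ^ 2 = 1 := by linear_combination -hn
    obtain ⟨k, hk⟩ := h.units_pos E hE (u * η) (a + 2 * b) (a + b) (by
      rw [Units.val_mul, e, hη]; push_cast; linear_combination (b : 𝓞 K) * h.wsq) hn'
    rw [hpu, ← zpow_natCast, zpow_comm, zpow_natCast] at hk
    refine ⟨η ^ k * η⁻¹, ?_⟩
    rcases hk with hk | hk
    · right; right; left
      rw [mul_pow, ← hk, inv_pow, sq, mul_inv]; simp
    · right; right; right
      have : (η ^ k) ^ 2 = - (u * η) := by rw [hk, neg_neg]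
      rw [mul_pow, this, inv_pow, sq, mul_inv]; simp
end QF

namespace BQ
variable {q r s : ℕ} {F K1 K2 K3 : Type*} [Field F] [Field K1] [Field K2] [Field K3]
    [NumberField F] [NumberField K1] [NumberField K2] [NumberField K3]
    [Algebra K1 F] [Algebra K2 F] [Algebra K3 F]
    {s1 : K1 ≃+* K1} {s2 : K2 ≃+* K2} {s3 : K3 ≃+* K3} {w1 : 𝓞 K1} {w2 : 𝓞 K2} {w3 : 𝓞 K3}
    {σ1 σ2 σ3 : F ≃+* F} {τ t : 𝓞 F} 
    {E2 : Pell.Solution₁ (q * r * s : ℤ)} {E3 : Pell.Solution₁ (2 * (q * r * s) : ℤ)} 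

/-- inclusion of units -/
noncomputable abbrev inc (K F : Type*) [Field K] [Field F] [Algebra K F] : (𝓞 K)ˣ →* (𝓞 F)ˣ := 
  Units.map (algebraMap (𝓞 K) (𝓞 F) : 𝓞 K →* 𝓞 F)

section basic
variable (H : BQ q r s F K1 K2 K3 s1 s2 s3 w1 w2 w3 σ1 σ2 σ3 τ t E2 E3)
include H

theorem conj3 (z : 𝓞 K3) : oc σ1 (algebraMap (𝓞 K3) (𝓞 F) z) = algebraMap (𝓞 K3) (𝓞 F) (oc s3 z) := by
  obtain ⟨a, b, rfl⟩ := H.k3.form z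
  rw [H.k3.conj_form]
  have h1 : oc σ1 τ = τ := by rw [← H.m1, H.q1.fixA]
  simp only [map_add, map_sub, map_mul, map_intCast, H.m3, h1, H.q1.conj]
  ring

theorem conj32 (z : 𝓞 K3) : oc σ2 (algebraMap (𝓞 K3) (𝓞 F) z) = algebraMap (𝓞 K3) (𝓞 F) (oc s3 z) := by
  rw [← H.o13, H.q3.fixA, H.conj3]

theorem sqclass {b c e : ℕ} (a : ℕ) (y : F) (hy : y ^ 2 = ((2 ^ a * q ^ b * r ^ c * s ^ e : ℕ) : F)) :
   (Even b ∧ Even c ∧ Even e) ∨ (Even (b + 1) ∧ Even (c + 1) ∧ Even (e + 1)) := by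
  rcases H.sqLemma _ y hy with h | h | h | h
  · exact Or.inl (H.hyp.sq_even h)
  · exact Or.inl (H.hyp.sq_even (a := a + 1) (by convert h using 1; ring))
  · exact Or.inr (H.hyp.sq_even (a := a) (by convert h using 1; ring))
  · exact Or.inr (H.hyp.sq_even (a := a + 1) (by convert h using 1; ring))

theorem nrm3 (v : (𝓞 K3)ˣ) : (v : 𝓞 K3) * oc s3 v = 1 := by
  obtain ⟨a, b, e, hn | hn⟩ := H.k3.unit_form v
  · rw [e, H.k3.conj_form]
    have : ((a ^ 2 - (2 * (q * r * s)) * b ^ 2 : ℤ) : 𝓞 K3) = 1 := by rw [hn]; simp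
    have h2 := H.k3.wsq
    push_cast at this h2
    linear_combination this - (b : 𝓞 K3) ^ 2 * h2
  · exact absurd ⟨a, b, 1, one_ne_zero, by linarith⟩ H.hyp.neg_even

theorem u_sq (u : (𝓞 F)ˣ) : ∃ (n1 : (𝓞 K1)ˣ) (n2 : (𝓞 K2)ˣ) (n3 : (𝓞 K3)ˣ), 
    u ^ 2 = inc K1 F n1 * inc K2 F n2 * inc K3 F n3 := by
  obtain ⟨n1, h1⟩ := H.q1.normUnit u
  obtain ⟨n2, h2⟩ := H.q2.normUnit u
  obtain ⟨n3, h3⟩ := H.q3.normUnit u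
  refine ⟨n1, n2, n3, ?_⟩
  have e : oc σ1 (algebraMap (𝓞 K3) (𝓞 F) n3) * algebraMap (𝓞 K3) (𝓞 F) n3 = 1 := by
    rw [H.conj3, ← map_mul, mul_comm, H.nrm3, map_one]
  rw [h3] at e
  rw [map_mul, H.o13] at e
  ext1
  simp only [Units.val_mul, Units.val_pow_eq_pow_val, Units.coe_map, MonoidHom.coe_coe, h1, h2, h3]
  have : (u : 𝓞 F) ^ 2 * (oc σ1 u * oc σ2 u * (u * oc σ3 u)) = u ^ 2 * 1 := by rw [e]
  linear_combination -this
end basic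
end BQ

set_option linter.unusedVariables false
set_option linter.unusedSectionVars false
open NumberField
namespace QF
variable {K : Type*} [Field K] [NumberField K] {σ : K ≃+* K} {w : 𝓞 K} {d : ℤ}

theorem pu_pos (h : QF K σ w d) (E : Pell.Solution₁ d) (hE : Pell.IsFundamental E) (ι : 𝓞 K →+* ℝ) :
    0 < ι (h.pu E) := by
  rw [pu_val, map_add, map_intCast]
  set Y := ι (E.y * w) with hY
  have h1 : (E.x : ℝ) ^ 2 - Y ^ 2 = 1 := by
    have h2 : ((E.x ^ 2 - d * E.y ^ 2 : ℤ) : ℝ) = 1 := by rw [E.prop]; simp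
    have h3 : Y ^ 2 = d * E.y ^ 2 := by
      rw [hY, ← map_pow, mul_pow, h.wsq]; simp; ring
    rw [h3]; push_cast at h2; exact h2
  have hx : (1:ℝ) < E.x := by exact_mod_cast hE.1
  have : |Y| < E.x := abs_lt_of_sq_lt_sq (by linarith) (by linarith)
  have := (abs_lt.mp this).1
  linarith

theorem pu_rep (h : QF K σ w d) (E : Pell.Solution₁ d) (n : ℕ) (hn : n ≠ 0) (k : ℤ) (hk : k ≠ 0)
    (e : 2 * (E.x + 1) = n * k ^ 2) {F : Type*} [Field F] [CharZero F] (φ : 𝓞 K →+* F) : 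
    ∃ y : F, y ≠ 0 ∧ φ (h.pu E) = n * y ^ 2 := by
  have h1 := congrArg φ (h.pu_sq E)
  rw [e] at h1
  simp only [map_pow, map_add, map_one, map_mul, map_intCast] at h1
  have hu : φ (h.pu E) ≠ 0 := ((h.pu E).isUnit.map φ).ne_zero
  set ε := φ (h.pu E)
  have hn' : (n : F) ≠ 0 := by exact_mod_cast hn
  have hk' : (k : F) ≠ 0 := by exact_mod_cast hk
  push_cast at h1
  have e1 : ε = n * ((1 + ε) / (n * k)) ^ 2 := by
    field_simp
    linear_combination -h1
  refine ⟨(1 + ε) / (n * k), ?_, e1⟩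
  intro h0
  rw [h0] at e1
  simp at e1
  exact hu e1
end QF

theorem neg_one_or {U : Type*} [Group U] [HasDistribNeg U] {a x : U} (h : a = x ∨ a = -x) : ∃ g : U, (g = 1 ∨ g = -1) ∧ a = g * x := by
  rcases h with h | h
  · exact ⟨1, Or.inl rfl, by simpa using h⟩
  · exact ⟨-1, Or.inr rfl, by simpa using h⟩

section cg
variable {U : Type*} [CommGroup U]
theorem cg1 {u x g e n2 n3 : U} (h : u ^ 2 = (g * x ^ 2 * e) * n2 * n3) : (u * x⁻¹) ^ 2 = g * e * n2 * n3 := by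
  rw [mul_pow, inv_pow, mul_inv_eq_iff_eq_mul, h]; ac_rfl
theorem cg2 {u x g a A b B : U} (h : u ^ 2 = (g * x ^ 2) * (a * A) * (b * B)) : 
    (u * x⁻¹) ^ 2 = (g * a * b) * A * B := by
  rw [mul_pow, inv_pow, mul_inv_eq_iff_eq_mul, h]; ac_rfl
theorem cg3 {u A B : U} {k l k' l' K L : ℤ} (h : u ^ 2 = A ^ k * B ^ l) (hk : k' + 2 * K = k) (hl : l' + 2 * L = l) :
    (u * (A ^ K)⁻¹ * (B ^ L)⁻¹) ^ 2 = A ^ k' * B ^ l' := by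
  rw [mul_pow, mul_pow, inv_pow, inv_pow, mul_inv_eq_iff_eq_mul, mul_inv_eq_iff_eq_mul, h, ← hk, ← hl, zpow_add, zpow_add, 
    zpow_mul', zpow_mul', zpow_ofNat, zpow_ofNat]
  ac_rfl
theorem cg4 {u x A B : U} (h : u * x⁻¹ * A⁻¹ * B⁻¹ = 1) : u = x * A * B := by
  rw [mul_inv_eq_iff_eq_mul, mul_inv_eq_iff_eq_mul, mul_inv_eq_iff_eq_mul, one_mul] at h
  rw [h]; ac_rfl
end cg

namespace BQ
variable {q r s : ℕ} {F K1 K2 K3 : Type*} [Field F] [Field K1] [Field K2] [Field K3]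
    [NumberField F] [NumberField K1] [NumberField K2] [NumberField K3]
    [Algebra K1 F] [Algebra K2 F] [Algebra K3 F]
    {s1 : K1 ≃+* K1} {s2 : K2 ≃+* K2} {s3 : K3 ≃+* K3} {w1 : 𝓞 K1} {w2 : 𝓞 K2} {w3 : 𝓞 K3}
    {σ1 σ2 σ3 : F ≃+* F} {τ t : 𝓞 F} 
    {E2 : Pell.Solution₁ (q * r * s : ℤ)} {E3 : Pell.Solution₁ (2 * (q * r * s) : ℤ)} 
section basic
variable (H : BQ q r s F K1 K2 K3 s1 s2 s3 w1 w2 w3 σ1 σ2 σ3 τ t E2 E3)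
include H

theorem no_eps2 (ι : F →+* ℝ) (u g : (𝓞 F)ˣ) (hg : g = 1 ∨ g = -1) (η : (𝓞 K1)ˣ) (hη : (η : 𝓞 K1) = 1 + w1)
    (n2 : (𝓞 K2)ˣ) (n3 : (𝓞 K3)ˣ) (h : u ^ 2 = g * inc K1 F η * inc K2 F n2 * inc K3 F n3) : False := by
  have h0 : (u : 𝓞 F) ^ 2 = g * (1 + τ) * algebraMap (𝓞 K2) (𝓞 F) n2 * algebraMap (𝓞 K3) (𝓞 F) n3 := by
    have := congrArg Units.val h
    simpa [hη, H.m1] using this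
  have hg2 : (g : 𝓞 F) ^ 2 = 1 := by rcases hg with rfl | rfl <;> simp
  have hgσ : oc σ2 (g : 𝓞 F) = g := by rcases hg with rfl | rfl <;> simp
  have h1 := congrArg (oc σ2) h0
  simp only [map_mul, map_pow, hgσ, map_add, map_one, H.q2.conj, H.q2.fixA, H.conj32] at h1
  have h3 : algebraMap (𝓞 K3) (𝓞 F) n3 * algebraMap (𝓞 K3) (𝓞 F) (oc s3 n3) = 1 := by
    rw [← map_mul, H.nrm3, map_one]
  set x := algebraMap (𝓞 K2) (𝓞 F) n2 with hx
  set y := algebraMap (𝓞 K3) (𝓞 F) n3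
  set y' := algebraMap (𝓞 K3) (𝓞 F) (oc s3 n3)
  have h4 : (u * oc σ2 u) ^ 2 = - x ^ 2 := by
    have : (u * oc σ2 u) ^ 2 = (g : 𝓞 F) ^ 2 * (1 - τ ^ 2) * x ^ 2 * (y * y') := by
      rw [mul_pow, h0, h1]; ring
    rw [this, hg2, H.τsq, h3]; ring
  have h5 := congrArg (ι.comp (algebraMap (𝓞 F) F)) h4
  rw [map_neg, map_pow, map_pow] at h5
  have hx0 : (ι.comp (algebraMap (𝓞 F) F)) x ≠ 0 := by
    have : IsUnit x := n2.isUnit.map _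
    exact (this.map _).ne_zero
  have := sq_nonneg ((ι.comp (algebraMap (𝓞 F) F)) (u * oc σ2 u))
  have := pow_pos (abs_pos.mpr hx0) 2
  rw [sq_abs] at this
  linarith

theorem noeps (u : (𝓞 F)ˣ) (k l : ℤ) (hk : k = 0 ∨ k = 1) (hl : l = 0 ∨ l = 1) 
    (h : u ^ 2 = inc K2 F (H.k2.pu E2) ^ k * inc K3 F (H.k3.pu E3) ^ l) : k = 0 ∧ l = 0 := by
  obtain ⟨z1, z2, z3⟩ := QF.nz H.hyp
  obtain ⟨k2, hk2, hk2'⟩ := H.hyp.fund2 E2 H.h2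
  obtain ⟨k3, hk3, hk3'⟩ := H.hyp.fund3 E3 H.h3 H.hns
  obtain ⟨y2, hy2, e2⟩ := H.k2.pu_rep E2 (r * s) (by simp [z2, z3]) k2 hk2 (by rw [hk2']; push_cast; ring) 
    ((algebraMap (𝓞 F) F).comp (algebraMap (𝓞 K2) (𝓞 F)))
  have H3 : ∃ y3 : F, y3 ≠ 0 ∧ (((algebraMap (𝓞 F) F).comp (algebraMap (𝓞 K3) (𝓞 F))) (H.k3.pu E3) = (s : ℕ) * y3 ^ 2 ∨ 
     ((algebraMap (𝓞 F) F).comp (algebraMap (𝓞 K3) (𝓞 F))) (H.k3.pu E3) = (2 * r : ℕ) * y3 ^ 2) := by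
    rcases hk3' with hk3' | hk3'
    · obtain ⟨y, hy, e⟩ := H.k3.pu_rep E3 s z3 k3 hk3 hk3' ((algebraMap (𝓞 F) F).comp (algebraMap (𝓞 K3) (𝓞 F)))
      exact ⟨y, hy, Or.inl e⟩
    · obtain ⟨y, hy, e⟩ := H.k3.pu_rep E3 (2 * r) (by simp [z2]) k3 hk3 (by rw [hk3']; push_cast; ring) ((algebraMap (𝓞 F) F).comp (algebraMap (𝓞 K3) (𝓞 F)))
      exact ⟨y, hy, Or.inr e⟩
  obtain ⟨y3, hy3, e3⟩ := H3
  have c2 : (algebraMap (𝓞 F) F) (inc K2 F (H.k2.pu E2) : 𝓞 F) = ((algebraMap (𝓞 F) F).comp (algebraMap (𝓞 K2) (𝓞 F))) (H.k2.pu E2) := rfl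
  have c3 : (algebraMap (𝓞 F) F) (inc K3 F (H.k3.pu E3) : 𝓞 F) = ((algebraMap (𝓞 F) F).comp (algebraMap (𝓞 K3) (𝓞 F))) (H.k3.pu E3) := rfl
  have h' := congrArg (fun z : (𝓞 F)ˣ => algebraMap (𝓞 F) F (z : 𝓞 F)) h
  rw [← c2] at e2
  rw [← c3] at e3
  clear hk2' hk3'
  rcases hk with rfl | rfl <;> rcases hl with rfl | rfl
  · simp
  · exfalso
    simp only [zpow_zero, zpow_one, one_mul, Units.val_pow_eq_pow_val, map_pow] at h'
    rcases e3 with e3 | e3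
    · have := H.sqclass (b := 0) (c := 0) (e := 1) 0 (algebraMap (𝓞 F) F (u : 𝓞 F) / y3) (by
        rw [div_pow, h', e3]; field_simp; simp)
      simp at this
    · have := H.sqclass (b := 0) (c := 1) (e := 0) 1 (algebraMap (𝓞 F) F (u : 𝓞 F) / y3) (by
        rw [div_pow, h', e3]; field_simp; simp)
      simp at this
  · exfalso
    simp only [zpow_zero, zpow_one, mul_one, Units.val_pow_eq_pow_val, map_pow] at h'
    have := H.sqclass (b := 0) (c := 1) (e := 1) 0 (algebraMap (𝓞 F) F (u : 𝓞 F) / y2) (by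
        rw [div_pow, h', e2]; field_simp; simp)
    simp at this
  · exfalso
    simp only [zpow_one, Units.val_mul, Units.val_pow_eq_pow_val, map_pow, map_mul] at h'
    rcases e3 with e3 | e3
    · have := H.sqclass (b := 0) (c := 1) (e := 2) 0 (algebraMap (𝓞 F) F (u : 𝓞 F) / (y2 * y3)) (by
        rw [div_pow, h', e3, e2]; field_simp; push_cast; ring)
      revert this; decide
    · have := H.sqclass (b := 0) (c := 2) (e := 1) 1 (algebraMap (𝓞 F) F (u : 𝓞 F) / (y2 * y3)) (by
        rw [div_pow, h', e3, e2]; field_simp; push_cast; ring)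
      revert this; decide

theorem pm_sq (ι : F →+* ℝ) (u g : (𝓞 F)ˣ) (hg : g = 1 ∨ g = -1) (k l : ℤ)
    (h : u ^ 2 = g * inc K2 F (H.k2.pu E2) ^ k * inc K3 F (H.k3.pu E3) ^ l) : g = 1 := by
  rcases hg with rfl | rfl
  · rfl
  exfalso
  let ρ : (𝓞 F)ˣ →* ℝˣ := Units.map ((ι.comp (algebraMap (𝓞 F) F) : 𝓞 F →+* ℝ) : 𝓞 F →* ℝ)
  have h2 : (0:ℝ) < ρ (inc K2 F (H.k2.pu E2)) := H.k2.pu_pos E2 H.h2 ((ι.comp (algebraMap (𝓞 F) F)).comp (algebraMap (𝓞 K2) (𝓞 F)))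
  have h3 : (0:ℝ) < ρ (inc K3 F (H.k3.pu E3)) := H.k3.pu_pos E3 H.h3 ((ι.comp (algebraMap (𝓞 F) F)).comp (algebraMap (𝓞 K3) (𝓞 F)))
  have e : (u ^ 2) = -(inc K2 F (H.k2.pu E2) ^ k * inc K3 F (H.k3.pu E3) ^ l) := by rw [h]; simp
  have e' : - u ^ 2 = (inc K2 F (H.k2.pu E2) ^ k * inc K3 F (H.k3.pu E3) ^ l) := by rw [e]; simp
  have h4 := congrArg (fun z => ((ρ z : ℝˣ) : ℝ)) e'
  simp only [map_mul, map_zpow, Units.val_mul, Units.val_zpow_eq_zpow_val] at h4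
  have h5 : ((ρ (-u ^ 2) : ℝˣ) : ℝ) = - ((ρ u : ℝˣ) : ℝ) ^ 2 := by
    change (ι.comp (algebraMap (𝓞 F) F)) _ = - ((ι.comp (algebraMap (𝓞 F) F)) _) ^ 2
    rw [Units.val_neg, map_neg, Units.val_pow_eq_pow_val, map_pow]
  rw [h5] at h4
  have h6 := mul_pos (zpow_pos h2 k) (zpow_pos h3 l)
  rw [← h4] at h6
  nlinarith [sq_nonneg ((ρ u : ℝˣ) : ℝ)]

theorem units_gen (ι : F →+* ℝ) (u : (𝓞 F)ˣ) : ∃ (v1 : (𝓞 K1)ˣ) (v2 : (𝓞 K2)ˣ) (v3 : (𝓞 K3)ˣ), 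
    u = inc K1 F v1 * inc K2 F v2 * inc K3 F v3 := by
  have pmmul : ∀ a b : (𝓞 F)ˣ, a = 1 ∨ a = -1 → b = 1 ∨ b = -1 → a * b = 1 ∨ a * b = -1 := by
    rintro a b (rfl | rfl) (rfl | rfl) <;> simp
  obtain ⟨n1, n2, n3, hu⟩ := H.u_sq u
  obtain ⟨η, hη⟩ := H.k1.eps2
  obtain ⟨v, hv⟩ := H.k1.units1 η hη n1
  have hv' : ∃ g : (𝓞 K1)ˣ, (g = 1 ∨ g = -1) ∧ (n1 = g * v ^ 2 ∨ n1 = g * v ^ 2 * η) := by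
    rcases hv with h | h | h | h
    · exact ⟨1, Or.inl rfl, Or.inl (by simpa using h)⟩
    · exact ⟨-1, Or.inr rfl, Or.inl (by simpa using h)⟩
    · exact ⟨1, Or.inl rfl, Or.inr (by simpa using h)⟩
    · exact ⟨-1, Or.inr rfl, Or.inr (by simpa using h)⟩
  clear hv
  obtain ⟨g1, hg1, hn1⟩ := hv'
  have hg1' : inc K1 F g1 = 1 ∨ inc K1 F g1 = -1 := by
    rcases hg1 with rfl | rfl
    · left; simp
    · right; ext1; simp
  rcases hn1 with hn1 | hn1
  swap
  · exfalso
    refine H.no_eps2 ι (u * (inc K1 F v)⁻¹) (inc K1 F g1) hg1' η hη n2 n3 ?_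
    exact cg1 (by rw [hu, hn1, map_mul, map_mul, map_pow])
  obtain ⟨k, hk⟩ := H.k2.units E2 H.h2 H.hyp.neg_odd n2
  obtain ⟨l, hl⟩ := H.k3.units E3 H.h3 H.hyp.neg_even n3
  obtain ⟨g2, hg2, hn2⟩ := neg_one_or hk
  obtain ⟨g3, hg3, hn3⟩ := neg_one_or hl
  have hg2' : inc K2 F g2 = 1 ∨ inc K2 F g2 = -1 := by
    rcases hg2 with rfl | rfl
    · left; simp
    · right; ext1; simp
  have hg3' : inc K3 F g3 = 1 ∨ inc K3 F g3 = -1 := by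
    rcases hg3 with rfl | rfl
    · left; simp
    · right; ext1; simp
  set A := inc K2 F (H.k2.pu E2) with hA
  set B := inc K3 F (H.k3.pu E3) with hB
  have h1 : (u * (inc K1 F v)⁻¹) ^ 2 = (inc K1 F g1 * inc K2 F g2 * inc K3 F g3) * A ^ k * B ^ l := by
    exact cg2 (by rw [hu, hn1, hn2, hn3]; simp only [map_mul, map_pow, map_zpow]; rfl)
  have hg := H.pm_sq ι _ _ (pmmul _ _ (pmmul _ _ hg1' hg2') hg3') k l h1
  rw [hg, one_mul] at h1
  have ek := Int.emod_add_mul_ediv k 2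
  have el := Int.emod_add_mul_ediv l 2
  have h2 : (u * (inc K1 F v)⁻¹ * (A ^ (k / 2))⁻¹ * (B ^ (l / 2))⁻¹) ^ 2 = A ^ (k % 2) * B ^ (l % 2) := by
    exact cg3 h1 ek el
  obtain ⟨k0, l0⟩ := H.noeps _ _ _ (Int.emod_two_eq_zero_or_one k) (Int.emod_two_eq_zero_or_one l) h2
  rw [k0, l0, zpow_zero, zpow_zero, mul_one] at h2
  have h3 : u * (inc K1 F v)⁻¹ * (A ^ (k / 2))⁻¹ * (B ^ (l / 2))⁻¹ = 1 ∨ 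
    u * (inc K1 F v)⁻¹ * (A ^ (k / 2))⁻¹ * (B ^ (l / 2))⁻¹ = -1 := by
    have := congrArg Units.val h2
    rw [Units.val_pow_eq_pow_val, Units.val_one, sq_eq_one_iff] at this
    rcases this with h | h
    · left; ext1; exact h
    · right; ext1; simpa using h
  rcases h3 with h3 | h3
  · refine ⟨v, H.k2.pu E2 ^ (k / 2), H.k3.pu E3 ^ (l / 2), ?_⟩
    rw [map_zpow, map_zpow, ← hA, ← hB]
    exact cg4 h3
  · refine ⟨-v, H.k2.pu E2 ^ (k / 2), H.k3.pu E3 ^ (l / 2), ?_⟩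
    rw [map_zpow, map_zpow, ← hA, ← hB]
    have : inc K1 F (-v) = - inc K1 F v := by ext1; simp
    rw [this]
    have h4 := cg4 (x := - inc K1 F v) (A := A ^ (k / 2)) (B := B ^ (l / 2)) (u := u) (by
      rw [inv_neg, mul_neg, neg_mul, neg_mul, h3, neg_neg])
    exact h4
end basic
end BQ

set_option linter.unusedVariables false
set_option linter.unusedSectionVars false
open NumberField

section gen
variable {K L : Type*} [Field K] [Field L] [NumberField K] [NumberField L] [Algebra K L]

noncomputable abbrev jh (K L : Type*) [Field K] [Field L] [NumberField K] [NumberField L] [Algebra K L] :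
  ClassGroup (𝓞 K) →* ClassGroup (𝓞 L) := (idMap_map (R := 𝓞 K) (S := 𝓞 L)).hom
noncomputable abbrev Nh (K L : Type*) [Field K] [Field L] [NumberField K] [NumberField L] [Algebra K L] :
  ClassGroup (𝓞 L) →* ClassGroup (𝓞 K) := (idMap_relNorm (R := 𝓞 K) (S := 𝓞 L)).hom

theorem jh_cl {I : Ideal (𝓞 K)} (hI : I ≠ ⊥) : jh K L (cl I) = cl (I.map (algebraMap (𝓞 K) (𝓞 L))) :=
  (idMap_map (R := 𝓞 K) (S := 𝓞 L)).hom_cl hI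
theorem Nh_cl {I : Ideal (𝓞 L)} (hI : I ≠ ⊥) : Nh K L (cl I) = cl (Ideal.relNorm (𝓞 K) I) :=
  (idMap_relNorm (R := 𝓞 K) (S := 𝓞 L)).hom_cl hI

theorem QR.jN {σ : 𝓞 L ≃+* 𝓞 L} {τ : 𝓞 L} (h : QR (𝓞 K) (𝓞 L) σ τ) {I : Ideal (𝓞 L)} (hI : I ≠ ⊥) :
    jh K L (Nh K L (cl I)) = cl I * cl (I.map σ) := by
  rw [Nh_cl hI, jh_cl, h.map_relNorm I hI, cl_mul hI (map_ne_bot' σ h.inv hI)]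
  exact (idMap_relNorm (R := 𝓞 K) (S := 𝓞 L)).ne I hI

theorem QR.Nj {σ : 𝓞 L ≃+* 𝓞 L} {τ : 𝓞 L} (h : QR (𝓞 K) (𝓞 L) σ τ) (x : ClassGroup (𝓞 K)) :
    Nh K L (jh K L x) = x ^ 2 := by
  obtain ⟨I, hI, rfl⟩ := cl_surj x
  rw [jh_cl hI, Nh_cl, Ideal.relNorm_algebraMap, h.rank, cl_pow hI]
  exact (idMap_map (R := 𝓞 K) (S := 𝓞 L)).ne I hI

theorem QF.Rr.map {x : ClassGroup (𝓞 K)} {n : ℕ} (h : QF.Rr x n) : QF.Rr (jh K L x) n := by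
  obtain ⟨J, hJ, rfl, e⟩ := h
  refine ⟨J.map (algebraMap (𝓞 K) (𝓞 L)), (idMap_map (R := 𝓞 K) (S := 𝓞 L)).ne J hJ, (jh_cl hJ).symm, ?_⟩
  rw [← Ideal.map_pow, e, Ideal.map_span, Set.image_singleton, map_natCast]
end gen

theorem pow2_one {G : Type*} [Group G] (h : ∀ x : G, x ^ 2 = 1 → x = 1) (n : ℕ) (x : G) (hx : x ^ 2 ^ n = 1) : x = 1 := by
  induction n with
  | zero => simpa using hx
  | succ n ih => exact ih (h _ (by rw [← pow_mul, ← pow_succ]; exact hx))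
theorem pow2_two {G : Type*} [Group G] (h : ∀ x : G, (x ^ 2) ^ 2 = 1 → x ^ 2 = 1) (n : ℕ) (x : G) (hx : x ^ 2 ^ n = 1) : x ^ 2 = 1 := by
  induction n with
  | zero => simp at hx; simp [hx]
  | succ n ih =>
    cases n with
    | zero => simpa using hx
    | succ n => 
      apply ih
      rw [pow_succ 2 n, pow_mul]
      apply h
      rw [← pow_mul, ← pow_mul]
      rw [pow_succ, pow_succ, mul_assoc] at hx
      exact hx

namespace BQ
variable {q r s : ℕ} {F K1 K2 K3 : Type*} [Field F] [Field K1] [Field K2] [Field K3]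
    [NumberField F] [NumberField K1] [NumberField K2] [NumberField K3]
    [Algebra K1 F] [Algebra K2 F] [Algebra K3 F]
    {s1 : K1 ≃+* K1} {s2 : K2 ≃+* K2} {s3 : K3 ≃+* K3} {w1 : 𝓞 K1} {w2 : 𝓞 K2} {w3 : 𝓞 K3}
    {σ1 σ2 σ3 : F ≃+* F} {τ t : 𝓞 F} 
    {E2 : Pell.Solution₁ (q * r * s : ℤ)} {E3 : Pell.Solution₁ (2 * (q * r * s) : ℤ)} 
section basic
variable (H : BQ q r s F K1 K2 K3 s1 s2 s3 w1 w2 w3 σ1 σ2 σ3 τ t E2 E3)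
include H
open QF

theorem cap (n : ℕ) (hn : n ∣ 2 * (q * r * s)) : Rr (1 : ClassGroup (𝓞 F)) n := by
  obtain ⟨z1, z2, z3⟩ := QF.nz H.hyp
  have R2 : Rr (1 : ClassGroup (𝓞 F)) 2 := Rr.one_of 2 (by norm_num) τ 1 (by rw [H.τsq]; simp)
  have Rm : Rr (1 : ClassGroup (𝓞 F)) (q * (r * s)) := 
    Rr.one_of _ (by simp [z1, z2, z3]) t 1 (by rw [H.tsq]; push_cast; ring)
  obtain ⟨k, hk, hk2⟩ := H.hyp.fund2 E2 H.h2
  have Rrs : Rr (1 : ClassGroup (𝓞 F)) (r * s) := by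
    have := (Rr.eps H.k2 E2 (r * s) (mul_ne_zero z2 z3) k hk (by rw [hk2]; push_cast; ring)).map (L := F)
    rwa [map_one] at this
  have Rq : Rr (1 : ClassGroup (𝓞 F)) q := by
    simpa using Rr.toggle (mul_ne_zero z2 z3) Rm (z := 1) (by simpa using Rrs)
  have Rs : Rr (1 : ClassGroup (𝓞 F)) s := by
    rcases QF.R3 H.hyp H.k3 E3 H.h3 H.hns with ⟨hA, -⟩ | ⟨-, hA⟩
    · have := hA.map (L := F)
      rwa [map_one] at this
    · have := hA.map (L := F)
      rw [map_one] at this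
      simpa using Rr.toggle z1 this (z := 1) (by simpa using Rq)
  have Rr' : Rr (1 : ClassGroup (𝓞 F)) r := by
    simpa using Rr.toggle z3 Rrs (z := 1) (by simpa using Rs)
  have pw : ∀ n : ℕ, Rr (1 : ClassGroup (𝓞 F)) n → ∀ a : Bool, Rr (1 : ClassGroup (𝓞 F)) (n ^ a.toNat) := by
    intro n hn a
    cases a
    · simpa using Rr.one_one
    · simpa using hn
  obtain ⟨a, b, c, e, rfl⟩ := dvd_cases H.hyp hn
  simpa using (((pw 2 R2 a).mul (pw q Rq b)).mul (pw r Rr' c)).mul (pw s Rs e)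

theorem cap2 {x : ClassGroup (𝓞 K2)} (hx : x ^ 2 = 1) : jh K2 F x = 1 := by
  obtain ⟨n, hn, hR⟩ := QF.amb2 H.hyp H.k2 hx
  exact (hR.map (L := F)).uniq (H.cap n hn)
theorem cap3 {x : ClassGroup (𝓞 K3)} (hx : x ^ 2 = 1) : jh K3 F x = 1 := by
  obtain ⟨n, hn, hR⟩ := QF.amb3 H.hyp H.k3 hx
  exact (hR.map (L := F)).uniq (H.cap n hn)

theorem S1 {I : Ideal (𝓞 F)} (hI : I ≠ ⊥) (n : ℕ) (h : cl I ^ 2 ^ n = 1) : cl I * cl (I.map (oc σ1)) = 1 := by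
  rw [← H.q1.jN hI]
  have : Nh K1 F (cl I) = 1 := pow2_one (fun x hx => H.k1.cl1 hx) n _ (by rw [← map_pow, h, map_one])
  rw [this, map_one]
theorem S2 {I : Ideal (𝓞 F)} (hI : I ≠ ⊥) (n : ℕ) (h : cl I ^ 2 ^ n = 1) : cl I * cl (I.map (oc σ2)) = 1 := by
  rw [← H.q2.jN hI]
  exact H.cap2 (pow2_two (fun x hx => QF.cl2 H.hyp H.k2 E2 H.h2 hx) n _ (by rw [← map_pow, h, map_one]))

theorem S3 {I : Ideal (𝓞 F)} (hI : I ≠ ⊥) (n : ℕ) (h : cl I ^ 2 ^ n = 1) : cl (I.map (oc σ3)) = cl I := by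
  have hI2 := map_ne_bot' (oc σ2) H.q2.inv hI
  have e2 := H.S2 hI n h
  have c2 : cl (I.map (oc σ2)) = (cl I)⁻¹ := (eq_inv_of_mul_eq_one_right e2)
  have e1 := H.S1 hI2 n (by rw [c2, inv_pow, h, inv_one])
  rw [c2, inv_mul_eq_one] at e1
  rw [e1]
  congr 1
  change I.map (oc σ3 : 𝓞 F →+* 𝓞 F) = (I.map (oc σ2 : 𝓞 F →+* 𝓞 F)).map (oc σ1 : 𝓞 F →+* 𝓞 F)
  rw [Ideal.map_map]
  congr 1
  ext1 x
  exact (H.o12 x).symm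
end basic
end BQ

set_option linter.unusedVariables false
set_option linter.unusedSectionVars false
open NumberField
namespace BQ
variable {q r s : ℕ} {F K1 K2 K3 : Type*} [Field F] [Field K1] [Field K2] [Field K3]
    [NumberField F] [NumberField K1] [NumberField K2] [NumberField K3]
    [Algebra K1 F] [Algebra K2 F] [Algebra K3 F]
    {s1 : K1 ≃+* K1} {s2 : K2 ≃+* K2} {s3 : K3 ≃+* K3} {w1 : 𝓞 K1} {w2 : 𝓞 K2} {w3 : 𝓞 K3}
    {σ1 σ2 σ3 : F ≃+* F} {τ t : 𝓞 F} 
    {E2 : Pell.Solution₁ (q * r * s : ℤ)} {E3 : Pell.Solution₁ (2 * (q * r * s) : ℤ)} 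

/-- the prime above 2 -/
structure IsP (σ : F ≃+* F) (τ : 𝓞 F) (P : Ideal (𝓞 F)) : Prop where
  ne : P ≠ ⊥
  sq : P ^ 2 = Ideal.span {τ}
  norm : Ideal.absNorm P = 2
  inv : P.map (oc σ) = P
  uniq : ∀ P' : Ideal (𝓞 F), P'.IsPrime → P' ≠ ⊥ → 2 * τ ∈ P' → P' = P

section basic
variable (H : BQ q r s F K1 K2 K3 s1 s2 s3 w1 w2 w3 σ1 σ2 σ3 τ t E2 E3)
include H

theorem m8 : ∃ M : ℕ, q * r * s = 8 * M + 7 := by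
  refine ⟨q * r * s / 8, ?_⟩
  have h1 : q * r * s % 8 = 7 := by
    rw [Nat.mul_mod, Nat.mul_mod q r, H.hyp.hq8, H.hyp.hr8, H.hyp.hs8]
  omega

theorem theta : ∃ θ : 𝓞 F, τ * θ = 1 + t := by
  obtain ⟨M, hM⟩ := H.m8
  have e := H.e3.ne
  have eτ : (τ : F) ^ 2 = 2 := by
    have := congrArg (algebraMap (𝓞 F) F) H.τsq
    rw [map_pow, map_ofNat] at this
    exact this
  have et : (t : F) ^ 2 = (8 * M + 7 : ℕ) := by
    have := congrArg (algebraMap (𝓞 F) F) H.tsq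
    rw [hM, map_pow, map_natCast] at this
    exact this
  set θ : F := (1 + t) / τ with hθ
  have h1 : θ ^ 2 = 4 * M + 4 + t := by
    rw [hθ, div_pow, eτ]; push_cast at et; field_simp; linear_combination et
  have hi : IsIntegral ℤ (θ ^ 2) := by
    rw [h1]
    have a1 : IsIntegral ℤ (t : F) := RingOfIntegers.isIntegral_coe t
    have a2 : IsIntegral ℤ ((4 * M + 4 : ℕ) : F) := isIntegral_natCast _
    have := a2.add a1
    push_cast at this; exact this
  have hi2 : IsIntegral ℤ θ := IsIntegral.of_pow (by norm_num) hi
  refine ⟨⟨θ, hi2⟩, ?_⟩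
  apply RingOfIntegers.ext
  change (τ : F) * θ = 1 + t
  rw [hθ]; field_simp

theorem absNorm_tau : Ideal.absNorm (Ideal.span {τ}) = 4 := by
  have e : Ideal.span {τ} = (Ideal.span {w1}).map (algebraMap (𝓞 K1) (𝓞 F)) := by
    rw [Ideal.map_span, Set.image_singleton, H.m1]
  rw [← Ideal.absNorm_relNorm (𝓞 K1), e, Ideal.relNorm_algebraMap, H.q1.rank, map_pow, H.k1.absNorm_span]
  have := H.k1.norm_form 0 1
  simp at this
  rw [this]; rfl

theorem exP : ∃ P, IsP σ3 τ P := by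
  obtain ⟨θ, hθ⟩ := H.theta
  obtain ⟨M, hM⟩ := H.m8
  have h2 := H.τsq
  have ht := H.tsq
  rw [hM] at ht
  push_cast at ht
  have hτ0 : τ ≠ 0 := H.q3.ne
  have hθ2 : θ ^ 2 = τ * θ + 4 * M + 3 := by
    have : τ ^ 2 * θ ^ 2 = τ ^ 2 * (τ * θ + 4 * M + 3) := by
      rw [h2]
      linear_combination (τ * θ + 1 + t) * hθ + ht - h2 * θ ^ 2 - 2 * hθ
    exact mul_left_cancel₀ (pow_ne_zero 2 hτ0) this
  set P : Ideal (𝓞 F) := Ideal.span {1 + θ, τ} with hP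
  have ma : 1 + θ ∈ P := Ideal.subset_span (by simp)
  have mb : τ ∈ P := Ideal.subset_span (by simp)
  have hsq : P ^ 2 = Ideal.span {τ} := by
    rw [sq]
    apply le_antisymm
    · rw [hP, Ideal.span_pair_mul_span_pair, Ideal.span_le]
      intro x hx
      simp only [Set.mem_insert_iff, Set.mem_singleton_iff] at hx
      rw [SetLike.mem_coe, Ideal.mem_span_singleton]
      rcases hx with rfl | rfl | rfl | rfl
      · exact ⟨θ + τ * (θ + 2 * M + 2), by linear_combination hθ2 - h2 * (θ + 2 * M + 2)⟩
      · exact Dvd.intro_left _ rfl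
      · exact Dvd.intro _ rfl
      · exact Dvd.intro _ rfl
    · rw [Ideal.span_singleton_le_iff_mem]
      have : τ = τ * (1 + θ) - (1 + θ) * (1 + θ) + (θ + 2 * M + 2) * (τ * τ) := by
        linear_combination hθ2 - h2 * (θ + 2 * M + 2)
      rw [this]
      exact add_mem (sub_mem (Ideal.mul_mem_mul mb ma) (Ideal.mul_mem_mul ma ma)) 
        (Ideal.mul_mem_left _ _ (Ideal.mul_mem_mul mb mb))
  have hne : P ≠ ⊥ := by
    intro h
    rw [h] at mb
    exact hτ0 mb
  have hn : Ideal.absNorm P = 2 := by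
    have := congrArg Ideal.absNorm hsq
    rw [map_pow, H.absNorm_tau] at this
    exact pow_left_injective two_ne_zero (by simpa using this)
  have hpr : P.IsPrime := Ideal.isPrime_of_irreducible_absNorm (by rw [hn]; exact Nat.prime_two)
  refine ⟨P, hne, hsq, hn, ?_, ?_⟩
  · apply pow_two_inj
    rw [← Ideal.map_pow, hsq, map_span_singleton', H.q3.conj, Ideal.span_singleton_neg]
  · intro P' hP' hP0 hm
    have hm2 : τ ∈ P' := by
      have : τ ^ 3 ∈ P' := by
        have e : τ ^ 3 = 2 * τ := by linear_combination τ * h2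
        rw [e]; exact hm
      exact hP'.mem_of_pow_mem 3 this
    have : P ≤ P' := by
      apply (Ideal.IsPrime.pow_le_iff (n := 2) two_ne_zero).mp
      rw [hsq, Ideal.span_singleton_le_iff_mem]; exact hm2
    exact ((hpr.isMaximal hne).eq_of_le hP'.ne_top this).symm
end basic
end BQ

set_option linter.unusedVariables false
set_option linter.unusedSectionVars false
open NumberField
namespace BQ
variable {q r s : ℕ} {F K1 K2 K3 : Type*} [Field F] [Field K1] [Field K2] [Field K3]
    [NumberField F] [NumberField K1] [NumberField K2] [NumberField K3]
    [Algebra K1 F] [Algebra K2 F] [Algebra K3 F]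
    {s1 : K1 ≃+* K1} {s2 : K2 ≃+* K2} {s3 : K3 ≃+* K3} {w1 : 𝓞 K1} {w2 : 𝓞 K2} {w3 : 𝓞 K3}
    {σ1 σ2 σ3 : F ≃+* F} {τ t : 𝓞 F} 
    {E2 : Pell.Solution₁ (q * r * s : ℤ)} {E3 : Pell.Solution₁ (2 * (q * r * s) : ℤ)} 

/-- twisted representation of an ambiguous class -/
def W (K3 : Type*) [Field K3] [NumberField K3] [Algebra K3 F] (σ : F ≃+* F) (c : ClassGroup (𝓞 F)) (v : (𝓞 K3)ˣ) : Prop :=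
  ∃ I : Ideal (𝓞 F), I ≠ ⊥ ∧ cl I = c ∧ ∃ α β : 𝓞 F, α ≠ 0 ∧ β ≠ 0 ∧ 
    Ideal.span {α} * I = Ideal.span {β} * I.map (oc σ) ∧ 
    β * oc σ β = algebraMap (𝓞 K3) (𝓞 F) v * (α * oc σ α)

/-- classes of strongly ambiguous ideals -/
def A0 (K3 : Type*) [Field K3] [NumberField K3] [Algebra K3 F] (P : Ideal (𝓞 F)) (c : ClassGroup (𝓞 F)) : Prop :=
  ∃ (x : ClassGroup (𝓞 K3)) (k : Bool), c = jh K3 F x * cl P ^ k.toNat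

theorem W.unit {c : ClassGroup (𝓞 F)} {v : (𝓞 K3)ˣ} (h : W K3 σ3 c v) (u : (𝓞 F)ˣ) (v' : (𝓞 K3)ˣ)
    (e : (u : 𝓞 F) * oc σ3 u = algebraMap (𝓞 K3) (𝓞 F) v') : W K3 σ3 c (v' * v) := by
  obtain ⟨I, hI, hc, α, β, hα, hβ, e1, e2⟩ := h
  refine ⟨I, hI, hc, α, u * β, hα, mul_ne_zero u.ne_zero hβ, ?_, ?_⟩
  · rw [e1]; congr 1
    exact Ideal.span_singleton_eq_span_singleton.mpr ⟨u, by ring⟩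
  · rw [map_mul, Units.val_mul, map_mul]
    linear_combination e * (β * oc σ3 β) + algebraMap (𝓞 K3) (𝓞 F) v' * e2

theorem W.mul {c d : ClassGroup (𝓞 F)} {v v' : (𝓞 K3)ˣ} (h : W K3 σ3 c v) (h' : W K3 σ3 d v') :
    W K3 σ3 (c * d) (v * v') := by
  obtain ⟨I, hI, hc, α, β, hα, hβ, e1, e2⟩ := h
  obtain ⟨J, hJ, hd, γ, δ, hγ, hδ, e3, e4⟩ := h'
  refine ⟨I * J, ideal_mul_ne hI hJ, by rw [cl_mul hI hJ, hc, hd], α * γ, β * δ, mul_ne_zero hα hγ, mul_ne_zero hβ hδ, ?_, ?_⟩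
  · rw [← Ideal.span_singleton_mul_span_singleton, ← Ideal.span_singleton_mul_span_singleton, Ideal.map_mul,
      mul_mul_mul_comm, e1, e3, mul_mul_mul_comm]
  · rw [map_mul, map_mul, Units.val_mul, map_mul]
    linear_combination (δ * oc σ3 δ) * e2 + algebraMap (𝓞 K3) (𝓞 F) v * (α * oc σ3 α) * e4

section basic
variable (H : BQ q r s F K1 K2 K3 s1 s2 s3 w1 w2 w3 σ1 σ2 σ3 τ t E2 E3)
include H

theorem Wsq {c : ClassGroup (𝓞 F)} {v : (𝓞 K3)ˣ} (h : W K3 σ3 c v) (u : (𝓞 K3)ˣ) : W K3 σ3 c (u ^ 2 * v) := 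
  h.unit (inc K3 F u) (u ^ 2) (by
    change algebraMap (𝓞 K3) (𝓞 F) u * oc σ3 (algebraMap (𝓞 K3) (𝓞 F) u) = _
    rw [H.q3.fixA, Units.val_pow_eq_pow_val, map_pow, sq])
theorem Wneg {c : ClassGroup (𝓞 F)} {v : (𝓞 K3)ˣ} (h : W K3 σ3 c v) : W K3 σ3 c (- v) := by
  obtain ⟨η, hη⟩ := H.k1.eps2
  have := h.unit (inc K1 F η) (-1) (by
    change algebraMap (𝓞 K1) (𝓞 F) η * oc σ3 (algebraMap (𝓞 K1) (𝓞 F) η) = _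
    rw [hη, map_add, map_one, H.m1, map_add, map_one, H.q3.conj, Units.val_neg, Units.val_one, map_neg, map_one]
    linear_combination - H.τsq)
  rwa [neg_one_mul] at this

theorem Wred {c : ClassGroup (𝓞 F)} {v : (𝓞 K3)ˣ} (h : W K3 σ3 c v) : W K3 σ3 c 1 ∨ W K3 σ3 c (H.k3.pu E3) := by
  have key : ∀ k : ℤ, W K3 σ3 c (H.k3.pu E3 ^ k) → W K3 σ3 c 1 ∨ W K3 σ3 c (H.k3.pu E3) := by
    intro k hk
    obtain ⟨j, hj | hj⟩ := Int.even_or_odd' k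
    · left
      have := H.Wsq hk (H.k3.pu E3 ^ (-j))
      rw [← zpow_natCast, ← zpow_mul, ← zpow_add, hj] at this
      have e : -j * (2 : ℕ) + 2 * j = 0 := by push_cast; ring
      rwa [e, zpow_zero] at this
    · right
      have := H.Wsq hk (H.k3.pu E3 ^ (-j))
      rw [← zpow_natCast, ← zpow_mul, ← zpow_add, hj] at this
      have e : -j * (2 : ℕ) + (2 * j + 1) = 1 := by push_cast; ring
      rwa [e, zpow_one] at this
  obtain ⟨k, hk | hk⟩ := H.k3.units E3 H.h3 H.hyp.neg_even v
  · exact key k (hk ▸ h)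
  · apply key k
    have := H.Wneg h
    rwa [hk, neg_neg] at this

theorem Wone {P : Ideal (𝓞 F)} (hP : IsP σ3 τ P) {c : ClassGroup (𝓞 F)} (h : W K3 σ3 c 1) : A0 K3 P c := by
  obtain ⟨I, hI, hc, α, β, hα, hβ, e1, e2⟩ := h
  rw [Units.val_one, map_one, one_mul] at e2
  obtain ⟨δ, hδ, -, hδ2⟩ := H90 (oc σ3) H.q3.inv τ H.q3.ne H.q3.conj I α β hα e1 e2
  have hσ : oc σ3 δ ≠ 0 := by simpa using hδ
  have hn : Ideal.span {oc σ3 δ} * I ≠ ⊥ := ideal_mul_ne (by simpa using hσ) hI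
  obtain ⟨J, k, hJ, e⟩ := H.q3.invariant P hP.ne hP.inv hP.uniq _ hn hδ2
  have hc2 : c = jh K3 F (cl J) * cl P ^ k := by
    rw [← hc, ← cl_span_mul hσ hI, e, cl_mul _ (pow_ne_zero k hP.ne), jh_cl hJ, cl_pow hP.ne]
    exact (idMap_map (R := 𝓞 K3) (S := 𝓞 F)).ne J hJ
  have hP2 : cl P ^ 2 = 1 := by rw [← cl_pow hP.ne, hP.sq, cl_span]
  obtain ⟨j, hj | hj⟩ := Nat.even_or_odd' k
  · exact ⟨cl J, false, by rw [hc2, hj, pow_mul, hP2]; simp⟩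
  · exact ⟨cl J, true, by rw [hc2, hj, pow_succ, pow_mul, hP2]; simp⟩

theorem Wex {c : ClassGroup (𝓞 F)} (n : ℕ) (hc : c ^ 2 ^ n = 1) : ∃ v, W K3 σ3 c v := by
  obtain ⟨I, hI, rfl⟩ := cl_surj c
  have hI' := map_ne_bot' (oc σ3) H.q3.inv hI
  obtain ⟨α, β, hα, hβ, e⟩ := (cl_eq hI hI').mp (H.S3 hI n hc).symm
  have e2 := congrArg (Ideal.map (oc σ3)) e
  rw [Ideal.map_mul, Ideal.map_mul, map_map_inv _ H.q3.inv, map_span_singleton', map_span_singleton'] at e2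
  have e3 : (Ideal.span {β * oc σ3 β}) * (I * I.map (oc σ3)) = (Ideal.span {α * oc σ3 α}) * (I * I.map (oc σ3)) := by
    rw [← Ideal.span_singleton_mul_span_singleton, ← Ideal.span_singleton_mul_span_singleton]
    calc _ = (Ideal.span {β} * I.map (oc σ3)) * (Ideal.span {oc σ3 β} * I) := by ring
      _ = (Ideal.span {α} * I) * (Ideal.span {oc σ3 α} * I.map (oc σ3)) := by rw [e, e2]
      _ = _ := by ring
  have e4 := mul_right_cancel₀ (ideal_mul_ne hI hI') e3
  obtain ⟨u, hu⟩ := Ideal.span_singleton_eq_span_singleton.mp e4.symm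
  have hα2 : α * oc σ3 α ≠ 0 := mul_ne_zero hα (by simpa using hα)
  have fixu : ∀ u : (𝓞 F)ˣ, oc σ3 u = u → oc σ3 (u⁻¹ : (𝓞 F)ˣ) = (u⁻¹ : (𝓞 F)ˣ) := by
    intro u h
    have : oc σ3 (u : 𝓞 F) * oc σ3 (u⁻¹ : (𝓞 F)ˣ) = 1 := by rw [← map_mul, Units.mul_inv, map_one]
    rw [h] at this
    calc _ = (u⁻¹ : (𝓞 F)ˣ) * ((u : 𝓞 F) * oc σ3 (u⁻¹ : (𝓞 F)ˣ)) := by rw [Units.inv_mul_cancel_left]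
      _ = _ := by rw [this, mul_one]
  have hfu : oc σ3 u = u := by
    have := congrArg (oc σ3) hu
    simp only [map_mul, H.q3.inv] at this
    apply mul_left_cancel₀ hα2
    linear_combination this - hu
  obtain ⟨a, ha⟩ := H.q3.fix _ hfu
  obtain ⟨b, hb⟩ := H.q3.fix _ (fixu u hfu)
  have inj := FaithfulSMul.algebraMap_injective (𝓞 K3) (𝓞 F)
  have hab : a * b = 1 := inj (by rw [map_mul, ha, hb, Units.mul_inv, map_one])
  refine ⟨⟨a, b, hab, by rw [mul_comm, hab]⟩, I, hI, rfl, α, β, hα, hβ, e, ?_⟩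
  change _ = algebraMap (𝓞 K3) (𝓞 F) a * _
  rw [ha, ← hu, mul_comm]

theorem dich {P : Ideal (𝓞 F)} (hP : IsP σ3 τ P) {c d : ClassGroup (𝓞 F)} (n : ℕ) (hc : c ^ 2 ^ n = 1) 
    (hd : d ^ 2 ^ n = 1) : A0 K3 P c ∨ A0 K3 P d ∨ A0 K3 P (c * d) := by
  obtain ⟨v, hv⟩ := H.Wex n hc
  obtain ⟨v', hv'⟩ := H.Wex n hd
  rcases H.Wred hv with h | h
  · exact Or.inl (H.Wone hP h)
  rcases H.Wred hv' with h' | h'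
  · exact Or.inr (Or.inl (H.Wone hP h'))
  · right; right
    have := H.Wsq (h.mul h') (H.k3.pu E3)⁻¹
    rw [← sq, ← mul_pow, inv_mul_cancel, one_pow] at this
    exact H.Wone hP this
end basic
end BQ

set_option linter.unusedVariables false
set_option linter.unusedSectionVars false
open NumberField

theorem Hyp.aux_nonnorm {q r s p : ℕ} (h : Hyp q r s) (h1 : jacobiSym p q = sg true) (h2 : jacobiSym p r = sg true)
   (h3 : jacobiSym p s = sg false) (g a b : Bool) (hD : IsNm (2 * (q * r * s)) (sg g * (2 ^ a.toNat * p ^ b.toNat : ℤ))) :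
   a = false ∧ b = false := by
  cases b
  · have := IsNm.even_case1 h (g := g) (a := a) (b := false) (c := false) (e := false) 
      (by simpa [tv] using hD)
    simp [this.2]
  · have := IsNm.even_case h (p : ℤ) true true false h1 h2 h3 (g := g) (a := a) (b := false) (c := false) (e := false) 
      (by simp only [tv, Bool.toNat_false, pow_zero, mul_one]; convert hD using 1; simp only [Bool.toNat_true, pow_one]; ring)
    exact absurd (this.2.1.trans this.2.2.symm) (by decide)

namespace BQ
variable {q r s : ℕ} {F K1 K2 K3 : Type*} [Field F] [Field K1] [Field K2] [Field K3]
    [NumberField F] [NumberField K1] [NumberField K2] [NumberField K3]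
    [Algebra K1 F] [Algebra K2 F] [Algebra K3 F]
    {s1 : K1 ≃+* K1} {s2 : K2 ≃+* K2} {s3 : K3 ≃+* K3} {w1 : 𝓞 K1} {w2 : 𝓞 K2} {w3 : 𝓞 K3}
    {σ1 σ2 σ3 : F ≃+* F} {τ t : 𝓞 F} 
    {E2 : Pell.Solution₁ (q * r * s : ℤ)} {E3 : Pell.Solution₁ (2 * (q * r * s) : ℤ)} 

section basic
variable (H : BQ q r s F K1 K2 K3 s1 s2 s3 w1 w2 w3 σ1 σ2 σ3 τ t E2 E3)
include H

theorem aux_ideal {p : ℕ} (hp : p.Prime) (hp8 : p % 8 = 1) (hp2 : IsSquare (2 : ZMod p)) 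
    (hpm : IsSquare ((q * r * s : ℕ) : ZMod p)) : ∃ I : Ideal (𝓞 F), I ≠ ⊥ ∧ Ideal.absNorm I = p := by
  have hnt : Ideal.span {(p : 𝓞 F)} ≠ ⊤ := by
    intro h
    have h1 := congrArg Ideal.absNorm h
    rw [Ideal.absNorm_top, Ideal.absNorm_eq_one_iff, Ideal.span_singleton_eq_top] at h1
    have h2 : IsUnit (algebraMap ℤ (𝓞 F) p) := by simpa using h1
    have : IsLocalHom (algebraMap ℤ (𝓞 F)) := 
      RingHom.IsIntegral.isLocalHom (Algebra.IsIntegral.isIntegral) (FaithfulSMul.algebraMap_injective ℤ (𝓞 F))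
    have h3 := isUnit_of_map_unit (algebraMap ℤ (𝓞 F)) _ h2
    rw [Int.ofNat_isUnit, Nat.isUnit_iff] at h3
    exact hp.one_lt.ne' h3
  obtain ⟨I, hI, hle⟩ := Ideal.exists_le_maximal _ hnt
  have hpI : (p : 𝓞 F) ∈ I := hle (Ideal.mem_span_singleton_self _)
  have hne : I ≠ ⊥ := by
    rintro rfl
    exact hp.ne_zero (by exact_mod_cast (Ideal.mem_bot.mp hpI))
  refine ⟨I, hne, ?_⟩
  have := Fact.mk hp
  have hchar : CharP (𝓞 F ⧸ I) p := (CharP.charP_iff_prime_eq_zero hp).mpr (by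
    have := Ideal.Quotient.eq_zero_iff_mem.mpr hpI
    simpa using this)
  let φ : ZMod p →+* (𝓞 F ⧸ I) := ZMod.castHom (dvd_refl p) _
  have hsq : ∀ (x : 𝓞 F) (n : ℕ), x ^ 2 = n → IsSquare (n : ZMod p) → Ideal.Quotient.mk I x ∈ φ.range := by
    intro x n hx hn
    obtain ⟨a, ha⟩ := hn
    have h1 : (Ideal.Quotient.mk I x) ^ 2 = φ a ^ 2 := by
      rw [← map_pow, hx, ← map_pow, sq a, ← ha, map_natCast, map_natCast]
    rcases sq_eq_sq_iff_eq_or_eq_neg.mp h1 with h | h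
    · exact ⟨a, h.symm⟩
    · exact ⟨-a, by rw [map_neg]; exact h.symm⟩
  have hτ := hsq τ 2 (by rw [H.τsq]; simp) (by exact_mod_cast hp2)
  have ht := hsq t (q * r * s) H.tsq hpm
  have h0 : ((2 * (q * r * s) : ℕ) : ZMod p) ≠ 0 := by
    rw [Ne, ZMod.natCast_eq_zero_iff]
    intro hd
    have e1 := H.hyp.hq8
    have e2 := H.hyp.hr8
    have e3 := H.hyp.hs8
    rw [hp.dvd_mul, hp.dvd_mul, hp.dvd_mul, Nat.prime_dvd_prime_iff_eq hp Nat.prime_two, 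
      Nat.prime_dvd_prime_iff_eq hp H.hyp.hq, Nat.prime_dvd_prime_iff_eq hp H.hyp.hr, 
      Nat.prime_dvd_prime_iff_eq hp H.hyp.hs] at hd
    omega
  have hsurj : Function.Surjective φ := by
    intro y
    obtain ⟨x, rfl⟩ := Ideal.Quotient.mk_surjective y
    obtain ⟨a, b, c, e, h⟩ := H.order x
    have hi : ∀ n : ℤ, (n : 𝓞 F ⧸ I) ∈ φ.range := fun n => ⟨n, by simp⟩
    have h1 := congrArg (Ideal.Quotient.mk I) h
    simp only [map_add, map_mul, map_intCast, map_natCast] at h1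
    have h2 : Ideal.Quotient.mk I x = φ (((2 * (q * r * s) : ℕ) : ZMod p)⁻¹) * (a + b * Ideal.Quotient.mk I τ
       + c * Ideal.Quotient.mk I t + e * (Ideal.Quotient.mk I τ * Ideal.Quotient.mk I t)) := by
      rw [← h1, ← mul_assoc, ← map_natCast φ, ← map_mul, inv_mul_cancel₀ h0, map_one, one_mul]
    have : Ideal.Quotient.mk I x ∈ φ.range := by
      rw [h2]
      exact mul_mem ⟨_, rfl⟩ (add_mem (add_mem (add_mem (hi a) (mul_mem (hi b) hτ)) (mul_mem (hi c) ht)) 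
        (mul_mem (hi e) (mul_mem hτ ht)))
    exact this
  have hc := Nat.card_eq_of_bijective φ ⟨φ.injective, hsurj⟩
  rw [Nat.card_zmod] at hc
  rw [Ideal.absNorm_apply, Submodule.cardQuot_apply]
  exact hc.symm
end basic
end BQ

set_option linter.unusedVariables false
set_option linter.unusedSectionVars false
open NumberField

theorem mem_sylow {G : Type*} [CommGroup G] [Finite G] (A : Sylow 2 G) (x : G) (n : ℕ) (hx : x ^ 2 ^ n = 1) : x ∈ A := by
  have : Fact (Nat.Prime 2) := ⟨Nat.prime_two⟩
  have h1 : IsPGroup 2 (Subgroup.zpowers x) := by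
    intro y
    obtain ⟨y, k, rfl⟩ := y
    refine ⟨n, Subtype.ext ?_⟩
    change (x ^ k) ^ 2 ^ n = 1
    rw [← zpow_natCast, zpow_comm, zpow_natCast, hx, one_zpow]
  obtain ⟨Q, hQ⟩ := h1.exists_le_sylow
  have := Sylow.unique_of_normal A inferInstance
  rw [Subsingleton.elim A Q]
  exact hQ (Subgroup.mem_zpowers x)

theorem of_sylow {G : Type*} [CommGroup G] [Finite G] (A : Sylow 2 G) {x : G} (hx : x ∈ A) : ∃ n : ℕ, x ^ 2 ^ n = 1 := by
  obtain ⟨n, hn⟩ := A.isPGroup' ⟨x, hx⟩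
  exact ⟨n, congrArg Subtype.val hn⟩

theorem group_lemma {G B : Type*} [CommGroup G] [CommGroup B] [Finite G] [Finite B] (N : G →* B) (j : B →* G)
    (hNj : ∀ x, N (j x) = x ^ 2) (hinj : ∀ c n, c ^ 2 ^ n = 1 → N c = 1 → c = 1)
    (f : Bool × Bool → B) (hf : ∀ x, x ^ 2 = 1 → ∃ i, f i = x) (c1 c2 : G) (n1 n2 : ℕ) (hc1 : c1 ^ 2 ^ n1 = 1)
    (hc2 : c2 ^ 2 ^ n2 = 1) 
    (NS : ∀ (a b : Bool) (y : B), N c1 ^ a.toNat * N c2 ^ b.toNat = y ^ 2 → a = false ∧ b = false) :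
    2 ^ (Nat.card G).factorization 2 = 2 ^ (Nat.card B).factorization 2 := by
  have : Fact (Nat.Prime 2) := ⟨Nat.prime_two⟩
  obtain ⟨A⟩ : Nonempty (Sylow 2 G) := inferInstance
  obtain ⟨C⟩ : Nonempty (Sylow 2 B) := inferInstance
  rw [← A.card_eq_multiplicity, ← C.card_eq_multiplicity]
  apply le_antisymm
  · have hm : ∀ x : A, N x ∈ C := by
      rintro ⟨x, hx⟩
      obtain ⟨n, hn⟩ := of_sylow A hx
      exact mem_sylow C _ n (by rw [← map_pow, hn, map_one])
    apply Nat.card_le_card_of_injective (fun x : A => (⟨N x, hm x⟩ : C))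
    rintro ⟨x, hx⟩ ⟨y, hy⟩ h
    have h' : N x = N y := congrArg Subtype.val h
    obtain ⟨n, hn⟩ := of_sylow A (div_mem hx hy)
    have := hinj _ n hn (by rw [map_div, h', div_self'])
    exact Subtype.ext (div_eq_one.mp this)
  · -- the squares
    let S : Subgroup B := (C : Subgroup B).map (powMonoidHom 2)
    have hC : Nat.card C ≤ Nat.card S * 4 := by
      have h1 := Subgroup.card_mul_index ((powMonoidHom 2 : C →* C).ker)
      have h2 : Nat.card ((powMonoidHom 2 : C →* C).ker) ≤ 4 := by
        have : Nat.card (Bool × Bool) = 4 := by simp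
        rw [← this]
        choose g hg using fun x : ((powMonoidHom 2 : C →* C).ker) => hf (x.1 : B) (by
          have := x.2
          rw [MonoidHom.mem_ker] at this
          exact congrArg Subtype.val this)
        apply Nat.card_le_card_of_injective g
        intro x y h
        apply Subtype.ext; apply Subtype.ext
        rw [← hg x, ← hg y, h]
      have h3 : Nat.card ((powMonoidHom 2 : C →* C).range) ≤ Nat.card S := by
        apply Nat.card_le_card_of_injective (fun x : (powMonoidHom 2 : C →* C).range => (⟨x.1.1, by
          obtain ⟨z, hz⟩ := x.2
          refine ⟨z.1, z.2, ?_⟩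
          exact congrArg Subtype.val hz⟩ : S))
        intro x y h
        apply Subtype.ext; apply Subtype.ext
        exact congrArg (fun z : S => (z : B)) h
      rw [Subgroup.index_ker] at h1
      change _ = Nat.card C at h1
      rw [← h1, mul_comm]
      exact Nat.mul_le_mul h3 h2
    refine hC.trans ?_
    have h4 : Nat.card S * 4 = Nat.card (S × Bool × Bool) := by
      simp
    rw [h4]
    have hs : ∀ x : S, ∃ y : A, ∃ z : B, (x : B) = z ^ 2 ∧ N y = x := by
      rintro ⟨x, z, hz, rfl⟩
      obtain ⟨n, hn⟩ := of_sylow C hz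
      exact ⟨⟨j z, mem_sylow A _ n (by rw [← map_pow, hn, map_one])⟩, z, rfl, hNj z⟩
    choose g z hz hg using hs
    have m1 := mem_sylow A c1 n1 hc1
    have m2 := mem_sylow A c2 n2 hc2
    apply Nat.card_le_card_of_injective (fun x : S × Bool × Bool => 
      g x.1 * (⟨c1, m1⟩ : A) ^ x.2.1.toNat * (⟨c2, m2⟩ : A) ^ x.2.2.toNat)
    rintro ⟨x, a, b⟩ ⟨x', a', b'⟩ h
    have h5 := congrArg (N.comp (A : Subgroup G).subtype) h
    simp only [map_mul, map_pow] at h5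
    change N (g x) * N c1 ^ a.toNat * N c2 ^ b.toNat = N (g x') * N c1 ^ a'.toNat * N c2 ^ b'.toNat at h5
    have xor : ∀ (p : B) (a a' : Bool), p ^ (a ^^ a').toNat = p ^ a.toNat * p ^ a'.toNat * ((p ^ (a && a').toNat)⁻¹) ^ 2 := by
      intro p a a'
      cases a <;> cases a' <;> simp [sq]
    have h6 := NS (a ^^ a') (b ^^ b') ((z x)⁻¹ * z x' * N c1 ^ a'.toNat * N c2 ^ b'.toNat * (N c1 ^ (a && a').toNat)⁻¹ *
       (N c2 ^ (b && b').toNat)⁻¹) (by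
      rw [xor, xor]
      rw [hg, hg, hz, hz] at h5
      have h7 : N c1 ^ a.toNat * N c2 ^ b.toNat = ((z x)⁻¹) ^ 2 * (z x' ^ 2 * N c1 ^ a'.toNat * N c2 ^ b'.toNat) := by
        rw [← h5]
        rw [inv_pow, mul_assoc, inv_mul_cancel_left]
      calc _ = (N c1 ^ a.toNat * N c2 ^ b.toNat) * (N c1 ^ a'.toNat * N c2 ^ b'.toNat) * 
            (((N c1 ^ (a && a').toNat)⁻¹) ^ 2 * ((N c2 ^ (b && b').toNat)⁻¹) ^ 2) := by 
              simp only [mul_comm, mul_left_comm, mul_assoc]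
        _ = _ := by
          rw [h7]
          simp only [mul_pow, sq]
          simp only [mul_comm, mul_left_comm, mul_assoc])
    have ea : a = a' := by have := h6.1; revert this; cases a <;> cases a' <;> simp
    have eb : b = b' := by have := h6.2; revert this; cases b <;> cases b' <;> simp
    subst ea eb
    have h8 := mul_right_cancel (mul_right_cancel h5)
    rw [hg, hg] at h8
    rw [Subtype.ext h8]

namespace BQ
variable {q r s : ℕ} {F K1 K2 K3 : Type*} [Field F] [Field K1] [Field K2] [Field K3]
    [NumberField F] [NumberField K1] [NumberField K2] [NumberField K3]
    [Algebra K1 F] [Algebra K2 F] [Algebra K3 F]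
    {s1 : K1 ≃+* K1} {s2 : K2 ≃+* K2} {s3 : K3 ≃+* K3} {w1 : 𝓞 K1} {w2 : 𝓞 K2} {w3 : 𝓞 K3}
    {σ1 σ2 σ3 : F ≃+* F} {τ t : 𝓞 F} 
    {E2 : Pell.Solution₁ (q * r * s : ℤ)} {E3 : Pell.Solution₁ (2 * (q * r * s) : ℤ)} 

section basic
variable (H : BQ q r s F K1 K2 K3 s1 s2 s3 w1 w2 w3 σ1 σ2 σ3 τ t E2 E3)
include H

theorem aux_class {P : Ideal (𝓞 F)} (hP : IsP σ3 τ P) : ∃ (c2 : ClassGroup (𝓞 F)) (n : ℕ), c2 ^ 2 ^ n = 1 ∧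
    ∀ (a b : Bool) (y : ClassGroup (𝓞 K3)), Nh K3 F (cl P) ^ a.toNat * Nh K3 F c2 ^ b.toNat = y ^ 2 → 
     a = false ∧ b = false := by
  obtain ⟨p, hp, hp8, j1, j2, j3, hp2, hpm⟩ := H.hyp.aux_prime
  obtain ⟨I, hI, hN⟩ := H.aux_ideal hp hp8 hp2 hpm
  set h := Nat.card (ClassGroup (𝓞 F)) with hh
  have h0 : h ≠ 0 := Nat.card_pos.ne'
  obtain ⟨m, hm⟩ : Odd (h / 2 ^ h.factorization 2) := by
    rw [← Nat.not_even_iff_odd, even_iff_two_dvd]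
    exact Nat.not_dvd_ordCompl Nat.prime_two h0
  refine ⟨cl I ^ (2 * m + 1), h.factorization 2, ?_, ?_⟩
  · rw [← pow_mul, ← hm, mul_comm, Nat.ordProj_mul_ordCompl_eq_self, hh, pow_card_eq_one']
  · intro a b y e
    rw [← map_pow, ← map_pow, ← map_mul, ← pow_mul, ← cl_pow hP.ne, ← cl_pow hI, 
      ← cl_mul (pow_ne_zero _ hP.ne) (pow_ne_zero _ hI), 
      Nh_cl (ideal_mul_ne (pow_ne_zero _ hP.ne) (pow_ne_zero _ hI))] at e
    obtain ⟨g, hg⟩ := H.k3.genus_sq ((idMap_relNorm (R := 𝓞 K3) (S := 𝓞 F)).ne _ 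
      (ideal_mul_ne (pow_ne_zero _ hP.ne) (pow_ne_zero _ hI))) e
    rw [Ideal.absNorm_relNorm, map_mul, map_pow, map_pow, hN, hP.norm] at hg
    apply H.hyp.aux_nonnorm j1 j2 j3 g a b
    have hz : ((p : ℤ) ^ (m * b.toNat)) ≠ 0 := pow_ne_zero _ (by exact_mod_cast hp.ne_zero)
    apply IsNm.red hz
    convert hg using 1
    push_cast
    ring

theorem A0_norm {P : Ideal (𝓞 F)} {c : ClassGroup (𝓞 F)} (h : A0 K3 P c) : 
    ∃ (x : ClassGroup (𝓞 K3)) (k : Bool), c = jh K3 F x * cl P ^ k.toNat ∧ 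
      Nh K3 F c = x ^ 2 * Nh K3 F (cl P) ^ k.toNat := by
  obtain ⟨x, k, e⟩ := h
  exact ⟨x, k, e, by rw [e, map_mul, map_pow, H.q3.Nj]⟩

theorem h2eq : 2 ^ (Nat.card (ClassGroup (𝓞 F))).factorization 2 = 2 ^ (Nat.card (ClassGroup (𝓞 K3))).factorization 2 := by
  obtain ⟨P, hP⟩ := H.exP
  obtain ⟨c2, n2, hc2, NS⟩ := H.aux_class hP
  have hcl : ∀ x : ClassGroup (𝓞 K3), x ^ 2 = 1 → ∃ ab : Bool × Bool, QF.Rr x (2 ^ ab.1.toNat * q ^ ab.2.toNat) := by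
    intro x hx
    obtain ⟨a, b, h⟩ := QF.cl3 H.hyp H.k3 E3 H.h3 H.hns hx
    exact ⟨(a, b), h⟩
  have hf : ∃ f : Bool × Bool → ClassGroup (𝓞 K3), ∀ x, x ^ 2 = 1 → ∃ i, f i = x := by
    classical
    refine ⟨fun i => if h : ∃ x : ClassGroup (𝓞 K3), QF.Rr x (2 ^ i.1.toNat * q ^ i.2.toNat) then h.choose else 1, ?_⟩
    intro x hx
    obtain ⟨i, hi⟩ := hcl x hx
    have hex : ∃ x : ClassGroup (𝓞 K3), QF.Rr x (2 ^ i.1.toNat * q ^ i.2.toNat) := ⟨x, hi⟩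
    refine ⟨i, ?_⟩
    simp only [dif_pos hex]
    exact hex.choose_spec.uniq hi
  obtain ⟨f, hf⟩ := hf
  refine group_lemma (Nh K3 F) (jh K3 F) H.q3.Nj ?_ f hf (cl P) c2 1 n2 ?_ hc2 NS
  · intro c n hc hN
    have bad : ∀ d, A0 K3 P d → Nh K3 F d = Nh K3 F c2 → False := by
      intro d hd e
      obtain ⟨x, k, -, h⟩ := H.A0_norm hd
      have := NS k true (x * Nh K3 F (cl P) ^ k.toNat) (by
        rw [← e, h, Bool.toNat_true, pow_one, mul_pow]
        simp only [sq]
        simp only [mul_comm, mul_left_comm, mul_assoc])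
      simp at this
    have e1 : c ^ 2 ^ (n + n2) = 1 := by rw [pow_add, pow_mul, hc, one_pow]
    have e2 : c2 ^ 2 ^ (n + n2) = 1 := by rw [add_comm, pow_add, pow_mul, hc2, one_pow]
    rcases H.dich hP (n + n2) e1 e2 with h | h | h
    · obtain ⟨x, k, hx, h'⟩ := H.A0_norm h
      rw [hN] at h'
      have := NS k false x⁻¹ (by
        rw [Bool.toNat_false, pow_zero, mul_one, inv_pow]
        exact (eq_inv_of_mul_eq_one_right h'.symm))
      rw [this.1, Bool.toNat_false, pow_zero, mul_one] at h' hx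
      rw [hx, H.cap3 h'.symm]
    · exact (bad _ h rfl).elim
    · exact (bad _ h (by rw [map_mul, hN, one_mul])).elim
  · rw [pow_one, ← cl_pow hP.ne, hP.sq, cl_span]
end basic
end BQ

set_option linter.unusedVariables false
set_option linter.unusedSectionVars false
open NumberField

theorem BQ.main {q r s : ℕ} (hyp : Hyp q r s) {F K1 K2 K3 : Type*} [Field F] [Field K1] [Field K2] [Field K3]
    [NumberField F] [NumberField K1] [NumberField K2] [NumberField K3]
    [Algebra K1 F] [Algebra K2 F] [Algebra K3 F]
    {E2 : Pell.Solution₁ (q * r * s : ℤ)} {E3 : Pell.Solution₁ (2 * (q * r * s) : ℤ)} 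
    (h2 : Pell.IsFundamental E2) (h3 : Pell.IsFundamental E3) (hns : ¬ IsSquare (2 * q * (E3.x - 1)))
    (x1 : K1) (x2 : K2) (x3 : K3) (τ t : F)
    (hx1 : x1 ^ 2 = (2 : ℕ)) (hx2 : x2 ^ 2 = (q * r * s : ℕ)) (hx3 : x3 ^ 2 = (2 * (q * r * s) : ℕ)) 
    (m1 : algebraMap K1 F x1 = τ) (m2 : algebraMap K2 F x2 = t) (m3 : algebraMap K3 F x3 = τ * t)
    (n1 : ∀ a : ℚ, x1 ≠ a) (n2 : ∀ a : ℚ, x2 ≠ a) (n3 : ∀ a : ℚ, x3 ≠ a)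
    (N1 : ∀ a, t ≠ algebraMap K1 F a) (N2 : ∀ a, τ ≠ algebraMap K2 F a) (N3 : ∀ a, τ ≠ algebraMap K3 F a)
    (p1 : ∀ x : K1, ∃ a b : ℚ, x = a + b * x1) (p2 : ∀ x : K2, ∃ a b : ℚ, x = a + b * x2)
    (p3 : ∀ x : K3, ∃ a b : ℚ, x = a + b * x3)
    (P1 : ∀ x : F, ∃ a b, x = algebraMap K1 F a + algebraMap K1 F b * t)
    (P2 : ∀ x : F, ∃ a b, x = algebraMap K2 F a + algebraMap K2 F b * τ)
    (P3 : ∀ x : F, ∃ a b, x = algebraMap K3 F a + algebraMap K3 F b * τ) (ι : F →+* ℝ) :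
    (∀ u : (𝓞 F)ˣ, ∃ (v1 : (𝓞 K1)ˣ) (v2 : (𝓞 K2)ˣ) (v3 : (𝓞 K3)ˣ), u = inc K1 F v1 * inc K2 F v2 * inc K3 F v3) ∧
    2 ^ (Nat.card (ClassGroup (𝓞 F))).factorization 2 = 2 ^ (Nat.card (ClassGroup (𝓞 K3))).factorization 2 := by
  have i1 : IsIntegral ℤ x1 := IsIntegral.of_pow two_pos (hx1 ▸ isIntegral_natCast _)
  have i2 : IsIntegral ℤ x2 := IsIntegral.of_pow two_pos (hx2 ▸ isIntegral_natCast _)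
  have i3 : IsIntegral ℤ x3 := IsIntegral.of_pow two_pos (hx3 ▸ isIntegral_natCast _)
  have hτ : τ ^ 2 = (2 : ℕ) := by rw [← m1, ← map_pow, hx1, map_natCast]
  have ht : t ^ 2 = (q * r * s : ℕ) := by rw [← m2, ← map_pow, hx2, map_natCast]
  have iτ : IsIntegral ℤ τ := IsIntegral.of_pow two_pos (hτ ▸ isIntegral_natCast _)
  have it : IsIntegral ℤ t := IsIntegral.of_pow two_pos (ht ▸ isIntegral_natCast _)
  obtain ⟨s1, f1⟩ := Quad.exists_of (K := ℚ) (L := K1) (τ := x1) (t := ((2 : ℤ) : ℚ)) (by rw [hx1]; simp) (by simpa using n1) 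
    (by simpa using p1)
  obtain ⟨s2, f2⟩ := Quad.exists_of (K := ℚ) (L := K2) (τ := x2) (t := ((q * r * s : ℤ) : ℚ)) (by rw [hx2]; simp) (by simpa using n2) 
    (by simpa using p2)
  obtain ⟨s3, f3⟩ := Quad.exists_of (K := ℚ) (L := K3) (τ := x3) (t := ((2 * (q * r * s) : ℤ) : ℚ)) (by rw [hx3]; simp) (by simpa using n3) 
    (by simpa using p3)
  obtain ⟨σ1, g1⟩ := Quad.exists_of (K := K1) (L := F) (τ := t) (t := ((q * r * s : ℕ) : K1)) (by rw [ht, map_natCast]) N1 P1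
  obtain ⟨σ2, g2⟩ := Quad.exists_of (K := K2) (L := F) (τ := τ) (t := 2) (by rw [hτ, map_ofNat, Nat.cast_ofNat]) N2 P2
  obtain ⟨σ3, g3⟩ := Quad.exists_of (K := K3) (L := F) (τ := τ) (t := 2) (by rw [hτ, map_ofNat, Nat.cast_ofNat]) N3 P3
  have mod8 : q * r * s % 8 = 7 := by
    rw [Nat.mul_mod, Nat.mul_mod q r, hyp.hq8, hyp.hr8, hyp.hs8]
  have sq1 : Squarefree (2 * (q * r * s) : ℤ) := by
    have := Int.squarefree_natCast.mpr hyp.sqf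
    push_cast at this; exact this
  have H : BQ q r s F K1 K2 K3 s1 s2 s3 ⟨x1, i1⟩ ⟨x2, i2⟩ ⟨x3, i3⟩ σ1 σ2 σ3 ⟨τ, iτ⟩ ⟨t, it⟩ E2 E3 := 
   { hyp := hyp
     k1 := ⟨f1, Int.prime_two.squarefree, by norm_num⟩
     k2 := ⟨f2, sq1.squarefree_of_dvd (Dvd.intro_left _ rfl), by right; exact_mod_cast (by omega : q * r * s % 4 = 3)⟩
     k3 := ⟨f3, sq1, by left; exact_mod_cast (by omega : 2 * (q * r * s) % 4 = 2)⟩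
     e1 := g1, e2 := g2, e3 := g3
     m1 := RingOfIntegers.ext m1
     m2 := RingOfIntegers.ext m2
     m3 := RingOfIntegers.ext m3
     h2 := h2, h3 := h3, hns := hns }
  exact ⟨H.units_gen ι, H.h2eq⟩

theorem gen_span (K : IntermediateField ℚ ℝ) (y : ℝ) (hy : y ^ 2 ∈ K) (S : Set ℝ) 
    (hS : ∀ x ∈ S, ∃ a ∈ K, ∃ b ∈ K, x = a + b * y) {x : ℝ} (hx : x ∈ IntermediateField.adjoin ℚ S) :
    ∃ a ∈ K, ∃ b ∈ K, x = a + b * y := by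
  induction hx using IntermediateField.adjoin_induction with
  | mem x hx => exact hS x hx
  | algebraMap x => exact ⟨_, K.algebraMap_mem x, 0, zero_mem _, by simp⟩
  | add x x' _ _ h h' => 
    obtain ⟨a, ha, b, hb, rfl⟩ := h
    obtain ⟨a', ha', b', hb', rfl⟩ := h'
    exact ⟨a + a', add_mem ha ha', b + b', add_mem hb hb', by ring⟩
  | mul x x' _ _ h h' => 
    obtain ⟨a, ha, b, hb, rfl⟩ := h
    obtain ⟨a', ha', b', hb', rfl⟩ := h'
    exact ⟨a * a' + b * b' * y ^ 2, add_mem (mul_mem ha ha') (mul_mem (mul_mem hb hb') hy), a * b' + b * a', 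
      add_mem (mul_mem ha hb') (mul_mem hb ha'), by ring⟩
  | inv x _ h => 
    obtain ⟨a, ha, b, hb, rfl⟩ := h
    by_cases h1 : a + b * y = 0
    · exact ⟨0, zero_mem _, 0, zero_mem _, by rw [h1]; simp⟩
    by_cases h2 : a - b * y = 0
    · refine ⟨(a + a)⁻¹, inv_mem (add_mem ha ha), 0, zero_mem _, ?_⟩
      have : b * y = a := by linarith
      rw [this]; simp
    · have h3 : a ^ 2 - b ^ 2 * y ^ 2 ≠ 0 := by
        have := mul_ne_zero h1 h2
        convert this using 1; ring
      have h4 : a ^ 2 - b ^ 2 * y ^ 2 ∈ K := sub_mem (pow_mem ha 2) (mul_mem (pow_mem hb 2) hy)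
      refine ⟨a * (a ^ 2 - b ^ 2 * y ^ 2)⁻¹, mul_mem ha (inv_mem h4), -b * (a ^ 2 - b ^ 2 * y ^ 2)⁻¹, 
        mul_mem (neg_mem hb) (inv_mem h4), ?_⟩
      field_simp
      ring

theorem rat_span (y : ℝ) (n : ℕ) (hy : y ^ 2 = n) {x : ℝ} (hx : x ∈ IntermediateField.adjoin ℚ {y}) :
    ∃ a b : ℚ, x = a + b * y := by
  obtain ⟨a, ha, b, hb, e⟩ := gen_span ⊥ y (by rw [hy]; exact natCast_mem _ _) {y} (by
    rintro x rfl; exact ⟨0, zero_mem _, 1, one_mem _, by simp⟩) hx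
  obtain ⟨a, rfl⟩ := IntermediateField.mem_bot.mp ha
  obtain ⟨b, rfl⟩ := IntermediateField.mem_bot.mp hb
  exact ⟨a, b, by simpa using e⟩

theorem not_mem_quad (y z : ℝ) (m n : ℕ) (hy : y ^ 2 = m) (hz : z ^ 2 = n) (iz : Irrational z) (iy : Irrational y) 
    (iyz : Irrational (y * z)) : y ∉ IntermediateField.adjoin ℚ {z} := by
  intro h
  obtain ⟨a, b, e⟩ := rat_span z n hz h
  have h1 : ((2 * a * b : ℚ) : ℝ) * z = ((m - a ^ 2 - b ^ 2 * n : ℚ) : ℝ) := by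
    push_cast; rw [← hy, ← hz]; rw [e]; ring
  by_cases h2 : (2 * a * b : ℚ) = 0
  · have : a = 0 ∨ b = 0 := by simpa using h2
    rcases this with rfl | rfl
    · apply iyz
      refine ⟨b * n, ?_⟩
      push_cast; rw [← hz, e]; push_cast; ring
    · apply iy
      exact ⟨a, by rw [e]; simp⟩
  · apply iz
    refine ⟨(m - a ^ 2 - b ^ 2 * n) / (2 * a * b), ?_⟩
    rw [Rat.cast_div, ← h1]
    have : ((2 * a * b : ℚ) : ℝ) ≠ 0 := by exact_mod_cast h2
    field_simp

theorem nf_adjoin (S : Set ℝ) [Finite S] (h : ∀ x ∈ S, ∃ n : ℕ, x ^ 2 = n) : 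
    NumberField (IntermediateField.adjoin ℚ S) where
  to_charZero := inferInstance
  to_finiteDimensional := by
    apply IntermediateField.finiteDimensional_adjoin
    intro x hx
    obtain ⟨n, hn⟩ := h x hx
    exact IsIntegral.of_pow two_pos (hn ▸ isIntegral_natCast n)

theorem irr_sqrt (n : ℕ) (h : Squarefree n) (h1 : n ≠ 1) : Irrational (Real.sqrt n) := by
  rw [irrational_sqrt_natCast_iff]
  rintro ⟨k, rfl⟩
  have := h k (dvd_refl _)
  rw [Nat.isUnit_iff] at this
  subst this
  exact h1 rfl


theorem inc_coe_val (K F : IntermediateField ℚ ℝ) [NumberField K] [NumberField F] [Algebra K F]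
    (c : ∀ x : K, ((algebraMap K F x : F) : ℝ) = x) (v : (𝓞 K)ˣ) :
    ((algebraMap (𝓞 F) F (BQ.inc K F v : 𝓞 F) : F) : ℝ) ∈ K := by
  have h : algebraMap (𝓞 F) F (BQ.inc K F v : 𝓞 F) = algebraMap K F (algebraMap (𝓞 K) K (v : 𝓞 K)) := rfl
  rw [h, c]
  exact Subtype.property _

theorem final_step {q r s : ℕ} (hyp : Hyp q r s) (F K1 K2 K3 : IntermediateField ℚ ℝ)
    [NumberField F] [NumberField K1] [NumberField K2] [NumberField K3]
    [Algebra K1 F] [Algebra K2 F] [Algebra K3 F]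
    (c1 : ∀ x : K1, ((algebraMap K1 F x : F) : ℝ) = x)
    (c2 : ∀ x : K2, ((algebraMap K2 F x : F) : ℝ) = x)
    (c3 : ∀ x : K3, ((algebraMap K3 F x : F) : ℝ) = x)
    {E2 : Pell.Solution₁ (q * r * s : ℤ)} {E3 : Pell.Solution₁ (2 * (q * r * s) : ℤ)}
    (h2 : Pell.IsFundamental E2) (h3 : Pell.IsFundamental E3) (hns : ¬ IsSquare (2 * q * (E3.x - 1)))
    (Y2 Ym Y2m : ℝ) (a1 : Y2 ∈ K1) (a2 : Ym ∈ K2) (a3 : Y2m ∈ K3)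
    (mY2 : Y2 ∈ F) (mYm : Ym ∈ F)
    (y2 : Y2 ^ 2 = (2 : ℕ)) (ym : Ym ^ 2 = (q * r * s : ℕ)) (y2m : Y2m ^ 2 = (2 * (q * r * s) : ℕ))
    (ymul : Y2m = Y2 * Ym)
    (ir2 : Irrational Y2) (irm : Irrational Ym) (ir2m : Irrational Y2m)
    (N1 : Ym ∉ K1) (N2 : Y2 ∉ K2) (N3 : Y2 ∉ K3)
    (r1 : ∀ x ∈ K1, ∃ a b : ℚ, x = a + b * Y2)
    (r2 : ∀ x ∈ K2, ∃ a b : ℚ, x = a + b * Ym)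
    (r3 : ∀ x ∈ K3, ∃ a b : ℚ, x = a + b * Y2m)
    (sp1 : ∀ x ∈ F, ∃ a ∈ K1, ∃ b ∈ K1, x = a + b * Ym)
    (sp2 : ∀ x ∈ F, ∃ a ∈ K2, ∃ b ∈ K2, x = a + b * Y2)
    (sp3 : ∀ x ∈ F, ∃ a ∈ K3, ∃ b ∈ K3, x = a + b * Y2) :
    (subfieldUnits F {K1, K2, K3}).index = 1 ∧ h2pow F = h2pow K3 := by
  have cast_rat : ∀ (K : IntermediateField ℚ ℝ) (a : ℚ), ((a : K) : ℝ) = a :=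
    fun K a => map_ratCast K.val a
  have cast_nat : ∀ (K : IntermediateField ℚ ℝ) (a : ℕ), ((a : K) : ℝ) = a :=
    fun K a => map_natCast K.val a
  have main := BQ.main hyp (F := F) (K1 := K1) (K2 := K2) (K3 := K3) h2 h3 hns
    ⟨Y2, a1⟩ ⟨Ym, a2⟩ ⟨Y2m, a3⟩ ⟨Y2, mY2⟩ ⟨Ym, mYm⟩
    (Subtype.ext (y2.trans (cast_nat _ _).symm)) (Subtype.ext (ym.trans (cast_nat _ _).symm))
    (Subtype.ext (y2m.trans (cast_nat _ _).symm))
    (Subtype.ext (c1 _)) (Subtype.ext (c2 _)) (Subtype.ext ((c3 _).trans ymul))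
    (fun a h => ir2 ⟨a, ((congrArg Subtype.val h).trans (cast_rat _ _)).symm⟩)
    (fun a h => irm ⟨a, ((congrArg Subtype.val h).trans (cast_rat _ _)).symm⟩)
    (fun a h => ir2m ⟨a, ((congrArg Subtype.val h).trans (cast_rat _ _)).symm⟩)
    (fun x h => N1 (by
      have : Ym = (x : ℝ) := (congrArg Subtype.val h).trans (c1 x)
      rw [this]; exact x.2))
    (fun x h => N2 (by
      have : Y2 = (x : ℝ) := (congrArg Subtype.val h).trans (c2 x)
      rw [this]; exact x.2))
    (fun x h => N3 (by
      have : Y2 = (x : ℝ) := (congrArg Subtype.val h).trans (c3 x)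
      rw [this]; exact x.2))
    (fun x => by
      obtain ⟨a, b, e⟩ := r1 _ x.2
      exact ⟨a, b, Subtype.ext (by rw [e]; push_cast; rfl)⟩)
    (fun x => by
      obtain ⟨a, b, e⟩ := r2 _ x.2
      exact ⟨a, b, Subtype.ext (by rw [e]; push_cast; rfl)⟩)
    (fun x => by
      obtain ⟨a, b, e⟩ := r3 _ x.2
      exact ⟨a, b, Subtype.ext (by rw [e]; push_cast; rfl)⟩)
    (fun x => by
      obtain ⟨a, ha, b, hb, e⟩ := sp1 _ x.2
      exact ⟨⟨a, ha⟩, ⟨b, hb⟩, Subtype.ext (by rw [e]; push_cast; rw [c1, c1])⟩)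
    (fun x => by
      obtain ⟨a, ha, b, hb, e⟩ := sp2 _ x.2
      exact ⟨⟨a, ha⟩, ⟨b, hb⟩, Subtype.ext (by rw [e]; push_cast; rw [c2, c2])⟩)
    (fun x => by
      obtain ⟨a, ha, b, hb, e⟩ := sp3 _ x.2
      exact ⟨⟨a, ha⟩, ⟨b, hb⟩, Subtype.ext (by rw [e]; push_cast; rw [c3, c3])⟩)
    F.val.toRingHom
  refine ⟨?_, by unfold h2pow; exact main.2⟩
  rw [Subgroup.index_eq_one, eq_top_iff]
  rintro u -
  obtain ⟨v1, v2, v3, rfl⟩ := main.1 u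
  unfold subfieldUnits
  refine mul_mem (mul_mem ?_ ?_) ?_
  · exact Subgroup.subset_closure ⟨K1, by simp, inc_coe_val K1 F c1 v1⟩
  · exact Subgroup.subset_closure ⟨K2, by simp, inc_coe_val K2 F c2 v2⟩
  · exact Subgroup.subset_closure ⟨K3, by simp, inc_coe_val K3 F c3 v3⟩

/-- Let q ≡ 7 (mod 8) and r ≡ s ≡ 3 (mod 8) be distinct primes with
(q/r) = (q/s) = -1 and (s/r) = 1, and write ε_{2qrs} = a + b√(2qrs) for the fundamental
unit of Q(√(2qrs)) (fundamental = least positive Pell solution). If 2q(a-1) is not a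
perfect square, then the unit index q(F₁) = [E_{F₁} : ⟨-1, ε₂, ε_{qrs}, ε_{2qrs}⟩] of the
field F₁ = Q(√(qrs), √2) equals 1, and h₂(F₁) = h₂(2qrs). -/
theorem stmt12 (q r s : ℕ) (hq : q.Prime) (hr : r.Prime) (hs : s.Prime)
    (hqr : q ≠ r) (hqs : q ≠ s) (hrs : r ≠ s)
    (hq8 : q % 8 = 7) (hr8 : r % 8 = 3) (hs8 : s % 8 = 3)
    (h1 : @legendreSym r ⟨hr⟩ (q : ℤ) = -1) (h2 : @legendreSym s ⟨hs⟩ (q : ℤ) = -1)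
    (h3 : @legendreSym r ⟨hr⟩ (s : ℤ) = 1)
    (a b : ℤ) (ha : 0 < a) (hb : 0 < b)
    (hPell : a ^ 2 - 1 = 2 * q * r * s * b ^ 2)
    (hfund : ∀ a' b' : ℤ, 0 < a' → 0 < b' → a' ^ 2 - 1 = 2 * q * r * s * b' ^ 2 → a ≤ a')
    (hnsq : ¬ IsSquare (2 * q * (a - 1))) :
    (subfieldUnits (Qadj {Real.sqrt (q * r * s), Real.sqrt 2})
        {Qadj {Real.sqrt 2}, Qadj {Real.sqrt (q * r * s)},
          Qadj {Real.sqrt (2 * (q * r * s))}}).index = 1 ∧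
    h2pow (Qadj {Real.sqrt (q * r * s), Real.sqrt 2}) =
      h2pow (Qadj {Real.sqrt (2 * (q * r * s))}) := by
  have hyp := Hyp.mk' q r s hq hr hs hq8 hr8 hs8 h1 h2 h3
  have sqf := hyp.sqf
  have h2q := hq.two_le
  have h2r := hr.two_le
  have h2s := hs.two_le
  have hm4 : 2 ≤ q * r * s := 
    h2q.trans (by rw [mul_assoc]; exact Nat.le_mul_of_pos_right _ (Nat.mul_pos (by omega) (by omega)))
  have sqm : Squarefree (q * r * s) := sqf.squarefree_of_dvd (Dvd.intro_left _ rfl)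
  have c2 : Real.sqrt 2 = Real.sqrt ((2 : ℕ) : ℝ) := by simp
  have cm : Real.sqrt (q * r * s) = Real.sqrt ((q * r * s : ℕ) : ℝ) := by push_cast; rfl
  have c2m : Real.sqrt (2 * (q * r * s)) = Real.sqrt ((2 * (q * r * s) : ℕ) : ℝ) := by push_cast; rfl
  have ir2 : Irrational (Real.sqrt 2) := by rw [c2]; exact irr_sqrt _ Nat.prime_two.squarefree (by norm_num)
  have irm : Irrational (Real.sqrt (q * r * s)) := by rw [cm]; exact irr_sqrt _ sqm (by omega)
  have ir2m : Irrational (Real.sqrt (2 * (q * r * s))) := by rw [c2m]; exact irr_sqrt _ sqf (by omega)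
  have y2 : Real.sqrt 2 ^ 2 = (2 : ℕ) := by rw [c2]; exact Real.sq_sqrt (Nat.cast_nonneg _)
  have ym : Real.sqrt (q * r * s) ^ 2 = (q * r * s : ℕ) := by rw [cm]; exact Real.sq_sqrt (Nat.cast_nonneg _)
  have y2m : Real.sqrt (2 * (q * r * s)) ^ 2 = (2 * (q * r * s) : ℕ) := by 
    rw [c2m]; exact Real.sq_sqrt (Nat.cast_nonneg _)
  have ymul : Real.sqrt (2 * (q * r * s)) = Real.sqrt 2 * Real.sqrt (q * r * s) := Real.sqrt_mul (by norm_num) _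
  set Y2 := Real.sqrt 2 with hY2
  set Ym := Real.sqrt (q * r * s) with hYm
  set Y2m := Real.sqrt (2 * (q * r * s)) with hY2m
  clear_value Y2 Ym Y2m
  clear c2 cm c2m
  -- Pell equations
  have hsq2 : ¬ IsSquare (q * r * s : ℤ) := by
    rintro ⟨k, hk⟩
    apply irm
    have e : Ym ^ 2 = (k : ℝ) ^ 2 := by
      rw [ym]; rw [← sq] at hk; exact_mod_cast hk
    rcases sq_eq_sq_iff_eq_or_eq_neg.mp e with h | h
    · exact ⟨k, by rw [h]; simp⟩
    · exact ⟨-k, by rw [h]; simp⟩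
  obtain ⟨E2, hE2⟩ := Pell.IsFundamental.exists_of_not_isSquare (d := (q * r * s : ℤ)) (by exact_mod_cast (by omega : 0 < q * r * s)) hsq2
  have hP' : a ^ 2 - (2 * (q * r * s)) * b ^ 2 = 1 := by linarith
  let E3 : Pell.Solution₁ (2 * (q * r * s) : ℤ) := Pell.Solution₁.mk a b hP'
  have hpos : (0 : ℤ) < 2 * (q * r * s) := by exact_mod_cast (by omega : 0 < 2 * (q * r * s))
  have hE3 : Pell.IsFundamental E3 := by
    refine ⟨?_, hb, ?_⟩
    · change 1 < a
      have : 0 < 2 * (q * r * s) * b ^ 2 := by positivity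
      by_contra hc
      have ha1 : a = 1 := by omega
      rw [ha1] at hP'
      linarith
    · intro x hx
      change a ≤ x.x
      have hy : x.y ≠ 0 := by
        intro h0
        have := x.prop
        rw [h0] at this
        nlinarith
      have h4 := x.prop
      exact hfund x.x |x.y| (by linarith) (abs_pos.mpr hy) (by rw [sq_abs]; linarith)
  -- fields
  have hK1 : Qadj {Y2} ≤ Qadj {Ym, Y2} := IntermediateField.adjoin.mono _ _ _ (by simp)
  have hK2 : Qadj {Ym} ≤ Qadj {Ym, Y2} := IntermediateField.adjoin.mono _ _ _ (by simp)
  have mY2 : Y2 ∈ Qadj {Ym, Y2} := IntermediateField.subset_adjoin _ _ (by simp)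
  have mYm : Ym ∈ Qadj {Ym, Y2} := IntermediateField.subset_adjoin _ _ (by simp)
  have hK3 : Qadj {Y2m} ≤ Qadj {Ym, Y2} := by
    refine IntermediateField.adjoin_le_iff.mpr ?_
    rintro x rfl
    rw [ymul]
    exact mul_mem mY2 mYm
  have a1 : Y2 ∈ Qadj {Y2} := IntermediateField.subset_adjoin _ _ (by simp)
  have a2 : Ym ∈ Qadj {Ym} := IntermediateField.subset_adjoin _ _ (by simp)
  have a3 : Y2m ∈ Qadj {Y2m} := IntermediateField.subset_adjoin _ _ (by simp)
  have iF : NumberField (Qadj {Ym, Y2}) := nf_adjoin _ (by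
    rintro x (rfl | rfl)
    · exact ⟨_, ym⟩
    · exact ⟨_, y2⟩)
  have iK1 : NumberField (Qadj {Y2}) := nf_adjoin _ (by rintro x rfl; exact ⟨_, y2⟩)
  have iK2 : NumberField (Qadj {Ym}) := nf_adjoin _ (by rintro x rfl; exact ⟨_, ym⟩)
  have iK3 : NumberField (Qadj {Y2m}) := nf_adjoin _ (by rintro x rfl; exact ⟨_, y2m⟩)
  let A1 : Algebra (Qadj {Y2}) (Qadj {Ym, Y2}) := (IntermediateField.inclusion hK1).toRingHom.toAlgebra
  let A2 : Algebra (Qadj {Ym}) (Qadj {Ym, Y2}) := (IntermediateField.inclusion hK2).toRingHom.toAlgebra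
  let A3 : Algebra (Qadj {Y2m}) (Qadj {Ym, Y2}) := (IntermediateField.inclusion hK3).toRingHom.toAlgebra
  have sp1 : ∀ x ∈ Qadj {Ym, Y2}, ∃ a ∈ Qadj {Y2}, ∃ b ∈ Qadj {Y2}, x = a + b * Ym := by
    intro x hx
    refine gen_span _ Ym (by rw [ym]; exact natCast_mem _ _) {Ym, Y2} ?_ hx
    rintro x (rfl | rfl)
    · exact ⟨0, zero_mem _, 1, one_mem _, by simp⟩
    · exact ⟨_, a1, 0, zero_mem _, by simp⟩
  have sp2 : ∀ x ∈ Qadj {Ym, Y2}, ∃ a ∈ Qadj {Ym}, ∃ b ∈ Qadj {Ym}, x = a + b * Y2 := by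
    intro x hx
    refine gen_span _ Y2 (by rw [y2]; exact natCast_mem _ _) {Ym, Y2} ?_ hx
    rintro x (rfl | rfl)
    · exact ⟨_, a2, 0, zero_mem _, by simp⟩
    · exact ⟨0, zero_mem _, 1, one_mem _, by simp⟩
  have sp3 : ∀ x ∈ Qadj {Ym, Y2}, ∃ a ∈ Qadj {Y2m}, ∃ b ∈ Qadj {Y2m}, x = a + b * Y2 := by
    intro x hx
    refine gen_span _ Y2 (by rw [y2]; exact natCast_mem _ _) {Ym, Y2} ?_ hx
    rintro x (hx | rfl)
    · refine ⟨0, zero_mem _, Y2m / (2 : ℕ), div_mem a3 (natCast_mem _ _), ?_⟩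
      rw [hx, ymul]
      push_cast at y2 ⊢
      linear_combination (-Ym / 2) * y2
    · exact ⟨0, zero_mem _, 1, one_mem _, by simp⟩
  exact final_step hyp (Qadj {Ym, Y2}) (Qadj {Y2}) (Qadj {Ym}) (Qadj {Y2m}) (fun _ => rfl) (fun _ => rfl) (fun _ => rfl)
    hE2 hE3 hnsq Y2 Ym Y2m a1 a2 a3 mY2 mYm y2 ym y2m ymul ir2 irm ir2m
    (not_mem_quad Ym Y2 _ _ ym y2 ir2 irm (by rw [mul_comm, ← ymul]; exact ir2m))
    (not_mem_quad Y2 Ym _ _ y2 ym irm ir2 (by rw [← ymul]; exact ir2m))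
    (not_mem_quad Y2 Y2m _ _ y2 y2m ir2m ir2 (by
        have : Y2 * Y2m = Ym * (2 : ℕ) := by rw [ymul, ← y2]; ring
        rw [this]; exact irm.mul_natCast two_ne_zero))
    (fun x hx => rat_span Y2 _ y2 hx) (fun x hx => rat_span Ym _ ym hx) (fun x hx => rat_span Y2m _ y2m hx)
    sp1 sp2 sp3
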